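/- Let α ∈ ℝ∖ℚ be of bounded type and let s > 2. Then there exist v_0 ∈ G^s(𝕊¹), an energy E ∈ ℝ, K > 0, and a sequence v_n ∈ G^{s,K}(𝕊¹) with |v_n − v_0|_{s,K} → 0, such that L(S_{E,v_n}) does not converge to L(S_{E,v_0}); i.e. the Lyapunov exponent of quasiperiodic Schrödinger cocycles is discontinuous at v_0 in the G^s-topology. -/

import Mathlib

open Real MeasureTheory Filter
open scoped ENNReal

noncomputable section

/-- The Gevrey `(s,K)` weighted sup-norm of `f` on the set `I` (valued in `ℝ≥0∞`):
`|f|_{s,K} = (4π²/3) · sup_k (1+k)²/(K^k (k!)^s) · sup_{x∈I} |f^{(k)}(x)|`. -/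
def gevreyNormOn (s K : ℝ) (I : Set ℝ) (f : ℝ → ℝ) : ℝ≥0∞ :=
  ⨆ k : ℕ,
    ENNReal.ofReal (4 * π ^ 2 / 3 * ((1 + (k : ℝ)) ^ 2 / (K ^ k * ((k.factorial : ℝ)) ^ s))) *
      ⨆ x ∈ I, ENNReal.ofReal |iteratedDeriv k f x|

/-- The Gevrey `(s,K)` norm of a function on the circle `𝕊¹ = ℝ/2πℤ`, viewed as a
`2π`-periodic function on `ℝ`. -/
def gevreyNorm (s K : ℝ) (f : ℝ → ℝ) : ℝ≥0∞ := gevreyNormOn s K Set.univ f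

/-- `f` belongs to the Gevrey class `G^s(𝕊¹)`: it is smooth, `2π`-periodic and has finite
Gevrey `(s,K)` norm for some `K > 0`. -/
def GevreyCircle (s : ℝ) (f : ℝ → ℝ) : Prop :=
  ContDiff ℝ (⊤ : ℕ∞) f ∧ Function.Periodic f (2 * π) ∧ ∃ K > 0, gevreyNorm s K f < ⊤

/-- The operator norm of a `2×2` real matrix acting on Euclidean `ℝ²`. -/
def mnorm (A : Matrix (Fin 2) (Fin 2) ℝ) : ℝ :=
  ‖Matrix.toEuclideanCLM (𝕜 := ℝ) A‖

/-- The iterates of the quasiperiodic cocycle `(α, A)`: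
`A_n(x) = A(x + 2π(n-1)α) ⋯ A(x + 2πα) A(x)`. -/
def cocycleIter (α : ℝ) (A : ℝ → Matrix (Fin 2) (Fin 2) ℝ) : ℕ → ℝ → Matrix (Fin 2) (Fin 2) ℝ
  | 0, _ => 1
  | n + 1, x => A (x + 2 * π * n * α) * cocycleIter α A n x

/-- The Lyapunov exponent of the quasiperiodic cocycle `(α, A)`:
`L(A) = inf_{n ≥ 1} (1/n) ∫_{𝕊¹} log ‖A_n(x)‖ dx` (normalized measure on the circle). -/
def lyapunovExp (α : ℝ) (A : ℝ → Matrix (Fin 2) (Fin 2) ℝ) : ℝ :=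
  ⨅ n : ℕ, (1 / ((n : ℝ) + 1)) *
    ((2 * π)⁻¹ * ∫ x in (0 : ℝ)..(2 * π), Real.log (mnorm (cocycleIter α A (n + 1) x)))

/-- The denominator `q_n` of the `n`-th continued fraction convergent of `α`. -/
def cfDen (α : ℝ) (n : ℕ) : ℝ := (GenContFract.of α).dens n

/-- `α` is of bounded type with constant `M`: the continued fraction convergent denominators
satisfy `q_{n+1} ≤ M q_n` for all `n`. -/
def BoundedType (α M : ℝ) : Prop := ∀ n : ℕ, cfDen α (n + 1) ≤ M * cfDen α n

/-- The Schrödinger cocycle map `S_{E,v}(x) = [[E - v x, -1], [1, 0]]`. -/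
def schrodingerMap (E : ℝ) (v : ℝ → ℝ) (x : ℝ) : Matrix (Fin 2) (Fin 2) ℝ :=
  !![E - v x, -1; 1, 0]

/-! ### Badly approximable rotation numbers -/

theorem not_terminatedAt_of_irrational {α : ℝ} (hα : Irrational α) (n : ℕ) :
    ¬ (GenContFract.of α).TerminatedAt n := fun h =>
  hα <| by
    obtain ⟨q, hq⟩ := (GenContFract.terminates_iff_rat α).1 ⟨n, h⟩
    exact ⟨q, hq.symm⟩

theorem exists_int_contsAux {α : ℝ} (hα : Irrational α) (n : ℕ) :
    ∃ p q p' q' : ℤ, (GenContFract.of α).contsAux n = ⟨p, q⟩ ∧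
      (GenContFract.of α).contsAux (n + 1) = ⟨p', q'⟩ ∧ p * q' - q * p' ≠ 0 := by
  induction n with
  | zero =>
    refine ⟨1, 0, ⌊α⌋, 1, ?_, ?_, by norm_num⟩
    · simp [GenContFract.contsAux]
    · simp [GenContFract.contsAux, GenContFract.of_h_eq_floor]
  | succ n ih =>
    obtain ⟨p, q, p', q', h1, h2, h3⟩ := ih
    obtain ⟨gp, hgp⟩ := Option.ne_none_iff_exists'.1 (not_terminatedAt_of_irrational hα n)
    obtain ⟨ha, z, hz⟩ := GenContFract.of_partNum_eq_one_and_exists_int_partDen_eq hgp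
    refine ⟨p', q', z * p' + p, z * q' + q, h2, ?_, ?_⟩
    · rw [GenContFract.contsAux_recurrence hgp h1 h2, ha, hz]
      push_cast; simp
    · intro h; apply h3; linear_combination -h

/-- The distance of `x` to `2πℤ`. -/
def nd (x : ℝ) : ℝ := ‖(x : AddCircle (2 * π))‖

theorem exists_lower_bound_of_boundedType {α M : ℝ} (hα : Irrational α) (hM : 0 < M)
    (hb : BoundedType α M) : ∃ c > 0, ∀ k : ℕ, 1 ≤ k → ∀ p : ℤ, c / k ≤ |k * α - p| := by
  set g := GenContFract.of α with hg
  have hq0 : g.dens 0 = 1 := GenContFract.zeroth_den_eq_one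
  have hmono : Monotone g.dens := monotone_nat_of_le_succ fun n => GenContFract.of_den_mono
  have hpos : ∀ n, 1 ≤ g.dens n := fun n => hq0 ▸ hmono (Nat.zero_le n)
  have hM1 : 1 ≤ M := by
    have h1 := hb 0
    simp only [cfDen] at h1
    have h2 := hpos 1
    rw [← hg, hq0] at h1
    simpa using h2.trans h1
  refine ⟨1 / (4 * M ^ 2), by positivity, fun k hk p => ?_⟩
  have hk' : (1 : ℝ) ≤ k := by exact_mod_cast hk
  have hex : ∃ n, (2 : ℝ) * k < g.dens n := by
    refine ⟨2 * k + 5, ?_⟩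
    have h1 := GenContFract.succ_nth_fib_le_of_nth_den (v := α) (n := 2 * k + 5)
      (Or.inr (not_terminatedAt_of_irrational hα _))
    have h2 : 2 * k + 5 + 1 ≤ Nat.fib (2 * k + 5 + 1) := Nat.le_fib_self (by omega)
    have h3 : ((2 * k + 5 + 1 : ℕ) : ℝ) ≤ (Nat.fib (2 * k + 5 + 1) : ℝ) := by exact_mod_cast h2
    push_cast at h3
    linarith
  classical
  obtain ⟨n, hn, hmin⟩ : ∃ n, 2 * (k : ℝ) < g.dens n ∧ ∀ m < n, ¬ 2 * (k : ℝ) < g.dens m :=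
    ⟨Nat.find hex, Nat.find_spec hex, fun m hm => Nat.find_min hex hm⟩
  have hup : g.dens n ≤ 2 * M * k := by
    cases n with
    | zero => rw [hq0] at hn; linarith
    | succ n =>
      have h1 := hmin n (Nat.lt_succ_self n)
      have h2 := hb n
      simp only [cfDen] at h2
      rw [← hg] at h2
      push Not at h1
      nlinarith
  have hup' : g.dens (n + 1) ≤ 2 * M ^ 2 * k := by
    have h2 := hb n
    simp only [cfDen] at h2
    rw [← hg] at h2
    nlinarith
  have key : ∀ (m : ℕ) (a b : ℤ), n ≤ m → g.contsAux (m + 1) = ⟨a, b⟩ →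
      g.dens m ≤ 2 * M ^ 2 * k → (p * b - a * k ≠ 0) →
      1 / (4 * M ^ 2) / k ≤ |k * α - p| := by
    intro m a b hm hab hle hne
    have hden : g.dens m = b := by
      rw [GenContFract.den_eq_conts_b, GenContFract.nth_cont_eq_succ_nth_contAux, hab]
    have hnum : g.nums m = a := by
      rw [GenContFract.num_eq_conts_a, GenContFract.nth_cont_eq_succ_nth_contAux, hab]
    have h1 := GenContFract.abs_sub_convs_le (v := α) (not_terminatedAt_of_irrational hα m)
    rw [← hg, GenContFract.conv_eq_num_div_den, hnum, hden] at h1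
    have hb1 : 2 * (k : ℝ) < b := hden ▸ hn.trans_le (hmono hm)
    have hb2 : (b : ℝ) ≤ g.dens (m + 1) := hden ▸ hmono (Nat.le_succ m)
    have hb0 : (0 : ℝ) < b := by linarith
    have h2 : (1 : ℝ) ≤ |(p : ℝ) * b - a * k| := by exact_mod_cast Int.one_le_abs hne
    have h3 : |α - a / b| * b ≤ 1 / b := by
      calc |α - a / b| * b ≤ 1 / (b * g.dens (m + 1)) * b := by gcongr
        _ = 1 / g.dens (m + 1) := by field_simp
        _ ≤ 1 / b := by gcongr
    have h4 : |α - a / b| * b = |α * b - a| := by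
      rw [← abs_of_pos hb0, ← abs_mul, abs_of_pos hb0]; congr 1; field_simp
    have h5 : (1 : ℝ) ≤ |k * α - p| * b + k * |α * b - a| := by
      have : (p : ℝ) * b - a * k = -((k * α - p) * b) + k * (α * b - a) := by ring
      rw [this] at h2
      refine h2.trans ((abs_add_le _ _).trans ?_)
      rw [abs_neg, abs_mul, abs_mul, abs_of_pos hb0, abs_of_pos (by linarith : (0:ℝ) < k)]
    have h6 : k * |α * b - a| ≤ 1 / 2 := by
      rw [← h4]
      calc (k : ℝ) * (|α - a / b| * b) ≤ k * (1 / b) := by gcongr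
        _ = k / b := by ring
        _ ≤ 1 / 2 := by rw [div_le_div_iff₀ hb0 two_pos]; linarith
    have h7 : 1 / 2 ≤ |k * α - p| * (2 * M ^ 2 * k) := by
      have : |k * α - p| * b ≤ |k * α - p| * (2 * M ^ 2 * k) := by gcongr; rw [← hden]; exact hle
      linarith
    rw [div_div, div_le_iff₀ (by positivity)]
    linarith
  obtain ⟨a, b, a', b', h1, h2, h3⟩ := exists_int_contsAux hα (n + 1)
  by_cases h : (p * b - a * k : ℤ) = 0
  · refine key (n + 1) a' b' (Nat.le_succ n) h2 hup' fun h' => ?_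
    have hk0 : (k : ℤ) ≠ 0 := by positivity
    have e1 : (a * b' - b * a') * k = 0 := by linear_combination (-b') * h + b * h'
    rcases mul_eq_zero.1 e1 with e | e
    · exact h3 e
    · exact hk0 e
  · refine key n a b le_rfl h1 (hup.trans ?_) h
    nlinarith [mul_nonneg (sub_nonneg.2 hM1) (by linarith : (0:ℝ) ≤ k)]

theorem nd_sub_le (x y : ℝ) : nd (x - y) ≤ nd x + nd y := norm_sub_le (x : AddCircle (2 * π)) y

theorem nd_eq (x : ℝ) : nd x = |x - round (x / (2 * π)) * (2 * π)| := by
  rw [nd, AddCircle.norm_eq, inv_mul_eq_div]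

theorem nd_le_abs (x : ℝ) : nd x ≤ |x| := by
  have := round_le (x / (2 * π)) 0
  rw [nd_eq]
  have h2 : (0 : ℝ) < 2 * π := by positivity
  have : |x / (2 * π) - round (x / (2 * π))| * (2 * π) ≤
      |x / (2 * π) - ((0 : ℤ) : ℝ)| * (2 * π) := by
    gcongr
  rw [← abs_of_pos h2, ← abs_mul, ← abs_mul, abs_of_pos h2] at this
  rw [sub_mul, sub_mul, div_mul_cancel₀ x h2.ne'] at this
  simpa using this

theorem nd_continuous : Continuous nd :=
  continuous_norm.comp (AddCircle.continuous_mk' (2 * π))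

theorem exists_nd_lower_bound {α M : ℝ} (hα : Irrational α) (hM : 0 < M)
    (hb : BoundedType α M) : ∃ c > 0, ∀ k : ℕ, 1 ≤ k → c / k ≤ nd (k * (2 * π * α)) := by
  obtain ⟨c, hc, h⟩ := exists_lower_bound_of_boundedType hα hM hb
  refine ⟨c * (2 * π), by positivity, fun k hk => ?_⟩
  rw [nd_eq]
  have h2 : (0 : ℝ) < 2 * π := by positivity
  have := h k hk (round (k * (2 * π * α) / (2 * π)))
  have h3 := mul_le_mul_of_nonneg_right this h2.le
  rw [← abs_of_pos h2, ← abs_mul, abs_of_pos h2] at h3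
  rw [sub_mul] at h3
  calc c * (2 * π) / k = c / k * (2 * π) := by ring
    _ ≤ _ := h3
    _ = _ := by congr 2; ring

local notation "Smooth" => ContDiff ℝ ((⊤ : ℕ∞) : WithTop ℕ∞)

/-! ### Truncated Gevrey jet norms -/

/-- The Gevrey norm with index `s` and scale `K` of the `n`-jet of `f` at `x`. -/
def jn (s K : ℝ) (n : ℕ) (x : ℝ) (f : ℝ → ℝ) : ℝ :=
  ∑ k ∈ Finset.range (n + 1), |iteratedDeriv k f x| / ((k.factorial : ℝ) ^ s * K ^ k)

section Jet

variable {s K : ℝ} {n : ℕ} {x : ℝ} {f g : ℝ → ℝ}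

theorem contDiffAt_nat (hf : Smooth f) (k : ℕ) (x : ℝ) : ContDiffAt ℝ k f x :=
  (hf.of_le (by exact_mod_cast le_top)).contDiffAt

theorem jn_nonneg (hK : 0 < K) : 0 ≤ jn s K n x f :=
  Finset.sum_nonneg fun _ _ => by positivity

theorem abs_iteratedDeriv_le_jn (hK : 0 < K) {k : ℕ} (hk : k ≤ n) :
    |iteratedDeriv k f x| ≤ jn s K n x f * ((k.factorial : ℝ) ^ s * K ^ k) := by
  rw [← div_le_iff₀ (by positivity)]
  exact Finset.single_le_sum (f := fun k => |iteratedDeriv k f x| / ((k.factorial : ℝ) ^ s * K ^ k))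
    (fun _ _ => by positivity) (Finset.mem_range.2 (Nat.lt_succ_of_le hk))

theorem jn_congr (h : f =ᶠ[nhds x] g) : jn s K n x f = jn s K n x g :=
  Finset.sum_congr rfl fun k _ => by rw [h.iteratedDeriv_eq k]

theorem jn_comp_add (a : ℝ) : jn s K n x (fun y => f (y + a)) = jn s K n (x + a) f :=
  Finset.sum_congr rfl fun k _ => by rw [iteratedDeriv_comp_add_const]

theorem jn_const (c : ℝ) : jn s K n x (fun _ => c) = |c| := by
  rw [jn, Finset.sum_eq_single 0]
  · simp
  · intro k _ hk; simp [iteratedDeriv_const, hk]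
  · simp

theorem jn_const_mul (c : ℝ) : jn s K n x (fun y => c * f y) = |c| * jn s K n x f := by
  rw [jn, jn, Finset.mul_sum]
  exact Finset.sum_congr rfl fun k _ => by
    rw [iteratedDeriv_const_mul_field, abs_mul, mul_div_assoc]

theorem jn_neg : jn s K n x (fun y => -f y) = jn s K n x f := by
  simpa using jn_const_mul (s := s) (K := K) (n := n) (x := x) (f := f) (-1)

theorem jn_add_le (hK : 0 < K) (hf : Smooth f) (hg : Smooth g) :
    jn s K n x (fun y => f y + g y) ≤ jn s K n x f + jn s K n x g := by
  rw [jn, jn, jn, ← Finset.sum_add_distrib]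
  refine Finset.sum_le_sum fun k _ => ?_
  rw [← add_div, iteratedDeriv_fun_add (contDiffAt_nat hf k x) (contDiffAt_nat hg k x)]
  gcongr
  exact abs_add_le _ _

theorem jn_sub_le (hK : 0 < K) (hf : Smooth f) (hg : Smooth g) :
    jn s K n x (fun y => f y - g y) ≤ jn s K n x f + jn s K n x g := by
  simp only [sub_eq_add_neg]
  exact (jn_add_le hK hf hg.neg).trans_eq (by rw [jn_neg])

theorem factorial_rpow_le (hs : 1 ≤ s) {i k : ℕ} (h : i ≤ k) :
    (k.choose i : ℝ) * ((i.factorial : ℝ) ^ s * ((k - i).factorial : ℝ) ^ s) ≤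
      (k.factorial : ℝ) ^ s := by
  have h1 := Nat.choose_mul_factorial_mul_factorial h
  have h2 : (k.factorial : ℝ) = k.choose i * ((i.factorial : ℝ) * ((k - i).factorial : ℝ)) := by
    rw [← h1]; push_cast; ring
  have hc : (1 : ℝ) ≤ k.choose i := by exact_mod_cast Nat.choose_pos h
  rw [h2, mul_rpow (by positivity) (by positivity), mul_rpow (by positivity) (by positivity)]
  gcongr
  exact self_le_rpow_of_one_le hc hs

theorem jn_mul_le (hs : 1 ≤ s) (hK : 0 < K) (hf : Smooth f) (hg : Smooth g) :
    jn s K n x (fun y => f y * g y) ≤ jn s K n x f * jn s K n x g := by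
  set F : ℕ → ℝ := fun k => |iteratedDeriv k f x| / ((k.factorial : ℝ) ^ s * K ^ k) with hF
  set G : ℕ → ℝ := fun k => |iteratedDeriv k g x| / ((k.factorial : ℝ) ^ s * K ^ k) with hG
  have hF0 : ∀ k, 0 ≤ F k := fun k => by positivity
  have hG0 : ∀ k, 0 ≤ G k := fun k => by positivity
  calc jn s K n x (fun y => f y * g y)
      ≤ ∑ k ∈ Finset.range (n + 1), ∑ i ∈ Finset.range (k + 1), F i * G (k - i) := by
        refine Finset.sum_le_sum fun k _ => ?_
        rw [iteratedDeriv_fun_mul (contDiffAt_nat hf k x) (contDiffAt_nat hg k x),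
          div_le_iff₀ (by positivity), Finset.sum_mul]
        refine (Finset.abs_sum_le_sum_abs _ _).trans (Finset.sum_le_sum fun i hi => ?_)
        have hi' : i ≤ k := Nat.lt_succ_iff.1 (Finset.mem_range.1 hi)
        rw [abs_mul, abs_mul, Nat.abs_cast]
        have e1 : |iteratedDeriv i f x| = F i * ((i.factorial : ℝ) ^ s * K ^ i) := by
          rw [hF]; field_simp
        have e2 : |iteratedDeriv (k - i) g x| =
            G (k - i) * (((k - i).factorial : ℝ) ^ s * K ^ (k - i)) := by
          rw [hG]; field_simp
        rw [e1, e2]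
        have e3 : K ^ k = K ^ i * K ^ (k - i) := by rw [← pow_add, Nat.add_sub_cancel' hi']
        calc _ = F i * G (k - i) * ((k.choose i : ℝ) * ((i.factorial : ℝ) ^ s *
              ((k - i).factorial : ℝ) ^ s) * K ^ k) := by rw [e3]; ring
          _ ≤ _ := by
            have := hF0 i
            have := hG0 (k - i)
            gcongr
            exact factorial_rpow_le hs hi'
    _ = ∑ i ∈ Finset.range (n + 1), ∑ j ∈ Finset.range (n + 1 - i), F i * G j :=
        Finset.sum_range_diag_flip (n + 1) fun i j => F i * G j
    _ ≤ ∑ i ∈ Finset.range (n + 1), ∑ j ∈ Finset.range (n + 1), F i * G j := by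
        refine Finset.sum_le_sum fun i _ => Finset.sum_le_sum_of_subset_of_nonneg ?_ ?_
        · exact Finset.range_mono (Nat.sub_le _ _)
        · intro j _ _; exact mul_nonneg (hF0 i) (hG0 j)
    _ = _ := by rw [jn, jn, Finset.sum_mul_sum]

theorem jn_prod_le {ι : Type*} (t : Finset ι) (F : ι → ℝ → ℝ) (hs : 1 ≤ s) (hK : 0 < K)
    (hF : ∀ i ∈ t, Smooth (F i)) :
    jn s K n x (fun y => ∏ i ∈ t, F i y) ≤ ∏ i ∈ t, jn s K n x (F i) := by
  classical
  induction t using Finset.induction_on with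
  | empty => simp [jn_const]
  | insert a t ha ih =>
    simp only [Finset.prod_insert ha]
    refine (jn_mul_le hs hK (hF a (by simp))
      (contDiff_prod fun i hi => hF i (by simp [hi]))).trans ?_
    exact mul_le_mul_of_nonneg_left (ih fun i hi => hF i (by simp [hi])) (jn_nonneg hK)

theorem jn_pow_le (hs : 1 ≤ s) (hK : 0 < K) (hf : Smooth f) (m : ℕ) :
    jn s K n x (fun y => f y ^ m) ≤ jn s K n x f ^ m := by
  simpa using jn_prod_le (n := n) (x := x) (Finset.range m) (fun _ => f) hs hK fun _ _ => hf

theorem jn_inv_le (hs : 1 ≤ s) (hK : 0 < K) (hf : Smooth f) (hf0 : ∀ y, f y ≠ 0) {c δ : ℝ}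
    (h : jn s K n x (fun y => f y - c) ≤ δ) (hδ : δ < c) :
    jn s K n x (fun y => (f y)⁻¹) ≤ (c - δ)⁻¹ := by
  have hδ0 : 0 ≤ δ := (jn_nonneg hK).trans h
  have hi : Smooth (fun y => (f y)⁻¹) := hf.inv hf0
  have e : (fun y => c * (f y)⁻¹) = fun y => 1 - (f y - c) * (f y)⁻¹ := by
    funext y; have := hf0 y; field_simp; ring
  have h1 : c * jn s K n x (fun y => (f y)⁻¹) ≤ 1 + δ * jn s K n x (fun y => (f y)⁻¹) := by
    calc c * jn s K n x (fun y => (f y)⁻¹) = jn s K n x (fun y => c * (f y)⁻¹) := by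
          rw [jn_const_mul, abs_of_nonneg (by linarith)]
      _ ≤ jn s K n x (fun _ => 1) + jn s K n x (fun y => (f y - c) * (f y)⁻¹) := by
          rw [e]
          exact jn_sub_le hK contDiff_const ((hf.sub contDiff_const).mul hi)
      _ ≤ 1 + jn s K n x (fun y => f y - c) * jn s K n x (fun y => (f y)⁻¹) := by
          rw [jn_const, abs_one]
          gcongr
          exact jn_mul_le hs hK (hf.sub contDiff_const) hi
      _ ≤ _ := by
          gcongr
          exact jn_nonneg hK
  rw [← one_div, le_div_iff₀ (by linarith)]
  linarith

end Jet

/-! ### A Gevrey bump function -/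

/-- The flat function `exp (-x ^ (-q))` on `x > 0`, extended by zero. -/
def flatFn (q : ℕ) (x : ℝ) : ℝ := expNegInvGlue (x ^ q)

theorem flatFn_contDiff (q : ℕ) : Smooth (flatFn q) :=
  expNegInvGlue.contDiff.comp (contDiff_id.pow q)

theorem flatFn_of_nonpos {q : ℕ} (hq : Odd q) {x : ℝ} (hx : x ≤ 0) : flatFn q x = 0 :=
  expNegInvGlue.zero_of_nonpos (hq.pow_nonpos hx)

theorem flatFn_of_pos (q : ℕ) {x : ℝ} (hx : 0 < x) : flatFn q x = exp (-(x ^ q)⁻¹) := by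
  rw [flatFn, expNegInvGlue, if_neg (not_le.2 (pow_pos hx q))]

theorem flatFn_nonneg (q : ℕ) (x : ℝ) : 0 ≤ flatFn q x := expNegInvGlue.nonneg _

theorem flatFn_le_one (q : ℕ) (x : ℝ) : flatFn q x ≤ 1 := by
  rw [flatFn, expNegInvGlue]
  split_ifs with h
  · exact zero_le_one
  · exact exp_le_one_iff.2 (neg_nonpos.2 (inv_nonneg.2 (not_le.1 h).le))

theorem iteratedDeriv_ofReal_re {F : ℂ → ℂ} {U : Set ℂ} (hF : AnalyticOnNhd ℂ F U)
    (hU : IsOpen U) (k : ℕ) {x : ℝ} (hx : (x : ℂ) ∈ U) :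
    iteratedDeriv k (fun y : ℝ => (F y).re) x = (iteratedDeriv k F x).re := by
  induction k generalizing x with
  | zero => simp
  | succ k ih =>
    rw [iteratedDeriv_succ, iteratedDeriv_succ]
    have hev : iteratedDeriv k (fun y : ℝ => (F y).re) =ᶠ[nhds x]
        fun y : ℝ => (iteratedDeriv k F y).re := by
      filter_upwards [(hU.preimage Complex.continuous_ofReal).mem_nhds hx] with y hy
      exact ih hy
    rw [hev.deriv_eq]
    have hd : DifferentiableAt ℂ (iteratedDeriv k F) x := by
      rw [iteratedDeriv_eq_iterate]
      exact (hF.iterated_deriv k x hx).differentiableAt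
    exact hd.hasDerivAt.real_of_complex.deriv

theorem exists_re_inv_pow_ge (q : ℕ) :
    ∃ θ : ℝ, 0 < θ ∧ θ < 1 ∧ ∀ u : ℂ, ‖u‖ ≤ θ → 1 / 2 ≤ (((1 + u) ^ q)⁻¹).re := by
  have hc : ContinuousAt (fun u : ℂ => (((1 + u) ^ q)⁻¹).re) 0 := by
    refine Complex.continuous_re.continuousAt.comp (ContinuousAt.inv₀ (by fun_prop) (by simp))
  have h1 : ∀ᶠ u in nhds (0 : ℂ), 1 / 2 < (((1 + u) ^ q)⁻¹).re :=
    hc.eventually (lt_mem_nhds (by norm_num))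
  obtain ⟨ε, hε, h⟩ := Metric.eventually_nhds_iff.1 h1
  refine ⟨min (ε / 2) (1 / 2), by positivity, by
    exact (min_le_right _ _).trans_lt (by norm_num), fun u hu => (h ?_).le⟩
  rw [dist_zero_right]
  exact (hu.trans (min_le_left _ _)).trans_lt (by linarith)

theorem exp_neg_inv_pow_le {q : ℕ} (hq : 1 ≤ q) (k : ℕ) {x : ℝ} (hx : 0 < x) :
    exp (-(x ^ q)⁻¹ / 2) / x ^ k ≤ 2 ^ k * (k.factorial : ℝ) ^ (1 / q : ℝ) := by
  have hq0 : (q : ℝ) ≠ 0 := by positivity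
  set t := (x ^ q)⁻¹ with ht
  have ht0 : 0 < t := by positivity
  have h1 : (exp (-t / 2) / x ^ k) ^ q ≤ (2 ^ k * (k.factorial : ℝ) ^ (1 / q : ℝ)) ^ q := by
    have e1 : (exp (-t / 2) / x ^ k) ^ q = t ^ k * exp (-(q * t / 2)) := by
      rw [div_pow, ← exp_nat_mul, ← pow_mul, mul_comm k q, pow_mul, ht, inv_pow, div_eq_mul_inv,
        mul_comm]
      congr 2; ring
    have e2 : (2 ^ k * (k.factorial : ℝ) ^ (1 / q : ℝ)) ^ q = 2 ^ (k * q) * k.factorial := by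
      rw [mul_pow, ← pow_mul, ← rpow_natCast (_ ^ _) q, ← rpow_mul (by positivity),
        one_div_mul_cancel hq0, rpow_one]
    rw [e1, e2, exp_neg, ← div_eq_mul_inv, div_le_iff₀ (exp_pos _)]
    have h3 := pow_div_factorial_le_exp (q * t / 2) (by positivity) k
    rw [div_le_iff₀ (by positivity)] at h3
    have hq1 : (1 : ℝ) ≤ q := by exact_mod_cast hq
    calc t ^ k ≤ 2 ^ k * (q * t / 2) ^ k := by
          rw [← mul_pow]; gcongr; nlinarith
      _ ≤ 2 ^ (k * q) * (exp (q * t / 2) * k.factorial) := by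
          gcongr
          · norm_num
          · exact Nat.le_mul_of_pos_right k hq
      _ = _ := by ring
  exact le_of_pow_le_pow_left₀ (by omega) (by positivity) h1

theorem exists_iteratedDeriv_flatFn_le {q : ℕ} (hq : Odd q) :
    ∃ D : ℝ, 0 < D ∧ ∀ (k : ℕ) (x : ℝ),
      |iteratedDeriv k (flatFn q) x| ≤ D ^ k * (k.factorial : ℝ) ^ (1 + 1 / q : ℝ) := by
  obtain ⟨θ, hθ, hθ1, hre⟩ := exists_re_inv_pow_ge q
  have hq1 : 1 ≤ q := hq.pos
  refine ⟨2 / θ, by positivity, fun k => ?_⟩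
  have hposcase : ∀ x : ℝ, 0 < x → |iteratedDeriv k (flatFn q) x| ≤
      (2 / θ) ^ k * (k.factorial : ℝ) ^ (1 + 1 / q : ℝ) := by
    intro x hx
    set F : ℂ → ℂ := fun z => Complex.exp (-(z ^ q)⁻¹) with hF
    set U : Set ℂ := {z | z ≠ 0} with hU
    have hUo : IsOpen U := isOpen_ne
    have hdiff : DifferentiableOn ℂ F U := by
      intro z hz
      have : z ^ q ≠ 0 := pow_ne_zero q hz
      exact (((differentiableAt_id.pow q).inv this).neg.cexp).differentiableWithinAt
    have han : AnalyticOnNhd ℂ F U := fun z hz => hdiff.analyticAt (hUo.mem_nhds hz)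
    have hxU : (x : ℂ) ∈ U := by simpa [hU] using hx.ne'
    have hev : flatFn q =ᶠ[nhds x] fun y : ℝ => (F y).re := by
      filter_upwards [lt_mem_nhds hx] with y hy
      rw [flatFn_of_pos q hy]
      change _ = (Complex.exp (-((y : ℂ) ^ q)⁻¹)).re
      rw [← Complex.ofReal_pow, ← Complex.ofReal_inv, ← Complex.ofReal_neg, Complex.exp_ofReal_re]
    rw [hev.iteratedDeriv_eq, iteratedDeriv_ofReal_re han hUo k hxU]
    refine (Complex.abs_re_le_norm _).trans ?_
    have hR : 0 < θ * x := by positivity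
    have hball : ∀ z ∈ Metric.closedBall (x : ℂ) (θ * x), z ∈ U ∧
        ‖F z‖ ≤ exp (-(x ^ q)⁻¹ / 2) := by
      intro z hz
      have hx0 : (x : ℂ) ≠ 0 := hxU
      set u : ℂ := (z - x) / x with hu
      have hzu : z = x * (1 + u) := by rw [hu]; field_simp; ring
      have hun : ‖u‖ ≤ θ := by
        rw [hu, norm_div, Complex.norm_of_nonneg hx.le, div_le_iff₀ hx]
        simpa [dist_eq_norm] using hz
      have h1u : 1 + u ≠ 0 := by
        intro h0
        have := hre u hun
        rw [h0] at this
        simp [hq.pos.ne'] at this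
        norm_num at this
      refine ⟨by rw [hzu]; exact mul_ne_zero hx0 h1u, ?_⟩
      rw [hF, Complex.norm_exp, exp_le_exp, hzu, mul_pow, mul_inv, ← Complex.ofReal_pow,
        ← Complex.ofReal_inv, Complex.neg_re, Complex.re_ofReal_mul]
      have := hre u hun
      have h2 : 0 < (x ^ q)⁻¹ := by positivity
      nlinarith
    have hcl : DiffContOnCl ℂ F (Metric.ball (x : ℂ) (θ * x)) := by
      refine DifferentiableOn.diffContOnCl fun z hz => ?_
      rw [closure_ball _ hR.ne'] at hz
      exact (han z (hball z hz).1).differentiableAt.differentiableWithinAt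
    refine (Complex.norm_iteratedDeriv_le_of_forall_mem_sphere_norm_le k hR hcl
      fun z hz => (hball z (Metric.sphere_subset_closedBall hz)).2).trans ?_
    have h5 := exp_neg_inv_pow_le hq1 k hx
    have hk0 : (0 : ℝ) < k.factorial := by positivity
    calc k.factorial * exp (-(x ^ q)⁻¹ / 2) / (θ * x) ^ k
        = k.factorial / θ ^ k * (exp (-(x ^ q)⁻¹ / 2) / x ^ k) := by rw [mul_pow]; field_simp
      _ ≤ k.factorial / θ ^ k * (2 ^ k * (k.factorial : ℝ) ^ (1 / q : ℝ)) := by gcongr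
      _ = _ := by rw [rpow_add hk0, rpow_one, div_pow]; ring
  have hbound0 : 0 ≤ (2 / θ) ^ k * (k.factorial : ℝ) ^ (1 + 1 / q : ℝ) := by positivity
  have hcont : Continuous (iteratedDeriv k (flatFn q)) :=
    (flatFn_contDiff q).continuous_iteratedDeriv k (by exact_mod_cast le_top)
  have hneg : ∀ x : ℝ, x < 0 → iteratedDeriv k (flatFn q) x = 0 := by
    intro x hx
    have : flatFn q =ᶠ[nhds x] fun _ => (0 : ℝ) := by
      filter_upwards [gt_mem_nhds hx] with y hy
      exact flatFn_of_nonpos hq hy.le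
    rw [this.iteratedDeriv_eq]
    simp
  intro x
  rcases lt_trichotomy x 0 with hx | rfl | hx
  · rw [hneg x hx, abs_zero]; exact hbound0
  · have hclosed : IsClosed {x : ℝ | |iteratedDeriv k (flatFn q) x| ≤
        (2 / θ) ^ k * (k.factorial : ℝ) ^ (1 + 1 / q : ℝ)} :=
      isClosed_le hcont.abs continuous_const
    have hsub : Set.Ioi (0 : ℝ) ⊆ {x : ℝ | |iteratedDeriv k (flatFn q) x| ≤
        (2 / θ) ^ k * (k.factorial : ℝ) ^ (1 + 1 / q : ℝ)} := fun x hx => hposcase x hx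
    have := hclosed.closure_subset_iff.2 hsub
    rw [closure_Ioi] at this
    exact this (Set.mem_Ici.2 le_rfl)
  · exact hposcase x hx

/-- The derivatives of `f` satisfy the Gevrey estimate of index `s` with constants `A`, `D`. -/
def GevreyBound (s A D : ℝ) (f : ℝ → ℝ) : Prop :=
  ∀ (k : ℕ) (x : ℝ), |iteratedDeriv k f x| ≤ A * D ^ k * (k.factorial : ℝ) ^ s

section GevreyBound

variable {s A D K : ℝ} {n : ℕ} {x : ℝ} {f : ℝ → ℝ}

theorem GevreyBound.mono (h : GevreyBound s A D f) {s' : ℝ} (hA : 0 ≤ A) (hD : 0 ≤ D)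
    (hs : s ≤ s') : GevreyBound s' A D f := fun k x => by
  refine (h k x).trans ?_
  gcongr
  exact_mod_cast Nat.one_le_iff_ne_zero.2 k.factorial_ne_zero

theorem GevreyBound.jn_tail_le (h : GevreyBound s A D f) (hA : 0 ≤ A) (hD : 0 < D)
    (hK : 2 * D ≤ K) : ∑ k ∈ Finset.range n,
      |iteratedDeriv (k + 1) f x| / (((k + 1).factorial : ℝ) ^ s * K ^ (k + 1)) ≤
      2 * A * D / K := by
  have hK0 : 0 < K := by linarith
  have hDK : D / K ≤ 1 / 2 := by rw [div_le_div_iff₀ hK0 two_pos]; linarith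
  have hDK0 : 0 ≤ D / K := by positivity
  calc _ ≤ ∑ k ∈ Finset.range n, A * (D / K) * (D / K) ^ k := by
        refine Finset.sum_le_sum fun k _ => ?_
        rw [div_le_iff₀ (by positivity)]
        refine (h (k + 1) x).trans_eq ?_
        rw [div_pow, pow_succ, pow_succ]
        field_simp
    _ = A * (D / K) * ∑ k ∈ Finset.range n, (D / K) ^ k := by rw [Finset.mul_sum]
    _ ≤ A * (D / K) * 2 := by
        gcongr
        have h1 := geom_sum_Ico_le_of_lt_one (m := 0) (n := n) hDK0 (by linarith)
        rw [← Finset.range_eq_Ico] at h1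
        refine h1.trans ?_
        rw [pow_zero, div_le_iff₀ (by linarith)]
        linarith
    _ = _ := by ring

theorem GevreyBound.jn_le (h : GevreyBound s A D f) (hA : 0 ≤ A) (hD : 0 < D)
    (hK : 2 * D ≤ K) : jn s K n x f ≤ |f x| + 2 * A * D / K := by
  rw [jn, Finset.sum_range_succ', add_comm]
  gcongr
  · simp
  · exact h.jn_tail_le hA hD hK

theorem GevreyBound.jn_sub_le (h : GevreyBound s A D f) (hA : 0 ≤ A) (hD : 0 < D)
    (hf : Smooth f) (hK : 2 * D ≤ K) : jn s K n x (fun y => f y - f x) ≤ 2 * A * D / K := by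
  rw [jn, Finset.sum_range_succ']
  simp only [iteratedDeriv_zero, sub_self, abs_zero, zero_div, add_zero]
  refine le_trans (le_of_eq ?_) (h.jn_tail_le (n := n) (x := x) hA hD hK)
  refine Finset.sum_congr rfl fun k _ => ?_
  rw [iteratedDeriv_fun_sub (contDiffAt_nat hf _ _) contDiffAt_const]
  simp [iteratedDeriv_const]

theorem GevreyBound.of_jn_le (hK : 0 < K) (h : ∀ n x, jn s K n x f ≤ A) :
    GevreyBound s A K f := fun k x => by
  refine (abs_iteratedDeriv_le_jn (s := s) hK le_rfl).trans ?_
  rw [mul_assoc, mul_comm (K ^ k)]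
  gcongr
  exact h k x

theorem iteratedDeriv_comp_affine (hf : Smooth f) (k : ℕ) (a b : ℝ) :
    iteratedDeriv k (fun x => f (a + b * x)) x = b ^ k * iteratedDeriv k f (a + b * x) := by
  have h1 : Smooth (fun z => f (a + z)) := hf.comp (contDiff_const.add contDiff_id)
  have := congrFun (iteratedDeriv_comp_const_mul (n := k)
    (h1.of_le (by exact_mod_cast le_top)) b) x
  rw [this, iteratedDeriv_comp_const_add]

theorem GevreyBound.comp_affine (h : GevreyBound s A D f) (hf : Smooth f) (a b : ℝ) :
    GevreyBound s A (|b| * D) (fun x => f (a + b * x)) := fun k x => by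
  rw [iteratedDeriv_comp_affine hf, abs_mul, abs_pow, mul_pow]
  calc |b| ^ k * _ ≤ |b| ^ k * (A * D ^ k * (k.factorial : ℝ) ^ s) := by gcongr; exact h k _
    _ = _ := by ring

end GevreyBound

/-- A smooth transition from `0` on `x ≤ 0` to `1` on `1 ≤ x`. -/
def flatStep (q : ℕ) (x : ℝ) : ℝ := flatFn q x * (flatFn q x + flatFn q (1 + -1 * x))⁻¹

section flatStep

variable {q : ℕ}

theorem flatFn_ge {x : ℝ} (hx : 1 / 2 ≤ x) : exp (-2 ^ q) ≤ flatFn q x := by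
  have h0 : 0 < x := by linarith
  rw [flatFn_of_pos q h0, exp_le_exp, neg_le_neg_iff, ← inv_pow]
  gcongr
  rw [inv_le_comm₀ h0 two_pos]
  linarith

theorem flatStep_den_ge (x : ℝ) : exp (-2 ^ q) ≤ flatFn q x + flatFn q (1 + -1 * x) := by
  rcases le_total (1 / 2) x with h | h
  · linarith [flatFn_ge (q := q) h, flatFn_nonneg q (1 + -1 * x)]
  · linarith [flatFn_ge (q := q) (x := 1 + -1 * x) (by linarith), flatFn_nonneg q x]

theorem flatStep_den_ne (x : ℝ) : flatFn q x + flatFn q (1 + -1 * x) ≠ 0 :=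
  ((exp_pos _).trans_le (flatStep_den_ge x)).ne'

theorem flatStep_den_contDiff : Smooth (fun x => flatFn q x + flatFn q (1 + -1 * x)) :=
  (flatFn_contDiff q).add
    ((flatFn_contDiff q).comp (contDiff_const.add (contDiff_const.mul contDiff_id)))

theorem flatStep_contDiff : Smooth (flatStep q) :=
  (flatFn_contDiff q).mul (flatStep_den_contDiff.inv flatStep_den_ne)

theorem flatStep_nonneg (x : ℝ) : 0 ≤ flatStep q x :=
  mul_nonneg (flatFn_nonneg q x) (inv_nonneg.2 ((exp_pos _).trans_le (flatStep_den_ge x)).le)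

theorem flatStep_le_one (x : ℝ) : flatStep q x ≤ 1 := by
  rw [flatStep, ← div_eq_mul_inv, div_le_one ((exp_pos _).trans_le (flatStep_den_ge x))]
  linarith [flatFn_nonneg q (1 + -1 * x)]

theorem flatStep_of_nonpos (hq : Odd q) {x : ℝ} (hx : x ≤ 0) : flatStep q x = 0 := by
  rw [flatStep, flatFn_of_nonpos hq hx, zero_mul]

theorem flatStep_of_one_le (hq : Odd q) {x : ℝ} (hx : 1 ≤ x) : flatStep q x = 1 := by
  have h := flatStep_den_ne (q := q) x
  rw [flatFn_of_nonpos hq (by linarith : 1 + -1 * x ≤ 0), add_zero] at h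
  rw [flatStep, flatFn_of_nonpos hq (by linarith : 1 + -1 * x ≤ 0), add_zero, mul_inv_cancel₀ h]

theorem exists_gevreyBound_flatStep (hq : Odd q) {s : ℝ} (hs : 1 + 1 / (q : ℝ) ≤ s) :
    ∃ A D : ℝ, 0 < A ∧ 0 < D ∧ GevreyBound s A D (flatStep q) := by
  obtain ⟨D, hD, h⟩ := exists_iteratedDeriv_flatFn_le hq
  have hs1 : 1 ≤ s := le_trans (by linarith [show (0 : ℝ) ≤ 1 / q by positivity]) hs
  have hg : GevreyBound s 1 D (flatFn q) :=
    GevreyBound.mono (fun k x => by simpa using h k x) zero_le_one hD.le hs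
  have hg' : GevreyBound s 1 D (fun x => flatFn q (1 + -1 * x)) := by
    simpa using hg.comp_affine (flatFn_contDiff q) 1 (-1)
  have hsm' : Smooth (fun x => flatFn q (1 + -1 * x)) :=
    (flatFn_contDiff q).comp (contDiff_const.add (contDiff_const.mul contDiff_id))
  have hden : GevreyBound s 2 D (fun x => flatFn q x + flatFn q (1 + -1 * x)) := fun k x => by
    rw [iteratedDeriv_fun_add (contDiffAt_nat (flatFn_contDiff q) k x) (contDiffAt_nat hsm' k x)]
    refine (abs_add_le _ _).trans ((add_le_add (hg k x) (hg' k x)).trans_eq (by ring))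
  set c := exp (-2 ^ q : ℝ) with hc
  have hc0 : 0 < c := exp_pos _
  set K := 2 * D + 8 * D / c with hK
  have hK0 : 0 < K := by positivity
  have hK1 : 2 * D ≤ K := by rw [hK]; linarith [show 0 < 8 * D / c by positivity]
  have hK2 : 2 * 2 * D / K ≤ c / 2 := by
    rw [div_le_div_iff₀ hK0 two_pos, hK, mul_add, mul_div_assoc', mul_comm c (8 * D),
      mul_div_assoc, div_self hc0.ne']
    nlinarith
  refine ⟨(1 + 2 * 1 * D / K) * (c / 2)⁻¹, K, by positivity, hK0, .of_jn_le hK0 fun n x => ?_⟩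
  refine (jn_mul_le hs1 hK0 (flatFn_contDiff q)
    (flatStep_den_contDiff.inv flatStep_den_ne)).trans ?_
  gcongr
  · exact jn_nonneg hK0
  · refine (hg.jn_le zero_le_one hD hK1).trans ?_
    gcongr
    rw [abs_of_nonneg (flatFn_nonneg _ _)]
    exact flatFn_le_one _ _
  · have hx := flatStep_den_ge (q := q) x
    refine (jn_inv_le hs1 hK0 flatStep_den_contDiff flatStep_den_ne
      ((hden.jn_sub_le zero_le_two hD flatStep_den_contDiff hK1).trans hK2)
      (by linarith)).trans ?_
    gcongr
    linarith

end flatStep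

/-- `χ r` is a smooth periodic bump function supported in the `r`-neighbourhood of `2πℤ`, with
Gevrey scale `C / r`. -/
structure IsBumpFamily (s C : ℝ) (χ : ℝ → ℝ → ℝ) : Prop where
  contDiff : ∀ {r}, 0 < r → r ≤ 1 → Smooth (χ r)
  periodic : ∀ r, Function.Periodic (χ r) (2 * π)
  nonneg : ∀ r x, 0 ≤ χ r x
  le_one : ∀ r x, χ r x ≤ 1
  eq_one : ∀ {r x}, 0 < r → nd x ≤ 3 / 4 * r → χ r x = 1
  eq_zero : ∀ {r x}, 0 < r → 7 / 8 * r ≤ nd x → χ r x = 0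
  jn_le : ∀ {r K}, 0 < r → r ≤ 1 → C / r ≤ K → ∀ n x, jn s K n x (χ r) ≤ 3 / 2

/-- A bump function on the line, equal to one on `|x| ≤ 3 * r / 4` and to zero on
`7 * r / 8 ≤ |x|`. -/
def flatBump (q : ℕ) (r x : ℝ) : ℝ := flatStep q (7 + -8 / r * x) * flatStep q (7 + 8 / r * x)

/-- The `2π`-periodic extension of `flatBump q r`. -/
def circleBump (q : ℕ) (r x : ℝ) : ℝ := flatBump q r (x - round (x / (2 * π)) * (2 * π))

section bump

variable {q : ℕ} {r x : ℝ}

theorem flatStep_affine_contDiff (q : ℕ) (a b : ℝ) : Smooth (fun x => flatStep q (a + b * x)) :=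
  flatStep_contDiff.comp (contDiff_const.add (contDiff_const.mul contDiff_id))

theorem flatBump_contDiff : Smooth (flatBump q r) :=
  (flatStep_affine_contDiff q _ _).mul (flatStep_affine_contDiff q _ _)

theorem flatBump_eq_one (hq : Odd q) (hr : 0 < r) (h : |x| ≤ 3 / 4 * r) : flatBump q r x = 1 := by
  have h1 : 8 / r * |x| ≤ 6 := by
    rw [div_mul_eq_mul_div, div_le_iff₀ hr]; linarith
  have hr8 : 0 ≤ 8 / r := by positivity
  have h2 : 8 / r * x ≤ 6 := (mul_le_mul_of_nonneg_left (le_abs_self x) hr8).trans h1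
  have h3 : 8 / r * (-x) ≤ 6 := (mul_le_mul_of_nonneg_left (neg_le_abs x) hr8).trans h1
  rw [flatBump, flatStep_of_one_le hq, flatStep_of_one_le hq, one_mul]
  · linarith
  · rw [neg_div]; linarith

theorem flatBump_eq_zero (hq : Odd q) (hr : 0 < r) (h : 7 / 8 * r ≤ |x|) : flatBump q r x = 0 := by
  have h1 : 7 ≤ 8 / r * |x| := by
    rw [div_mul_eq_mul_div, le_div_iff₀ hr]; linarith
  rcases abs_cases x with ⟨h2, _⟩ | ⟨h2, _⟩ <;> rw [h2] at h1
  · rw [flatBump, flatStep_of_nonpos hq, zero_mul]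
    rw [neg_div]; linarith
  · rw [flatBump, flatStep_of_nonpos (x := 7 + 8 / r * x) hq, mul_zero]
    linarith

theorem circleBump_eventuallyEq (hq : Odd q) (hr : 0 < r) (hr1 : r ≤ 1) (y : ℝ) :
    circleBump q r =ᶠ[nhds y] fun z => flatBump q r (z + -(round (y / (2 * π)) * (2 * π))) := by
  have hπ := pi_gt_three
  have h2 : (0 : ℝ) < 2 * π := by positivity
  have hround : ∀ z : ℝ, |z - round (z / (2 * π)) * (2 * π)| ≤ π := by
    intro z
    have h := abs_sub_round (z / (2 * π))
    have h' := mul_le_mul_of_nonneg_right h h2.le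
    rw [← abs_of_pos h2, ← abs_mul, abs_of_pos h2, sub_mul, div_mul_cancel₀ z h2.ne'] at h'
    linarith
  filter_upwards [Metric.ball_mem_nhds y one_pos] with z hz
  rw [Metric.mem_ball, Real.dist_eq] at hz
  rw [circleBump]
  set m := round (y / (2 * π)) with hm
  set m' := round (z / (2 * π)) with hm'
  by_cases h : m' = m
  · rw [h, sub_eq_add_neg]
  have h1 : |z - m * (2 * π)| ≤ π + 1 := by
    have : z - m * (2 * π) = (y - m * (2 * π)) + (z - y) := by ring
    rw [this]
    exact (abs_add_le _ _).trans (add_le_add (hround y) hz.le)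
  have h3 : 2 * π ≤ |(m' : ℝ) * (2 * π) - m * (2 * π)| := by
    rw [← sub_mul, abs_mul, abs_of_pos h2]
    have : (1 : ℝ) ≤ |(m' : ℝ) - m| := by
      exact_mod_cast Int.one_le_abs (sub_ne_zero.2 h)
    nlinarith
  have h4 : |(m' : ℝ) * (2 * π) - m * (2 * π)| ≤ |z - m * (2 * π)| + |z - m' * (2 * π)| := by
    have : (m' : ℝ) * (2 * π) - m * (2 * π) = (z - m * (2 * π)) - (z - m' * (2 * π)) := by ring
    rw [this]; exact abs_sub _ _
  have h5 := hround z
  rw [← hm'] at h5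
  rw [flatBump_eq_zero hq hr (by linarith : 7 / 8 * r ≤ |z - m' * (2 * π)|), ← sub_eq_add_neg,
    flatBump_eq_zero hq hr (by linarith : 7 / 8 * r ≤ |z - m * (2 * π)|)]

theorem exists_isBumpFamily {s : ℝ} (hs : 1 < s) :
    ∃ (C : ℝ) (χ : ℝ → ℝ → ℝ), 0 < C ∧ IsBumpFamily s C χ := by
  obtain ⟨p, hp⟩ := exists_nat_gt (1 / (s - 1))
  have hs0 : 0 < s - 1 := by linarith
  have hp0 : 0 < (p : ℝ) := (by positivity : 0 < 1 / (s - 1)).trans hp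
  set q := 2 * p + 1 with hq'
  have hq : Odd q := ⟨p, rfl⟩
  have hqs : 1 + 1 / (q : ℝ) ≤ s := by
    have h1 : 1 / (q : ℝ) ≤ s - 1 := by
      rw [div_le_iff₀ (by positivity)]
      rw [div_lt_iff₀ hs0] at hp
      rw [hq']; push_cast
      nlinarith
    linarith
  obtain ⟨A, D, hA, hD, hst⟩ := exists_gevreyBound_flatStep hq hqs
  set C := 16 * D + 160 * A * D with hC
  have hC0 : 0 < C := by positivity
  have hfac : ∀ {r K : ℝ}, 0 < r → C / r ≤ K → ∀ b : ℝ, |b| = 8 / r → ∀ n x,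
      jn s K n x (fun x => flatStep q (7 + b * x)) ≤ 11 / 10 := by
    intro r K hr hK b hb n x
    have hg := hst.comp_affine flatStep_contDiff 7 b
    rw [hb] at hg
    have hCK : C / r ≤ K := hK
    have hK0 : 0 < K := (by positivity : 0 < C / r).trans_le hK
    have hDr : 0 < 8 / r * D := by positivity
    have hle : 2 * (8 / r * D) ≤ K := by
      refine le_trans ?_ hK
      rw [hC, show 2 * (8 / r * D) = 16 * D / r by ring]
      gcongr
      linarith [show 0 < 160 * A * D by positivity]
    refine (hg.jn_le hA.le hDr hle).trans ?_
    have h1 : 2 * A * (8 / r * D) / K ≤ 1 / 10 := by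
      rw [div_le_iff₀ hK0]
      have : 160 * A * D / r ≤ K := by
        refine le_trans ?_ hK
        gcongr
        rw [hC]; linarith
      calc 2 * A * (8 / r * D) = 1 / 10 * (160 * A * D / r) := by ring
        _ ≤ _ := by gcongr
    have h2 : |flatStep q (7 + b * x)| ≤ 1 := by
      rw [abs_of_nonneg (flatStep_nonneg _)]; exact flatStep_le_one _
    linarith
  have hs1 : 1 ≤ s := hs.le
  refine ⟨C, circleBump q, hC0, ?_, ?_, ?_, ?_, ?_, ?_, ?_⟩
  · intro r hr hr1
    refine contDiff_iff_contDiffAt.2 fun y => ?_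
    refine ContDiffAt.congr_of_eventuallyEq ?_ (circleBump_eventuallyEq hq hr hr1 y)
    exact (flatBump_contDiff.comp (contDiff_id.add contDiff_const)).contDiffAt
  · intro r x
    have h2 : (2 * π : ℝ) ≠ 0 := by positivity
    rw [circleBump, circleBump, add_div, div_self h2, round_add_one]
    congr 1; push_cast; ring
  · intro r x; exact mul_nonneg (flatStep_nonneg _) (flatStep_nonneg _)
  · intro r x; exact mul_le_one₀ (flatStep_le_one _) (flatStep_nonneg _) (flatStep_le_one _)
  · intro r x hr h; rw [nd_eq] at h; exact flatBump_eq_one hq hr h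
  · intro r x hr h; rw [nd_eq] at h; exact flatBump_eq_zero hq hr h
  · intro r K hr hr1 hK n x
    have hK0 : 0 < K := (by positivity : 0 < C / r).trans_le hK
    rw [jn_congr (circleBump_eventuallyEq hq hr hr1 x), jn_comp_add (f := flatBump q r)]
    refine (jn_mul_le hs1 hK0 (flatStep_affine_contDiff q 7 (-8 / r))
      (flatStep_affine_contDiff q 7 (8 / r))).trans ?_
    have e1 := hfac hr hK (-8 / r) (by rw [neg_div, abs_neg, abs_of_pos (by positivity)]) n
      (x + -(round (x / (2 * π)) * (2 * π)))
    have e2 := hfac hr hK (8 / r) (by rw [abs_of_pos (by positivity)]) n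
      (x + -(round (x / (2 * π)) * (2 * π)))
    refine (mul_le_mul e1 e2 (jn_nonneg hK0) (by norm_num)).trans (by norm_num)

end bump

/-! ### Birkhoff products and the local surgery of a positive multiplier -/

/-- A smooth positive `2π`-periodic function. -/
structure PosPer (a : ℝ → ℝ) : Prop where
  contDiff : Smooth a
  periodic : Function.Periodic a (2 * π)
  pos : ∀ x, 0 < a x

/-- The Birkhoff product of `a` along the rotation by `ω`. -/
def pr (ω : ℝ) (a : ℝ → ℝ) (k : ℕ) (x : ℝ) : ℝ := ∏ i ∈ Finset.range k, a (x + i * ω)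

/-- The sum of the reciprocals of products of consecutive Birkhoff products. -/
def sg (ω : ℝ) (a : ℝ → ℝ) (k : ℕ) (x : ℝ) : ℝ :=
  ∑ i ∈ Finset.range k, (pr ω a i x * pr ω a (i + 1) x)⁻¹

/-- The potential for which `a` solves the Riccati equation. -/
def pot (ω : ℝ) (a : ℝ → ℝ) (x : ℝ) : ℝ := a (x + ω) + (a x)⁻¹

/-- The size of the rank-one perturbation performed by `stepA`. -/
def stepF (ω : ℝ) (a E : ℝ → ℝ) (N : ℕ) (x : ℝ) : ℝ := (1 - E x) * (sg ω a N x)⁻¹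

/-- The ratio of the perturbed and the unperturbed Birkhoff product. -/
def stepG (ω : ℝ) (a E : ℝ → ℝ) (N k : ℕ) (x : ℝ) : ℝ := 1 - sg ω a k x * stepF ω a E N x

/-- The modification of `a` for which the `N`-th Birkhoff product gets multiplied by `E`. -/
def stepA (ω : ℝ) (a E : ℝ → ℝ) (N : ℕ) (y : ℝ) : ℝ :=
  a y * ∏ k ∈ Finset.range N,
    (stepG ω a E N (k + 1) (y - k * ω) * (stepG ω a E N k (y - k * ω))⁻¹)

section Step

variable {ω : ℝ} {a E : ℝ → ℝ} {N : ℕ}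

theorem pr_zero (x : ℝ) : pr ω a 0 x = 1 := by simp [pr]

theorem pr_succ (k : ℕ) (x : ℝ) : pr ω a (k + 1) x = pr ω a k x * a (x + k * ω) :=
  Finset.prod_range_succ _ _

theorem pr_add (m n : ℕ) (x : ℝ) : pr ω a (m + n) x = pr ω a m x * pr ω a n (x + m * ω) := by
  rw [pr, pr, pr, Finset.prod_range_add]
  congr 1
  refine Finset.prod_congr rfl fun i _ => ?_
  congr 1; push_cast; ring

theorem sg_zero (x : ℝ) : sg ω a 0 x = 0 := by simp [sg]

theorem sg_succ (k : ℕ) (x : ℝ) :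
    sg ω a (k + 1) x = sg ω a k x + (pr ω a k x * pr ω a (k + 1) x)⁻¹ :=
  Finset.sum_range_succ _ _

theorem sg_add (m n : ℕ) (x : ℝ) :
    sg ω a (m + n) x = sg ω a m x + (pr ω a m x)⁻¹ ^ 2 * sg ω a n (x + m * ω) := by
  rw [sg, sg, sg, Finset.sum_range_add, Finset.mul_sum]
  congr 1
  refine Finset.sum_congr rfl fun i _ => ?_
  rw [add_assoc, pr_add, pr_add, mul_inv, mul_inv, mul_inv, mul_inv]
  ring

theorem PosPer.pr (ha : PosPer a) (k : ℕ) : PosPer (pr ω a k) where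
  contDiff := contDiff_prod fun i _ => ha.contDiff.comp (contDiff_id.add contDiff_const)
  periodic x := Finset.prod_congr rfl fun i _ => by
    rw [add_right_comm, ha.periodic]
  pos x := Finset.prod_pos fun i _ => ha.pos _

theorem PosPer.sg_contDiff (ha : PosPer a) (k : ℕ) : Smooth (sg ω a k) :=
  ContDiff.sum fun i _ => ((ha.pr i).contDiff.mul (ha.pr (i + 1)).contDiff).inv fun x =>
    (mul_pos ((ha.pr i).pos x) ((ha.pr (i + 1)).pos x)).ne'

theorem PosPer.sg_periodic (ha : PosPer a) (k : ℕ) : Function.Periodic (sg ω a k) (2 * π) :=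
  fun x => Finset.sum_congr rfl fun i _ => by
    rw [(ha.pr i).periodic, (ha.pr (i + 1)).periodic]

theorem PosPer.sg_mono (ha : PosPer a) {k l : ℕ} (h : k ≤ l) (x : ℝ) :
    sg ω a k x ≤ sg ω a l x :=
  Finset.sum_le_sum_of_subset_of_nonneg (Finset.range_mono h) fun i _ _ =>
    inv_nonneg.2 (mul_pos ((ha.pr i).pos x) ((ha.pr (i + 1)).pos x)).le

theorem PosPer.sg_nonneg (ha : PosPer a) (k : ℕ) (x : ℝ) : 0 ≤ sg ω a k x := by
  simpa [sg_zero] using ha.sg_mono (ω := ω) (Nat.zero_le k) x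

theorem PosPer.sg_pos (ha : PosPer a) {k : ℕ} (hk : 0 < k) (x : ℝ) : 0 < sg ω a k x := by
  refine lt_of_lt_of_le ?_ (ha.sg_mono (Nat.one_le_of_lt hk) x)
  simp [sg, pr_zero, pr_succ, ha.pos]

theorem PosPer.pot_contDiff (ha : PosPer a) : Smooth (pot ω a) :=
  (ha.contDiff.comp (contDiff_id.add contDiff_const)).add
    (ha.contDiff.inv fun x => (ha.pos x).ne')

theorem PosPer.pot_periodic (ha : PosPer a) : Function.Periodic (pot ω a) (2 * π) := fun x => by
  rw [pot, pot, add_right_comm, ha.periodic, ha.periodic]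

set_option linter.unusedSectionVars false

variable (ha : PosPer a) (hE : PosPer E) (hE1 : ∀ x, E x ≤ 1) (hN : 0 < N)
include ha hE hE1 hN

theorem stepF_contDiff : Smooth (stepF ω a E N) :=
  (contDiff_const.sub hE.contDiff).mul ((ha.sg_contDiff N).inv fun x => (ha.sg_pos hN x).ne')

theorem stepF_nonneg (x : ℝ) : 0 ≤ stepF ω a E N x :=
  mul_nonneg (by linarith [hE1 x]) (inv_nonneg.2 (ha.sg_nonneg N x))

theorem stepG_self (x : ℝ) : stepG ω a E N N x = E x := by
  have := (ha.sg_pos (ω := ω) hN x).ne'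
  rw [stepG, stepF]; field_simp; ring

theorem stepG_posPer {k : ℕ} (hk : k ≤ N) : PosPer (stepG ω a E N k) where
  contDiff := contDiff_const.sub ((ha.sg_contDiff k).mul (stepF_contDiff ha hE hE1 hN))
  periodic x := by
    rw [stepG, stepG, stepF, stepF, ha.sg_periodic, ha.sg_periodic, hE.periodic]
  pos x := by
    have h := mul_le_mul_of_nonneg_right (ha.sg_mono (ω := ω) hk x)
      (stepF_nonneg (ω := ω) ha hE hE1 hN x)
    have h2 := stepG_self (ω := ω) ha hE hE1 hN x
    have h3 := hE.pos x
    rw [stepG] at h2 ⊢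
    linarith

theorem stepA_posPer : PosPer (stepA ω a E N) where
  contDiff := by
    refine ha.contDiff.mul (contDiff_prod fun k hk => ?_)
    have hk' := Finset.mem_range.1 hk
    have h1 := stepG_posPer (ω := ω) ha hE hE1 hN (k := k + 1) hk'
    have h0 := stepG_posPer (ω := ω) ha hE hE1 hN (k := k) hk'.le
    exact (h1.contDiff.comp (contDiff_id.sub contDiff_const)).mul
      ((h0.contDiff.comp (contDiff_id.sub contDiff_const)).inv fun x => (h0.pos _).ne')
  periodic x := by
    rw [stepA, stepA, ha.periodic]
    congr 1
    refine Finset.prod_congr rfl fun k hk => ?_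
    have hk' := Finset.mem_range.1 hk
    rw [add_sub_right_comm, (stepG_posPer (ω := ω) ha hE hE1 hN (k := k + 1) hk').periodic,
      (stepG_posPer (ω := ω) ha hE hE1 hN (k := k) hk'.le).periodic]
  pos x := by
    refine mul_pos (ha.pos x) (Finset.prod_pos fun k hk => ?_)
    have hk' := Finset.mem_range.1 hk
    exact mul_pos ((stepG_posPer (ω := ω) ha hE hE1 hN (k := k + 1) hk').pos _)
      (inv_pos.2 ((stepG_posPer (ω := ω) ha hE hE1 hN (k := k) hk'.le).pos _))

omit ha hE hE1 hN in
theorem stepG_of_stepF_eq_zero {x : ℝ} (h : stepF ω a E N x = 0) (k : ℕ) :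
    stepG ω a E N k x = 1 := by rw [stepG, h, mul_zero, sub_zero]

omit ha hE hE1 hN in
theorem stepA_eq_self {y : ℝ} (h : ∀ k < N, stepF ω a E N (y - k * ω) = 0) :
    stepA ω a E N y = a y := by
  rw [stepA, Finset.prod_eq_one, mul_one]
  intro k hk
  rw [stepG_of_stepF_eq_zero (h k (Finset.mem_range.1 hk)),
    stepG_of_stepF_eq_zero (h k (Finset.mem_range.1 hk)), inv_one, mul_one]

omit ha hE hE1 hN in
theorem stepA_eq_single {y : ℝ} {κ : ℕ} (hκ : κ < N)
    (h : ∀ k < N, k ≠ κ → stepF ω a E N (y - k * ω) = 0) :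
    stepA ω a E N y = a y *
      (stepG ω a E N (κ + 1) (y - κ * ω) * (stepG ω a E N κ (y - κ * ω))⁻¹) := by
  rw [stepA, Finset.prod_eq_single κ]
  · intro k hk hne
    rw [stepG_of_stepF_eq_zero (h k (Finset.mem_range.1 hk) hne),
      stepG_of_stepF_eq_zero (h k (Finset.mem_range.1 hk) hne), inv_one, mul_one]
  · intro h'; exact absurd (Finset.mem_range.2 hκ) h'

theorem pr_stepA {x : ℝ} (h : ∀ i < N, ∀ k < N, k ≠ i → stepF ω a E N (x + i * ω - k * ω) = 0)
    {k : ℕ} (hk : k ≤ N) : pr ω (stepA ω a E N) k x = pr ω a k x * stepG ω a E N k x := by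
  induction k with
  | zero => simp [pr_zero, stepG, sg_zero]
  | succ k ih =>
    rw [pr_succ, ih (by omega), stepA_eq_single hk (h k hk), pr_succ, add_sub_cancel_right]
    have := ((stepG_posPer (ω := ω) ha hE hE1 hN (k := k) (by omega)).pos x).ne'
    field_simp

theorem sg_stepA {x : ℝ} (h : ∀ i < N, ∀ k < N, k ≠ i → stepF ω a E N (x + i * ω - k * ω) = 0)
    {k : ℕ} (hk : k ≤ N) :
    sg ω (stepA ω a E N) k x = sg ω a k x * (stepG ω a E N k x)⁻¹ := by
  induction k with
  | zero => simp [sg_zero]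
  | succ k ih =>
    have h0 := ((stepG_posPer (ω := ω) ha hE hE1 hN (k := k) (by omega)).pos x).ne'
    have h1 := ((stepG_posPer (ω := ω) ha hE hE1 hN (k := k + 1) hk).pos x).ne'
    have p0 := ((ha.pr (ω := ω) k).pos x).ne'
    have p1 := ((ha.pr (ω := ω) (k + 1)).pos x).ne'
    have e : stepG ω a E N k x - stepG ω a E N (k + 1) x =
        (pr ω a k x * pr ω a (k + 1) x)⁻¹ * stepF ω a E N x := by
      rw [stepG, stepG, sg_succ]; ring
    have e0 : stepG ω a E N k x = 1 - sg ω a k x * stepF ω a E N x := rfl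
    rw [sg_succ, ih (by omega), pr_stepA ha hE hE1 hN h (by omega), pr_stepA ha hE hE1 hN h hk,
      sg_succ]
    have e2 : (pr ω a k x * stepG ω a E N k x * (pr ω a (k + 1) x * stepG ω a E N (k + 1) x))⁻¹ =
        (pr ω a k x * pr ω a (k + 1) x)⁻¹ * (stepG ω a E N k x)⁻¹ *
          (stepG ω a E N (k + 1) x)⁻¹ := by
      rw [← mul_inv, ← mul_inv]; congr 1; ring
    rw [e2]
    set u := (pr ω a k x * pr ω a (k + 1) x)⁻¹
    field_simp
    linear_combination (-sg ω a k x) * e - u * e0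

theorem pot_stepA {y : ℝ} (h : ∀ k ≤ N, ∀ l ≤ N, k ≠ l → stepF ω a E N (y + ω - k * ω) ≠ 0 →
      stepF ω a E N (y + ω - l * ω) = 0) :
    pot ω (stepA ω a E N) y = pot ω a y - stepF ω a E N (y + ω) +
      stepF ω a E N (y - (N - 1 : ℝ) * ω) * (E (y - (N - 1 : ℝ) * ω))⁻¹ *
        (pr ω a N (y - (N - 1 : ℝ) * ω))⁻¹ ^ 2 := by
  have hy : ∀ k : ℕ, y - k * ω = y + ω - ((k + 1 : ℕ) : ℝ) * ω := fun k => by push_cast; ring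
  have eN : y + ω - N * ω = y - (N - 1 : ℝ) * ω := by ring
  have e0 : y + ω = y + ω - (0 : ℕ) * ω := by simp
  rw [pot, pot]
  by_cases hex : ∃ κ ≤ N, stepF ω a E N (y + ω - κ * ω) ≠ 0
  swap
  · push Not at hex
    rw [stepA_eq_self fun k hk => hex k hk.le, stepA_eq_self fun k hk => by
      rw [hy]; exact hex (k + 1) hk, ← eN, hex N le_rfl]
    have := hex 0 (Nat.zero_le N)
    rw [← e0] at this
    rw [this]; ring
  obtain ⟨κ, hκ, hne⟩ := hex
  have hz : ∀ l ≤ N, l ≠ κ → stepF ω a E N (y + ω - l * ω) = 0 := fun l hl hlκ =>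
    h κ hκ l hl hlκ.symm hne
  have h1 : stepA ω a E N (y + ω) = if κ < N then a (y + ω) *
      (stepG ω a E N (κ + 1) (y + ω - κ * ω) * (stepG ω a E N κ (y + ω - κ * ω))⁻¹)
      else a (y + ω) := by
    split_ifs with hlt
    · exact stepA_eq_single hlt fun k hk hkne => hz k hk.le hkne
    · exact stepA_eq_self fun k hk => hz k hk.le (by omega)
  have hNz : κ ≠ N → stepF ω a E N (y - (N - 1 : ℝ) * ω) = 0 := fun hn => by
    rw [← eN]; exact hz N le_rfl (Ne.symm hn)
  have h0z : κ ≠ 0 → stepF ω a E N (y + ω) = 0 := fun hn => by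
    rw [e0]; exact hz 0 (Nat.zero_le _) (Ne.symm hn)
  rcases κ with _ | κ
  · have h2 : stepA ω a E N y = a y := stepA_eq_self fun k hk => by
      rw [hy]; exact hz (k + 1) hk (by omega)
    rw [h1, h2, if_pos hN, hNz hN.ne, ← e0]
    simp only [stepG, sg_zero, sg_succ, pr_zero, pr_succ]
    have := (ha.pos (y + ω)).ne'
    simp only [Nat.cast_zero, zero_mul, add_zero, sub_zero, one_mul, zero_add]
    field_simp
    ring
  set z := y + ω - ((κ + 1 : ℕ) : ℝ) * ω with hzdef
  have hyz : y - κ * ω = z := hy κ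
  have hza : z + κ * ω = y := by rw [← hyz]; ring
  have hza1 : z + ((κ + 1 : ℕ) : ℝ) * ω = y + ω := by rw [hzdef]; ring
  have h2 : stepA ω a E N y = a y *
      (stepG ω a E N (κ + 1) z * (stepG ω a E N κ z)⁻¹) := by
    rw [← hyz]
    exact stepA_eq_single hκ fun k hk hkne => by rw [hy]; exact hz _ hk (by omega)
  have g0 := ((stepG_posPer (ω := ω) ha hE hE1 hN (k := κ) (by omega)).pos z).ne'
  have g1 := ((stepG_posPer (ω := ω) ha hE hE1 hN (k := κ + 1) hκ).pos z).ne'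
  have p0 := ((ha.pr (ω := ω) κ).pos z).ne'
  have p1 := ((ha.pr (ω := ω) (κ + 1)).pos z).ne'
  have ay := (ha.pos y).ne'
  have ep : pr ω a (κ + 1) z = pr ω a κ z * a y := by rw [pr_succ, hza]
  have eg : stepG ω a E N κ z - stepG ω a E N (κ + 1) z =
      (pr ω a κ z * pr ω a (κ + 1) z)⁻¹ * stepF ω a E N z := by
    rw [stepG, stepG, sg_succ]; ring
  rw [h1, h2, h0z (by omega)]
  by_cases hlt : κ + 1 < N
  · rw [if_pos hlt, hNz (by omega)]
    have g2 := ((stepG_posPer (ω := ω) ha hE hE1 hN (k := κ + 1 + 1) hlt).pos z).ne'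
    have ay1 := (ha.pos (y + ω)).ne'
    have eg1 : stepG ω a E N (κ + 1) z - stepG ω a E N (κ + 1 + 1) z =
        (pr ω a (κ + 1) z * pr ω a (κ + 1 + 1) z)⁻¹ * stepF ω a E N z := by
      rw [stepG, stepG, sg_succ ((κ + 1))]; ring
    have ep1 : pr ω a (κ + 1 + 1) z = pr ω a κ z * a y * a (y + ω) := by
      rw [pr_succ (κ + 1), ep, hza1]
    rw [ep1, ep] at eg1
    rw [ep] at eg
    set A := stepG ω a E N κ z
    set B := stepG ω a E N (κ + 1) z
    set C := stepG ω a E N (κ + 1 + 1) z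
    set F := stepF ω a E N z
    set P := pr ω a κ z
    field_simp at eg eg1 ⊢
    have : P ^ 2 * a y * (a (y + ω) * a y * C + A - (B * (a (y + ω) * a y + 1))) = 0 := by
      linear_combination eg - eg1
    have hP : P ^ 2 * a y ≠ 0 := mul_ne_zero (pow_ne_zero 2 p0) ay
    have := (mul_eq_zero.1 this).resolve_left hP
    linear_combination this
  · have hκN : κ + 1 = N := by omega
    rw [if_neg hlt]
    have ez : y - (N - 1 : ℝ) * ω = z := by rw [← eN, ← hκN]
    rw [ez, ← stepG_self (ω := ω) ha hE hE1 hN z]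
    rw [show pr ω a N z = pr ω a κ z * a y by rw [← hκN, ep]]
    rw [show stepG ω a E N N z = stepG ω a E N (κ + 1) z by rw [hκN]]
    rw [ep] at eg
    set A := stepG ω a E N κ z
    set B := stepG ω a E N (κ + 1) z
    set F := stepF ω a E N z
    set P := pr ω a κ z
    field_simp at eg ⊢
    linear_combination eg

theorem integral_log_stepA :
    ∫ x in (0 : ℝ)..(2 * π), log (stepA ω a E N x) =
      (∫ x in (0 : ℝ)..(2 * π), log (a x)) + ∫ x in (0 : ℝ)..(2 * π), log (E x) := by
  have hlogc : ∀ {g : ℝ → ℝ}, PosPer g → Continuous fun x => log (g x) := fun hg =>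
    hg.contDiff.continuous.log fun x => (hg.pos x).ne'
  have hG : ∀ k ≤ N, PosPer (stepG ω a E N k) := fun k hk => stepG_posPer ha hE hE1 hN hk
  have hsh : ∀ k ≤ N, ∀ c : ℝ, ∫ x in (0 : ℝ)..(2 * π), log (stepG ω a E N k (x - c)) =
      ∫ x in (0 : ℝ)..(2 * π), log (stepG ω a E N k x) := by
    intro k hk c
    have hp : Function.Periodic (fun x => log (stepG ω a E N k x)) (2 * π) := fun x => by
      simp only [(hG k hk).periodic x]
    rw [intervalIntegral.integral_comp_sub_right (fun x => log (stepG ω a E N k x))]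
    have := hp.intervalIntegral_add_eq (0 - c) 0
    rw [zero_add, show 0 - c + 2 * π = 2 * π - c by ring] at this
    exact this
  have e1 : ∀ x, log (stepA ω a E N x) = log (a x) + ∑ k ∈ Finset.range N,
      (log (stepG ω a E N (k + 1) (x - k * ω)) - log (stepG ω a E N k (x - k * ω))) := by
    intro x
    have hpos : ∀ k ∈ Finset.range N, stepG ω a E N (k + 1) (x - k * ω) *
        (stepG ω a E N k (x - k * ω))⁻¹ ≠ 0 := fun k hk => by
      have hk := Finset.mem_range.1 hk
      exact (mul_pos ((hG (k + 1) hk).pos _) (inv_pos.2 ((hG k hk.le).pos _))).ne'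
    rw [stepA, log_mul (ha.pos x).ne' (Finset.prod_ne_zero_iff.2 hpos), log_prod hpos]
    congr 1
    refine Finset.sum_congr rfl fun k hk => ?_
    have hk := Finset.mem_range.1 hk
    rw [log_mul ((hG (k + 1) hk).pos _).ne' (inv_pos.2 ((hG k hk.le).pos _)).ne', log_inv,
      ← sub_eq_add_neg]
  have hci : ∀ k ≤ N, ∀ c : ℝ, IntervalIntegrable
      (fun x => log (stepG ω a E N k (x - c))) volume 0 (2 * π) := fun k hk c =>
    ((hlogc (hG k hk)).comp (continuous_id.sub continuous_const)).intervalIntegrable _ _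
  simp only [e1]
  rw [intervalIntegral.integral_add ((hlogc ha).intervalIntegrable _ _),
    intervalIntegral.integral_finsetSum]
  · congr 1
    have : ∀ k ∈ Finset.range N, ∫ x in (0 : ℝ)..(2 * π),
        (log (stepG ω a E N (k + 1) (x - k * ω)) - log (stepG ω a E N k (x - k * ω))) =
        (∫ x in (0 : ℝ)..(2 * π), log (stepG ω a E N (k + 1) x)) -
          ∫ x in (0 : ℝ)..(2 * π), log (stepG ω a E N k x) := fun k hk => by
      have hk := Finset.mem_range.1 hk
      rw [intervalIntegral.integral_sub (hci _ hk _) (hci _ hk.le _), hsh _ hk, hsh _ hk.le]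
    rw [Finset.sum_congr rfl this, Finset.sum_range_sub
      fun k => ∫ x in (0 : ℝ)..(2 * π), log (stepG ω a E N k x)]
    simp only [stepG_self ha hE hE1 hN]
    simp [stepG, sg_zero]
  · intro k hk
    have hk := Finset.mem_range.1 hk
    exact (hci _ hk _).sub (hci _ hk.le _)
  · refine Continuous.intervalIntegrable (continuous_finsetSum _ fun k hk => ?_) _ _
    have hk := Finset.mem_range.1 hk
    exact ((hlogc (hG _ hk)).comp (continuous_id.sub continuous_const)).sub
      ((hlogc (hG _ hk.le)).comp (continuous_id.sub continuous_const))

end Step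

/-! ### Schedules of radii and times, and the associated multipliers -/

/-- Admissible radii `r` and return times `N` for the rotation by `ω`. -/
structure Sched (ω c : ℝ) (r : ℕ → ℝ) (N : ℕ → ℕ) : Prop where
  r_pos : ∀ j, 0 < r j
  r_le_one : ∀ j, r j ≤ 1
  r_succ : ∀ j, r (j + 1) ≤ 3 / 4 * r j
  sum_le : ∀ j, ∑ i ∈ Finset.range j, 2 ^ (i + 1) * r i ≤ c / 2
  N_ge : ∀ j, 2 ^ (j + 1) ≤ N j
  N_le : ∀ j, N j ≤ 2 ^ (j + 2)
  sep : ∀ i k : ℕ, 1 ≤ k → k ≤ N i → 2 * r i ≤ nd (k * ω)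
  free : ∀ i j, i < j → ∀ k : ℕ, 1 ≤ k → k < N i → 2 * r i ≤ nd ((N j - k : ℝ) * ω)

/-- The factor by which the `j`-th Birkhoff product gets multiplied. -/
def Efn (χ : ℝ → ℝ → ℝ) (r : ℕ → ℝ) (j : ℕ) (x : ℝ) : ℝ := (1 - χ (r j) x / 2) ^ (2 ^ j)

/-- The successive multipliers. -/
def seqA (ω : ℝ) (χ : ℝ → ℝ → ℝ) (r : ℕ → ℝ) (N : ℕ → ℕ) : ℕ → ℝ → ℝ
  | 0 => fun _ => 64
  | j + 1 => stepA ω (seqA ω χ r N j) (Efn χ r j) (N j)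

/-- The points from which no unfinished surgery interval of level `< j` is entered. -/
def FreePt (ω : ℝ) (r : ℕ → ℝ) (N : ℕ → ℕ) (j : ℕ) (x : ℝ) : Prop :=
  ∀ i < j, ∀ k : ℕ, 1 ≤ k → k < N i → r i ≤ nd (x - k * ω)

/-- The loss incurred at `y` by the surgeries of level `< j`. -/
def wt (r : ℕ → ℝ) (j : ℕ) (y : ℝ) : ℝ :=
  ∏ i ∈ Finset.range j, if nd y < r i then (4 : ℝ) ^ (2 ^ i) else 1

theorem one_le_wt (r : ℕ → ℝ) (j : ℕ) (y : ℝ) : 1 ≤ wt r j y := by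
  induction j with
  | zero => simp [wt]
  | succ j ih =>
    rw [wt, Finset.prod_range_succ]
    refine one_le_mul_of_one_le_of_one_le ih ?_
    split_ifs
    · exact one_le_pow₀ (by norm_num)
    · exact le_rfl

theorem wt_succ (r : ℕ → ℝ) (j : ℕ) (y : ℝ) :
    wt r (j + 1) y = wt r j y * if nd y < r j then (4 : ℝ) ^ (2 ^ j) else 1 :=
  Finset.prod_range_succ _ _

theorem wt_le_succ (r : ℕ → ℝ) (j : ℕ) (y : ℝ) : wt r j y ≤ wt r (j + 1) y := by
  rw [wt_succ]
  refine le_mul_of_one_le_right (zero_le_one.trans (one_le_wt r j y)) ?_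
  split_ifs
  · exact one_le_pow₀ (by norm_num)
  · exact le_rfl

theorem card_mul_le_of_separated (S : Finset ℕ) (m : ℕ) (hS : ∀ t ∈ S, t < m) {R : ℝ}
    (hR : ∀ t ∈ S, ∀ u ∈ S, t < u → R ≤ (u - t : ℝ)) : (S.card : ℝ) * R ≤ R ⊔ 0 + m := by
  induction S using Finset.induction_on_max generalizing m with
  | empty => simp; positivity
  | insert b S hb ih =>
    have hbm : (b : ℝ) + 1 ≤ m := by
      have := hS b (by simp); exact_mod_cast this
    rw [Finset.card_insert_of_notMem fun h => lt_irrefl _ (hb b h)]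
    push_cast
    rcases S.eq_empty_or_nonempty with rfl | hne
    · simp only [Finset.card_empty, Nat.cast_zero, zero_add, one_mul]
      have : (0 : ℝ) ≤ m := by positivity
      linarith [le_max_left R 0]
    · obtain ⟨t, ht, hmax⟩ := S.exists_max_image id hne
      have h1 := ih (t + 1) (fun u hu => Nat.lt_succ_of_le (hmax u hu)) fun u hu v hv =>
        hR u (by simp [hu]) v (by simp [hv])
      have h2 := hR t (by simp [ht]) b (by simp) (hb t ht)
      push_cast at h1
      linarith

theorem card_visits_le {ω c : ℝ} (hc : ∀ k : ℕ, 1 ≤ k → c / k ≤ nd (k * ω)) (hc0 : 0 < c)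
    {ρ : ℝ} (hρ : 0 < ρ) (x : ℝ) (m : ℕ) :
    (((Finset.range m).filter fun t : ℕ => nd (x + t * ω) < ρ).card : ℝ) ≤ 1 + m * (2 * ρ / c) := by
  set S := (Finset.range m).filter fun t : ℕ => nd (x + t * ω) < ρ with hS
  have hR0 : 0 < c / (2 * ρ) := by positivity
  have := card_mul_le_of_separated S m (fun t ht => by simp [hS] at ht; exact ht.1)
    (R := c / (2 * ρ)) (fun t ht u hu htu => by
      simp only [hS, Finset.mem_filter] at ht hu
      have hut : ((u - t : ℕ) : ℝ) = (u : ℝ) - t := Nat.cast_sub htu.le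
      have h1 := hc (u - t) (by omega)
      have h2 : nd (((u - t : ℕ) : ℝ) * ω) ≤ nd (x + u * ω) + nd (x + t * ω) := by
        rw [hut, show ((u : ℝ) - t) * ω = (x + u * ω) - (x + t * ω) by ring]
        exact nd_sub_le _ _
      have hpos : (0 : ℝ) < u - t := by rw [sub_pos]; exact_mod_cast htu
      rw [hut] at h1 h2
      rw [div_le_iff₀ (by positivity)]
      rw [div_le_iff₀ hpos] at h1
      nlinarith [ht.2, hu.2])
  rw [max_eq_left hR0.le] at this
  have e : c / (2 * ρ) * (2 * ρ / c) = 1 := by field_simp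
  calc (S.card : ℝ) = S.card * (c / (2 * ρ)) * (2 * ρ / c) := by rw [mul_assoc, e, mul_one]
    _ ≤ (c / (2 * ρ) + m) * (2 * ρ / c) := by gcongr
    _ = _ := by rw [add_mul, e]

namespace Sched

variable {ω c : ℝ} {r : ℕ → ℝ} {N : ℕ → ℕ} (S : Sched ω c r N)
include S

theorem r_anti {i j : ℕ} (h : i ≤ j) : r j ≤ r i :=
  antitone_nat_of_succ_le (fun j => (S.r_succ j).trans (by linarith [S.r_pos j])) h

theorem N_pos (j : ℕ) : 0 < N j := (by positivity : 0 < 2 ^ (j + 1)).trans_le (S.N_ge j)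

theorem prod_wt_le (hc : ∀ k : ℕ, 1 ≤ k → c / k ≤ nd (k * ω)) (hc0 : 0 < c) (j m : ℕ) (x : ℝ) :
    ∏ t ∈ Finset.range m, wt r j (x + t * ω) ≤ 4 ^ (2 ^ j) * 2 ^ m := by
  simp only [wt]
  rw [Finset.prod_comm]
  have h1 : ∀ i, ∏ t ∈ Finset.range m, (if nd (x + t * ω) < r i then (4 : ℝ) ^ (2 ^ i) else 1) =
      (4 : ℝ) ^ (2 ^ i *
        (((Finset.range m).filter fun t : ℕ => nd (x + t * ω) < r i).card : ℝ)) := by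
    intro i
    rw [Finset.prod_ite, Finset.prod_const, Finset.prod_const_one, mul_one, rpow_mul (by norm_num),
      rpow_natCast]
    norm_cast
  simp only [h1]
  rw [← rpow_sum_of_pos (by norm_num)]
  have h2 : ∑ i ∈ Finset.range j, (2 : ℝ) ^ i *
      (((Finset.range m).filter fun t : ℕ => nd (x + t * ω) < r i).card : ℝ) ≤ 2 ^ j + m / 2 := by
    calc _ ≤ ∑ i ∈ Finset.range j, (2 : ℝ) ^ i * (1 + m * (2 * r i / c)) := by
          gcongr with i hi
          exact card_visits_le hc hc0 (S.r_pos i) x m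
      _ = ∑ i ∈ Finset.range j, (2 : ℝ) ^ i + m / c * ∑ i ∈ Finset.range j, 2 ^ (i + 1) * r i := by
          rw [Finset.mul_sum, ← Finset.sum_add_distrib]
          exact Finset.sum_congr rfl fun i _ => by rw [pow_succ]; ring
      _ ≤ 2 ^ j + m / c * (c / 2) := by
          gcongr
          · rw [geom_sum_eq (by norm_num)]; norm_num
          · exact S.sum_le j
      _ = _ := by field_simp
  calc _ ≤ (4 : ℝ) ^ ((2 : ℝ) ^ j + m / 2) := rpow_le_rpow_of_exponent_le (by norm_num) h2
    _ = _ := by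
      rw [rpow_add (by norm_num)]
      congr 1
      · norm_cast
      · rw [show (4 : ℝ) = 2 ^ (2 : ℝ) by norm_num, ← rpow_mul (by norm_num),
            mul_div_cancel₀ _ (by norm_num),
          rpow_natCast]

theorem freePt_of_nd_lt {j : ℕ} {x : ℝ} (hx : nd x < r j) : FreePt ω r N (j + 1) x := by
  intro i hi k hk1 hk
  have h1 := S.sep i k hk1 hk.le
  have h2 := S.r_anti (Nat.lt_succ_iff.1 hi)
  have h3 : nd (k * ω) ≤ nd x + nd (x - k * ω) := by
    have := nd_sub_le x (x - k * ω)
    rwa [sub_sub_cancel] at this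
  linarith

theorem freePt_add_of_nd_lt {j : ℕ} {x : ℝ} (hx : nd x < r j) :
    FreePt ω r N (j + 1) (x + N j * ω) := by
  intro i hi k hk1 hk
  have h2 := S.r_anti (Nat.lt_succ_iff.1 hi)
  have h3 : nd ((N j - k : ℝ) * ω) ≤ nd (x + N j * ω - k * ω) + nd x := by
    have := nd_sub_le (x + N j * ω - k * ω) x
    convert this using 2; ring
  have h1 : 2 * r i ≤ nd ((N j - k : ℝ) * ω) := by
    rcases Nat.lt_succ_iff_lt_or_eq.1 hi with h | rfl
    · exact S.free i j h k hk1 hk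
    · have := S.sep i (N i - k) (by omega) (by omega)
      rwa [Nat.cast_sub hk.le] at this
  linarith

end Sched

theorem FreePt.of_succ {ω : ℝ} {r : ℕ → ℝ} {N : ℕ → ℕ} {j : ℕ} {x : ℝ}
    (h : FreePt ω r N (j + 1) x) : FreePt ω r N j x :=
  fun i hi => h i (hi.trans (Nat.lt_succ_self j))

/-! ### Jet estimates for the Birkhoff products of the successive multipliers -/

/-- Bounds on the jets of inverse Birkhoff products at `x`, up to the loss `w`. -/
def ProdBound (s K : ℝ) (n : ℕ) (ω : ℝ) (a w : ℝ → ℝ) (m : ℕ) (x : ℝ) : Prop :=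
  jn s K n x (fun y => (pr ω a m y)⁻¹) ≤ (1 / 64) ^ m * ∏ t ∈ Finset.range m, w (x + t * ω) ∧
  jn s K n x (sg ω a m) ≤ ∑ k ∈ Finset.range m,
    (1 / 64) ^ (2 * k + 1) * (∏ t ∈ Finset.range (k + 1), w (x + t * ω)) ^ 2

theorem ProdBound.zero {s K : ℝ} {n : ℕ} {ω : ℝ} {a w : ℝ → ℝ} {x : ℝ} :
    ProdBound s K n ω a w 0 x := by
  constructor
  · simp [pr_zero, jn_const]
  · have : sg ω a 0 = fun _ => 0 := funext sg_zero
    simp [this, jn_const]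

theorem ProdBound.add {s K : ℝ} (hs : 1 ≤ s) (hK : 0 < K) {n : ℕ} {ω : ℝ} {a w : ℝ → ℝ}
    (ha : PosPer a) {m m' : ℕ} {x : ℝ} (h : ProdBound s K n ω a w m x)
    (h' : ProdBound s K n ω a w m' (x + m * ω)) : ProdBound s K n ω a w (m + m') x := by
  have hi : ∀ k, Smooth (fun y => (pr ω a k y)⁻¹) := fun k =>
    (ha.pr k).contDiff.inv fun x => ((ha.pr k).pos x).ne'
  have hsh : ∀ {f : ℝ → ℝ}, Smooth f → Smooth fun y => f (y + m * ω) := fun hf =>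
    hf.comp (contDiff_id.add contDiff_const)
  have hP : ∀ k, ∏ t ∈ Finset.range (m + k), w (x + t * ω) =
      (∏ t ∈ Finset.range m, w (x + t * ω)) * ∏ t ∈ Finset.range k, w (x + m * ω + t * ω) := by
    intro k
    rw [Finset.prod_range_add]
    congr 1
    refine Finset.prod_congr rfl fun t _ => ?_
    congr 1; push_cast; ring
  constructor
  · have e : (fun y => (pr ω a (m + m') y)⁻¹) =
        fun y => (pr ω a m y)⁻¹ * (fun z => (pr ω a m' z)⁻¹) (y + m * ω) := by
      funext y; simp only [pr_add, mul_inv]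
    rw [e, hP, pow_add]
    refine (jn_mul_le hs hK (hi m) (hsh (hi m'))).trans ?_
    rw [jn_comp_add (f := fun z => (pr ω a m' z)⁻¹)]
    calc _ ≤ _ := mul_le_mul h.1 h'.1 (jn_nonneg hK) ((jn_nonneg hK).trans h.1)
      _ = _ := by ring
  · have e : sg ω a (m + m') =
        fun y => sg ω a m y + (pr ω a m y)⁻¹ ^ 2 * sg ω a m' (y + m * ω) := by
      funext y; exact sg_add m m' y
    have h2 : Smooth fun y => (pr ω a m y)⁻¹ ^ 2 := (hi m).pow 2
    rw [e, Finset.sum_range_add]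
    refine (jn_add_le hK (ha.sg_contDiff m) (h2.mul (hsh (ha.sg_contDiff m')))).trans ?_
    refine add_le_add h.2 ((jn_mul_le hs hK h2 (hsh (ha.sg_contDiff m'))).trans ?_)
    rw [jn_comp_add]
    have h3 : jn s K n x (fun y => (pr ω a m y)⁻¹ ^ 2) ≤
        ((1 / 64) ^ m * ∏ t ∈ Finset.range m, w (x + t * ω)) ^ 2 :=
      (jn_pow_le hs hK (hi m) 2).trans (pow_le_pow_left₀ (jn_nonneg hK) h.1 2)
    calc _ ≤ _ := mul_le_mul h3 h'.2 (jn_nonneg hK) (by positivity)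
      _ = _ := by
        rw [Finset.mul_sum]
        refine Finset.sum_congr rfl fun k _ => ?_
        rw [add_assoc, hP]
        ring

theorem ProdBound.congr {s K : ℝ} {n : ℕ} {ω : ℝ} {a b w : ℝ → ℝ} {m : ℕ} {x : ℝ}
    (h : ∀ᶠ y in nhds x, ∀ i < m, b (y + i * ω) = a (y + i * ω))
    (hb : ProdBound s K n ω a w m x) : ProdBound s K n ω b w m x := by
  have hpr : ∀ᶠ y in nhds x, ∀ k ≤ m, pr ω b k y = pr ω a k y := by
    filter_upwards [h] with y hy k hk
    exact Finset.prod_congr rfl fun i hi => hy i ((Finset.mem_range.1 hi).trans_le hk)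
  constructor
  · refine le_trans (jn_congr ?_).le hb.1
    filter_upwards [hpr] with y hy
    rw [hy m le_rfl]
  · refine le_trans (jn_congr ?_).le hb.2
    filter_upwards [hpr] with y hy
    refine Finset.sum_congr rfl fun i hi => ?_
    have := Finset.mem_range.1 hi
    rw [hy i this.le, hy (i + 1) this]

theorem ProdBound.mono {s K : ℝ} {n : ℕ} {ω : ℝ} {a w w' : ℝ → ℝ} {m : ℕ} {x : ℝ}
    (hw0 : ∀ y, 0 ≤ w y) (hw : ∀ y, w y ≤ w' y) (h : ProdBound s K n ω a w m x) :
    ProdBound s K n ω a w' m x := by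
  have hp : ∀ k, ∏ t ∈ Finset.range k, w (x + t * ω) ≤ ∏ t ∈ Finset.range k, w' (x + t * ω) :=
    fun k => Finset.prod_le_prod (fun _ _ => hw0 _) fun _ _ => hw _
  have hp0 : ∀ k, 0 ≤ ∏ t ∈ Finset.range k, w (x + t * ω) :=
    fun k => Finset.prod_nonneg fun _ _ => hw0 _
  exact ⟨h.1.trans (mul_le_mul_of_nonneg_left (hp m) (by positivity)),
    h.2.trans (Finset.sum_le_sum fun k _ => mul_le_mul_of_nonneg_left
      (pow_le_pow_left₀ (hp0 _) (hp _) 2) (by positivity))⟩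

namespace IsBumpFamily

variable {s C K : ℝ} {χ : ℝ → ℝ → ℝ} (hχ : IsBumpFamily s C χ) {r : ℕ → ℝ} {j : ℕ}
  (hr : 0 < r j) (hr1 : r j ≤ 1)
include hχ

theorem one_sub_pos (ρ x : ℝ) : 0 < 1 - χ ρ x / 2 := by linarith [hχ.le_one ρ x]

theorem Efn_le_one (x : ℝ) : Efn χ r j x ≤ 1 :=
  pow_le_one₀ (hχ.one_sub_pos _ x).le (by linarith [hχ.nonneg (r j) x])

include hr

theorem Efn_eq_one {x : ℝ} (hx : 7 / 8 * r j ≤ nd x) : Efn χ r j x = 1 := by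
  simp [Efn, hχ.eq_zero hr hx]

theorem Efn_inv_eq {x : ℝ} (hx : nd x ≤ 3 / 4 * r j) : (Efn χ r j x)⁻¹ = 2 ^ (2 ^ j) := by
  rw [Efn, hχ.eq_one hr hx, ← inv_pow]; norm_num

include hr1

theorem one_sub_contDiff : Smooth fun x => 1 - χ (r j) x / 2 :=
  contDiff_const.sub ((hχ.contDiff hr hr1).div_const 2)

theorem Efn_posPer : PosPer (Efn χ r j) where
  contDiff := (hχ.one_sub_contDiff hr hr1).pow _
  periodic x := by rw [Efn, Efn, hχ.periodic]
  pos x := pow_pos (hχ.one_sub_pos _ x) _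

variable (hs : 1 ≤ s) (hK : 0 < K) (hCK : C / r j ≤ K)
include hs hK hCK

theorem jn_Efn_inv_le (n : ℕ) (x : ℝ) :
    jn s K n x (fun y => (Efn χ r j y)⁻¹) ≤ 4 ^ (2 ^ j) := by
  have h0 : ∀ y, 1 - χ (r j) y / 2 ≠ 0 := fun y => (hχ.one_sub_pos _ y).ne'
  have h1 := hχ.one_sub_contDiff hr hr1
  have h2 : jn s K n x (fun y => (1 - χ (r j) y / 2)⁻¹) ≤ (1 - 3 / 4)⁻¹ := by
    refine jn_inv_le hs hK h1 h0 ?_ (by norm_num)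
    have e : (fun y => 1 - χ (r j) y / 2 - 1) = fun y => (-(1 / 2)) * χ (r j) y := by
      funext y; ring
    rw [e, jn_const_mul]
    have := hχ.jn_le hr hr1 hCK n x
    rw [abs_neg, abs_of_pos (by norm_num)]
    linarith
  have e : (fun y => (Efn χ r j y)⁻¹) = fun y => (1 - χ (r j) y / 2)⁻¹ ^ (2 ^ j) := by
    funext y; rw [Efn, inv_pow]
  rw [e]
  refine (jn_pow_le hs hK (h1.inv h0) _).trans ?_
  refine (pow_le_pow_left₀ (jn_nonneg hK) h2 _).trans_eq ?_
  norm_num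

theorem jn_one_sub_Efn_le (n : ℕ) (x : ℝ) :
    jn s K n x (fun y => 1 - Efn χ r j y) ≤ 2 * (7 / 4) ^ (2 ^ j) := by
  have h1 := hχ.one_sub_contDiff hr hr1
  have h2 : jn s K n x (fun y => 1 - χ (r j) y / 2) ≤ 7 / 4 := by
    refine (jn_sub_le hK contDiff_const ((hχ.contDiff hr hr1).div_const 2)).trans ?_
    have e : (fun y => χ (r j) y / 2) = fun y => (1 / 2) * χ (r j) y := by
      funext y; ring
    rw [e, jn_const_mul, jn_const]
    have := hχ.jn_le hr hr1 hCK n x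
    rw [abs_of_pos (by norm_num), abs_of_pos (by norm_num)]
    linarith
  refine (jn_sub_le hK contDiff_const (h1.pow _)).trans ?_
  have h3 := (jn_pow_le (n := n) (x := x) hs hK h1 (2 ^ j)).trans
    (pow_le_pow_left₀ (jn_nonneg hK) h2 _)
  have h4 : (1 : ℝ) ≤ (7 / 4) ^ (2 ^ j) := one_le_pow₀ (by norm_num)
  rw [jn_const, abs_one]
  linarith

end IsBumpFamily

section SeqA

variable {s C K ω c : ℝ} {χ : ℝ → ℝ → ℝ} {r : ℕ → ℝ} {N : ℕ → ℕ}

theorem Sched.seqA_posPer (S : Sched ω c r N) (hχ : IsBumpFamily s C χ) (j : ℕ) :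
    PosPer (seqA ω χ r N j) := by
  induction j with
  | zero => exact ⟨contDiff_const, fun _ => rfl, fun _ => by norm_num [seqA]⟩
  | succ j ih =>
    exact stepA_posPer ih (hχ.Efn_posPer (S.r_pos j) (S.r_le_one j)) hχ.Efn_le_one (S.N_pos j)

theorem Sched.stepF_eq_zero (S : Sched ω c r N) (hχ : IsBumpFamily s C χ) {a : ℝ → ℝ} {j : ℕ}
    {M : ℕ} {x : ℝ} (hx : 7 / 8 * r j ≤ nd x) : stepF ω a (Efn χ r j) M x = 0 := by
  rw [stepF, hχ.Efn_eq_one (S.r_pos j) hx, sub_self, zero_mul]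

theorem Sched.nd_sub_ge (S : Sched ω c r N) {j k l : ℕ} (hk : k ≤ N j) (hl : l ≤ N j)
    (hkl : k ≠ l) {y : ℝ} (hy : nd (y - k * ω) < r j) : r j ≤ nd (y - l * ω) := by
  have h : ∀ {k l : ℕ}, k < l → l ≤ N j → 2 * r j ≤ nd (y - k * ω) + nd (y - l * ω) := by
    intro k l hkl hl
    have h1 := S.sep j (l - k) (by omega) (by omega)
    have h2 := nd_sub_le (y - k * ω) (y - l * ω)
    rw [Nat.cast_sub hkl.le] at h1
    rw [show y - k * ω - (y - l * ω) = (l - k : ℝ) * ω by ring] at h2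
    exact h1.trans h2
  rcases lt_or_gt_of_ne hkl with h1 | h1
  · linarith [h h1 hl]
  · linarith [h h1 hk]

theorem eventually_nd_lt {x ρ : ℝ} (h : nd x < ρ) : ∀ᶠ y in nhds x, nd y < ρ :=
  nd_continuous.continuousAt.eventually_lt continuousAt_const h

theorem eventually_lt_nd {x ρ : ℝ} (h : ρ < nd x) : ∀ᶠ y in nhds x, ρ < nd y :=
  continuousAt_const.eventually_lt nd_continuous.continuousAt h

theorem Sched.stepF_single (S : Sched ω c r N) (hχ : IsBumpFamily s C χ) {a : ℝ → ℝ} {j : ℕ}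
    {y : ℝ} (hy : nd y < r j) :
    ∀ i < N j, ∀ k < N j, k ≠ i → stepF ω a (Efn χ r j) (N j) (y + i * ω - k * ω) = 0 := by
  intro i hi k hk hki
  have := S.nd_sub_ge hi.le hk.le hki.symm (y := y + i * ω) (by rwa [add_sub_cancel_right])
  exact S.stepF_eq_zero hχ (by linarith [S.r_pos j])

theorem prod_wt_mul_le {j : ℕ} {x : ℝ} (hx : nd x < r j) (k : ℕ) :
    (∏ t ∈ Finset.range (k + 1), wt r j (x + t * ω)) * 4 ^ (2 ^ j) ≤
      ∏ t ∈ Finset.range (k + 1), wt r (j + 1) (x + t * ω) := by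
  rw [Finset.prod_range_succ', Finset.prod_range_succ', mul_assoc]
  refine mul_le_mul ?_ ?_ ?_ ?_
  · exact Finset.prod_le_prod (fun t _ => zero_le_one.trans (one_le_wt r j _)) fun t _ =>
      wt_le_succ r j _
  · simp only [Nat.cast_zero, zero_mul, add_zero]
    rw [wt_succ, if_pos hx]
  · exact mul_nonneg (zero_le_one.trans (one_le_wt r j _)) (by positivity)
  · exact Finset.prod_nonneg fun t _ => zero_le_one.trans (one_le_wt r (j + 1) _)

variable (S : Sched ω c r N) (hχ : IsBumpFamily s C χ) (hs : 1 ≤ s) (hK : 0 < K)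
include S hχ hs hK

theorem prodBound_return {j n : ℕ} (hCK : C / r j ≤ K) {x : ℝ} (hx : nd x < r j)
    (h : ProdBound s K n ω (seqA ω χ r N j) (wt r j) (N j) x) :
    ProdBound s K n ω (seqA ω χ r N (j + 1)) (wt r (j + 1)) (N j) x := by
  set a := seqA ω χ r N j with ha
  have hap : PosPer a := S.seqA_posPer hχ j
  have hE : PosPer (Efn χ r j) := hχ.Efn_posPer (S.r_pos j) (S.r_le_one j)
  have hEi : Smooth fun y => (Efn χ r j y)⁻¹ := hE.contDiff.inv fun y => (hE.pos y).ne'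
  have hJ := hχ.jn_Efn_inv_le (S.r_pos j) (S.r_le_one j) hs hK hCK n x
  have hN := S.N_pos j
  obtain ⟨M, hM⟩ : ∃ M, N j = M + 1 := ⟨N j - 1, by omega⟩
  have hw0 : ∀ k, 0 ≤ ∏ t ∈ Finset.range k, wt r j (x + t * ω) := fun k =>
    Finset.prod_nonneg fun t _ => zero_le_one.trans (one_le_wt r j _)
  constructor
  · have e : (fun y => (pr ω (seqA ω χ r N (j + 1)) (N j) y)⁻¹) =ᶠ[nhds x]
        fun y => (pr ω a (N j) y)⁻¹ * (Efn χ r j y)⁻¹ := by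
      filter_upwards [eventually_nd_lt hx] with y hy
      rw [seqA, pr_stepA hap hE hχ.Efn_le_one hN (S.stepF_single hχ hy) le_rfl,
        stepG_self hap hE hχ.Efn_le_one hN, mul_inv]
    rw [jn_congr e]
    refine (jn_mul_le hs hK ((hap.pr _).contDiff.inv fun y => ((hap.pr _).pos y).ne') hEi).trans ?_
    calc _ ≤ _ := mul_le_mul h.1 hJ (jn_nonneg hK) ((jn_nonneg hK).trans h.1)
      _ ≤ _ := by
        rw [mul_assoc, hM]
        exact mul_le_mul_of_nonneg_left (prod_wt_mul_le hx M) (by positivity)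
  · have e : sg ω (seqA ω χ r N (j + 1)) (N j) =ᶠ[nhds x]
        fun y => sg ω a (N j) y * (Efn χ r j y)⁻¹ := by
      filter_upwards [eventually_nd_lt hx] with y hy
      rw [seqA, sg_stepA hap hE hχ.Efn_le_one hN (S.stepF_single hχ hy) le_rfl,
        stepG_self hap hE hχ.Efn_le_one hN]
    rw [jn_congr e]
    refine (jn_mul_le hs hK (hap.sg_contDiff _) hEi).trans ?_
    refine (mul_le_mul h.2 hJ (jn_nonneg hK) ((jn_nonneg hK).trans h.2)).trans ?_
    rw [Finset.sum_mul]
    refine Finset.sum_le_sum fun k _ => ?_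
    rw [mul_assoc]
    refine mul_le_mul_of_nonneg_left ?_ (by positivity)
    refine le_trans ?_ (pow_le_pow_left₀ (mul_nonneg (hw0 _) (by positivity))
      (prod_wt_mul_le hx k) 2)
    rw [mul_pow]
    refine mul_le_mul_of_nonneg_left ?_ (by positivity)
    exact le_self_pow₀ (one_le_pow₀ (by norm_num)) (by norm_num)

theorem prodBound_of_freePt {j : ℕ} (hCK : ∀ i < j, C / r i ≤ K) (n m : ℕ) {x : ℝ}
    (h0 : FreePt ω r N j x) (hm : FreePt ω r N j (x + m * ω)) :
    ProdBound s K n ω (seqA ω χ r N j) (wt r j) m x := by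
  induction j generalizing m x with
  | zero =>
    refine ⟨?_, ?_⟩
    · simp [pr, seqA, wt, jn_const]
    · have e : sg ω (seqA ω χ r N 0) m = fun _ => ∑ k ∈ Finset.range m, (1 / 64) ^ (2 * k + 1) := by
        funext y
        refine Finset.sum_congr rfl fun k _ => ?_
        simp only [pr, seqA, Finset.prod_const, Finset.card_range]
        rw [← pow_add, one_div, inv_pow]
        congr 2; ring
      rw [e, jn_const, abs_of_nonneg (by positivity)]
      simp [wt]
  | succ j ihj =>
    have hCK' : ∀ i < j, C / r i ≤ K := fun i hi => hCK i (hi.trans (Nat.lt_succ_self j))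
    have hap := S.seqA_posPer hχ (j + 1)
    induction m using Nat.strong_induction_on generalizing x with
    | _ m ihm =>
    have hsplit : ∀ t : ℕ, 0 < t → t < m → FreePt ω r N (j + 1) (x + t * ω) →
        ProdBound s K n ω (seqA ω χ r N (j + 1)) (wt r (j + 1)) m x := by
      intro t ht htm hf
      obtain ⟨u, rfl⟩ := Nat.exists_eq_add_of_lt htm
      rw [add_assoc]
      refine (ihm t htm h0 hf).add hs hK hap (ihm (u + 1) (by omega) hf ?_)
      convert hm using 1
      push_cast; ring
    by_cases hv : ∃ t : ℕ, 0 < t ∧ t < m ∧ nd (x + t * ω) < r j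
    · obtain ⟨t, ht, htm, hx⟩ := hv
      exact hsplit t ht htm (S.freePt_of_nd_lt hx)
    push Not at hv
    by_cases hx : nd x < r j
    · rcases Nat.eq_zero_or_pos m with rfl | hm0
      · exact ProdBound.zero
      have hmN : N j ≤ m := by
        by_contra hlt
        have := hm j (Nat.lt_succ_self j) m hm0 (by omega)
        rw [add_sub_cancel_right] at this
        linarith
      rcases hmN.eq_or_lt with rfl | hlt
      · exact prodBound_return S hχ hs hK (hCK j (Nat.lt_succ_self j)) hx
          (ihj hCK' _ h0.of_succ hm.of_succ)
      · exact hsplit (N j) (S.N_pos j) hlt (S.freePt_add_of_nd_lt hx)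
    · refine ProdBound.mono (fun y => zero_le_one.trans (one_le_wt r j y)) (wt_le_succ r j) ?_
      refine (ihj hCK' m h0.of_succ hm.of_succ).congr ?_
      have hr := S.r_pos j
      have hfar : ∀ i < m, ∀ k < N j, 7 / 8 * r j < nd (x + i * ω - k * ω) := by
        intro i hi k hk
        have : r j ≤ nd (x + i * ω - k * ω) := by
          rcases le_or_gt k i with hki | hki
          · rw [show x + i * ω - k * ω = x + ((i - k : ℕ) : ℝ) * ω by
              rw [Nat.cast_sub hki]; ring]
            rcases Nat.eq_zero_or_pos (i - k) with h | h
            · rw [h]; simpa using hx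
            · exact hv _ h (by omega)
          · rw [show x + i * ω - k * ω = x - ((k - i : ℕ) : ℝ) * ω by
              rw [Nat.cast_sub hki.le]; ring]
            exact h0 j (Nat.lt_succ_self j) (k - i) (by omega) (by omega)
        linarith
      have hev : ∀ᶠ y in nhds x, ∀ i ∈ Finset.range m, ∀ k ∈ Finset.range (N j),
          7 / 8 * r j < nd (y + i * ω - k * ω) := by
        refine (Filter.eventually_all_finset _).2 fun i hi =>
          (Filter.eventually_all_finset _).2 fun k hk => ?_
        refine continuousAt_const.eventually_lt
          (g := fun y : ℝ => nd (y + i * ω - k * ω)) ?_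
          (hfar i (Finset.mem_range.1 hi) k (Finset.mem_range.1 hk))
        exact (nd_continuous.comp (by fun_prop)).continuousAt
      filter_upwards [hev] with y hy i hi
      exact stepA_eq_self fun k hk => S.stepF_eq_zero hχ
        (hy i (Finset.mem_range.2 hi) k (Finset.mem_range.2 hk)).le

end SeqA

theorem contDiff_shift {f : ℝ → ℝ} (hf : Smooth f) (a : ℝ) : Smooth fun y => f (y + a) :=
  hf.comp (contDiff_id.add contDiff_const)

section Increment

variable {s C K ω c : ℝ} {χ : ℝ → ℝ → ℝ} {r : ℕ → ℝ} {N : ℕ → ℕ}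

theorem Sched.N_le_succ (S : Sched ω c r N) (j : ℕ) : N j ≤ N (j + 1) :=
  (S.N_le j).trans (S.N_ge (j + 1))

theorem two_pow_two_pow_succ (j : ℕ) : (2 : ℝ) ^ (2 ^ (j + 1)) / 2 =
    2 ^ (2 ^ j) * (2 ^ (2 ^ j) / 2) := by
  rw [pow_succ 2 j, pow_mul]; ring

theorem four_pow_le_two_pow {j m : ℕ} (hm : 2 ^ (j + 1) ≤ m) : (4 : ℝ) ^ (2 ^ j) ≤ 2 ^ m := by
  calc (4 : ℝ) ^ (2 ^ j) = 2 ^ (2 ^ (j + 1)) := by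
        rw [pow_succ 2 j, mul_comm, pow_mul]; norm_num
    _ ≤ 2 ^ m := pow_le_pow_right₀ (by norm_num) hm

variable (S : Sched ω c r N) (hχ : IsBumpFamily s C χ) (hs : 1 ≤ s) (hK : 0 < K)
  (hc : ∀ k : ℕ, 1 ≤ k → c / k ≤ nd (k * ω)) (hc0 : 0 < c)
include S hχ hs hK

theorem prodBound_N {j n : ℕ} (hCK : ∀ i < j, C / r i ≤ K) {x : ℝ} (hx : nd x < r j) :
    ProdBound s K n ω (seqA ω χ r N j) (wt r j) (N j) x :=
  prodBound_of_freePt S hχ hs hK hCK n (N j) (S.freePt_of_nd_lt hx).of_succ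
    (S.freePt_add_of_nd_lt hx).of_succ

include hc hc0

theorem jn_sg_remainder_le {j n : ℕ} (hCK : ∀ i ≤ j, C / r i ≤ K) {x : ℝ}
    (hx : nd x < r (j + 1)) :
    jn s K n x (fun y => (pr ω (seqA ω χ r N (j + 1)) (N j) y)⁻¹ ^ 2 *
      sg ω (seqA ω χ r N (j + 1)) (N (j + 1) - N j) (y + N j * ω)) ≤
      63 / 128 * (1 / 64) ^ (j + 1) := by
  set a := seqA ω χ r N (j + 1) with ha
  have hap : PosPer a := S.seqA_posPer hχ (j + 1)
  have hxj : nd x < r j := hx.trans_le (S.r_anti (Nat.le_succ j))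
  have h1 : ProdBound s K n ω a (wt r (j + 1)) (N j) x :=
    prodBound_return S hχ hs hK (hCK j le_rfl) hxj
      (prodBound_N S hχ hs hK (fun i hi => hCK i hi.le) hxj)
  have h2 : ProdBound s K n ω a (wt r (j + 1)) (N (j + 1) - N j) (x + N j * ω) := by
    refine prodBound_of_freePt S hχ hs hK (fun i hi => hCK i (Nat.lt_succ_iff.1 hi)) n _
      (S.freePt_add_of_nd_lt hxj) ?_
    convert (S.freePt_add_of_nd_lt hx).of_succ using 1
    rw [Nat.cast_sub (S.N_le_succ j)]; ring
  have hi : Smooth fun y => (pr ω a (N j) y)⁻¹ :=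
    (hap.pr _).contDiff.inv fun y => ((hap.pr _).pos y).ne'
  have hsh : Smooth fun y => sg ω a (N (j + 1) - N j) (y + N j * ω) :=
    (hap.sg_contDiff _).comp (contDiff_id.add contDiff_const)
  set P := ∏ t ∈ Finset.range (N j), wt r (j + 1) (x + t * ω) with hP
  have hw0 : ∀ (k : ℕ) y, 0 ≤ ∏ t ∈ Finset.range k, wt r (j + 1) (y + t * ω) := fun k y =>
    Finset.prod_nonneg fun t _ => zero_le_one.trans (one_le_wt r (j + 1) _)
  have hterm : ∀ k : ℕ, ((1 / 64) ^ (N j) * P) ^ 2 * ((1 / 64) ^ (2 * k + 1) *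
      (∏ t ∈ Finset.range (k + 1), wt r (j + 1) (x + N j * ω + t * ω)) ^ 2) ≤
      1 / 16 * (1 / 64) ^ (N j) * (1 / 64 : ℝ) ^ k := by
    intro k
    have e : P * ∏ t ∈ Finset.range (k + 1), wt r (j + 1) (x + N j * ω + t * ω) =
        ∏ t ∈ Finset.range (N j + (k + 1)), wt r (j + 1) (x + t * ω) := by
      rw [Finset.prod_range_add _ (N j), ← hP]
      congr 1
      refine Finset.prod_congr rfl fun t _ => ?_
      congr 1; push_cast; ring
    have hb : P * ∏ t ∈ Finset.range (k + 1), wt r (j + 1) (x + N j * ω + t * ω) ≤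
        2 * 8 ^ (N j + k) := by
      rw [e]
      refine (S.prod_wt_le hc hc0 (j + 1) _ x).trans ?_
      calc (4 : ℝ) ^ 2 ^ (j + 1) * 2 ^ (N j + (k + 1)) ≤
          4 ^ (N j + k) * 2 ^ (N j + (k + 1)) := by
            gcongr
            · norm_num
            · exact (S.N_ge j).trans (Nat.le_add_right _ _)
        _ = _ := by
            rw [show (8 : ℝ) = 4 * 2 by norm_num, mul_pow]; ring
    calc _ = (1 / 64) ^ (2 * (N j + k) + 1) *
          (P * ∏ t ∈ Finset.range (k + 1), wt r (j + 1) (x + N j * ω + t * ω)) ^ 2 := by ring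
      _ ≤ (1 / 64) ^ (2 * (N j + k) + 1) * (2 * 8 ^ (N j + k)) ^ 2 := by
          gcongr
          exact mul_nonneg (hw0 _ _) (hw0 _ _)
      _ = 1 / 16 * ((1 / 64) ^ 2 * 8 ^ 2) ^ (N j + k) := by
          simp only [mul_pow, ← pow_mul, pow_succ _ (2 * (N j + k))]
          ring
      _ = _ := by norm_num [pow_add, mul_assoc]
  calc _ ≤ _ := jn_mul_le hs hK (hi.pow 2) hsh
    _ ≤ ((1 / 64) ^ (N j) * P) ^ 2 * ∑ k ∈ Finset.range (N (j + 1) - N j), (1 / 64) ^ (2 * k + 1) *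
        (∏ t ∈ Finset.range (k + 1), wt r (j + 1) (x + N j * ω + t * ω)) ^ 2 := by
      rw [jn_comp_add]
      exact mul_le_mul ((jn_pow_le hs hK hi 2).trans (pow_le_pow_left₀ (jn_nonneg hK) h1.1 2)) h2.2
        (jn_nonneg hK) (by positivity)
    _ ≤ 1 / 16 * (1 / 64) ^ (N j) * ∑ k ∈ Finset.range (N (j + 1) - N j), (1 / 64 : ℝ) ^ k := by
      rw [Finset.mul_sum, Finset.mul_sum]
      exact Finset.sum_le_sum fun k _ => hterm k
    _ ≤ 1 / 16 * (1 / 64) ^ (N j) * 2 := by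
      gcongr
      rw [Finset.range_eq_Ico]
      refine (geom_sum_Ico_le_of_lt_one (by norm_num) (by norm_num)).trans ?_
      norm_num
    _ ≤ 1 / 16 * (1 / 64) ^ (j + 1) * 2 := by
      have : j + 1 ≤ N j := (Nat.lt_two_pow_self).le.trans (S.N_ge j)
      have h := pow_le_pow_of_le_one (by norm_num : (0 : ℝ) ≤ 1 / 64) (by norm_num) this
      linarith
    _ ≤ _ := by
      have : (0 : ℝ) ≤ (1 / 64) ^ (j + 1) := by positivity
      linarith

theorem jn_sg_sub_le {j : ℕ} (n : ℕ) (hCK : ∀ i < j, C / r i ≤ K) {x : ℝ} (hx : nd x < r j) :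
    jn s K n x (fun y => sg ω (seqA ω χ r N j) (N j) y -
      2 ^ (2 ^ j) / 2 * ∑ k ∈ Finset.range (N 0), (1 / 64) ^ (2 * k + 1)) ≤
      2 ^ (2 ^ j) / 2 * (1 / 128 - (1 / 64) ^ (j + 1) / 2) := by
  induction j with
  | zero =>
    have e : ∀ y, sg ω (seqA ω χ r N 0) (N 0) y =
        ∑ k ∈ Finset.range (N 0), (1 / 64) ^ (2 * k + 1) := by
      intro y
      refine Finset.sum_congr rfl fun k _ => ?_
      simp only [pr, seqA, Finset.prod_const, Finset.card_range]
      rw [← pow_add, one_div, inv_pow]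
      congr 2; ring
    simp only [e]
    rw [jn_const]
    norm_num
  | succ j ih =>
    have hxj : nd x < r j := hx.trans_le (S.r_anti (Nat.le_succ j))
    have ih := ih (fun i hi => hCK i (hi.trans (Nat.lt_succ_self j))) hxj
    have hR := jn_sg_remainder_le S hχ hs hK hc hc0 (n := n)
      (fun i hi => hCK i (Nat.lt_succ_of_le hi)) hx
    have hap := S.seqA_posPer hχ j
    have hap1 := S.seqA_posPer hχ (j + 1)
    have hE : PosPer (Efn χ r j) := hχ.Efn_posPer (S.r_pos j) (S.r_le_one j)
    set b := ∑ k ∈ Finset.range (N 0), (1 / 64 : ℝ) ^ (2 * k + 1)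
    have hloc : (fun y => sg ω (seqA ω χ r N (j + 1)) (N (j + 1)) y - 2 ^ (2 ^ (j + 1)) / 2 * b)
        =ᶠ[nhds x] fun y => 2 ^ (2 ^ j) * (sg ω (seqA ω χ r N j) (N j) y - 2 ^ (2 ^ j) / 2 * b) +
          (pr ω (seqA ω χ r N (j + 1)) (N j) y)⁻¹ ^ 2 *
            sg ω (seqA ω χ r N (j + 1)) (N (j + 1) - N j) (y + N j * ω) := by
      filter_upwards [eventually_nd_lt hx] with y hy
      have hyj : nd y < r j := hy.trans_le (S.r_anti (Nat.le_succ j))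
      have e1 : sg ω (seqA ω χ r N (j + 1)) (N j) y =
          sg ω (seqA ω χ r N j) (N j) y * 2 ^ (2 ^ j) := by
        rw [seqA, sg_stepA hap hE hχ.Efn_le_one (S.N_pos j) (S.stepF_single hχ hyj) le_rfl,
          stepG_self hap hE hχ.Efn_le_one (S.N_pos j),
          hχ.Efn_inv_eq (S.r_pos j) (hy.le.trans (S.r_succ j))]
      have e2 := sg_add (ω := ω) (a := seqA ω χ r N (j + 1)) (N j) (N (j + 1) - N j) y
      rw [Nat.add_sub_cancel' (S.N_le_succ j), e1] at e2
      rw [e2, two_pow_two_pow_succ]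
      ring
    rw [jn_congr hloc]
    have hs1 : Smooth fun y => sg ω (seqA ω χ r N j) (N j) y - 2 ^ (2 ^ j) / 2 * b :=
      (hap.sg_contDiff _).sub contDiff_const
    have hi : Smooth fun y => (pr ω (seqA ω χ r N (j + 1)) (N j) y)⁻¹ :=
      (hap1.pr _).contDiff.inv fun y => ((hap1.pr _).pos y).ne'
    refine (jn_add_le hK (contDiff_const.mul hs1) ((hi.pow 2).mul
      (contDiff_shift (hap1.sg_contDiff _) _))).trans ?_
    rw [jn_const_mul, abs_of_pos (by positivity), two_pow_two_pow_succ]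
    set p : ℝ := 2 ^ (2 ^ j) / 2 with hp
    have hp1 : 1 ≤ 2 ^ (2 ^ j) * p := by
      rw [hp, ← two_pow_two_pow_succ, le_div_iff₀ (by norm_num), one_mul]
      exact le_self_pow₀ (by norm_num) (by positivity)
    have h0 : (0 : ℝ) ≤ (1 / 64) ^ (j + 1) := by positivity
    have h2 := mul_le_mul_of_nonneg_left ih (by positivity : (0 : ℝ) ≤ 2 ^ (2 ^ j))
    have h3 := mul_le_mul_of_nonneg_right hp1
      (by positivity : (0 : ℝ) ≤ 63 / 128 * (1 / 64) ^ (j + 1))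
    rw [pow_succ _ (j + 1)]
    linarith

theorem jn_sg_inv_le {j : ℕ} (n : ℕ) (hCK : ∀ i < j, C / r i ≤ K) {x : ℝ} (hx : nd x < r j) :
    jn s K n x (fun y => (sg ω (seqA ω χ r N j) (N j) y)⁻¹) ≤ 256 * (2 ^ (2 ^ j))⁻¹ := by
  have hap := S.seqA_posPer hχ j
  have h := jn_sg_sub_le S hχ hs hK hc hc0 n hCK hx
  set b := ∑ k ∈ Finset.range (N 0), (1 / 64 : ℝ) ^ (2 * k + 1) with hb
  have hb1 : 1 / 64 ≤ b := by
    have := Finset.single_le_sum (f := fun k => (1 / 64 : ℝ) ^ (2 * k + 1))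
      (fun _ _ => by positivity) (Finset.mem_range.2 (S.N_pos 0))
    simpa [hb] using this
  set p : ℝ := 2 ^ (2 ^ j) / 2 with hp
  have hp0 : 0 < p := by positivity
  have h' := h.trans (mul_le_mul_of_nonneg_left
    (sub_le_self (1 / 128 : ℝ) (by positivity : (0 : ℝ) ≤ (1 / 64) ^ (j + 1) / 2)) hp0.le)
  refine (jn_inv_le hs hK (hap.sg_contDiff _) (fun y => (hap.sg_pos (S.N_pos j) y).ne') h'
    (by nlinarith)).trans ?_
  rw [show (256 : ℝ) * (2 ^ (2 ^ j))⁻¹ = (p * (1 / 128))⁻¹ by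
    rw [hp]; field_simp; norm_num]
  exact inv_anti₀ (by positivity) (by nlinarith)

theorem jn_stepF_le {j : ℕ} (n : ℕ) (hCK : ∀ i ≤ j, C / r i ≤ K) (x : ℝ) :
    jn s K n x (stepF ω (seqA ω χ r N j) (Efn χ r j) (N j)) ≤ 512 * (7 / 8) ^ (2 ^ j) := by
  have hap := S.seqA_posPer hχ j
  have hE : PosPer (Efn χ r j) := hχ.Efn_posPer (S.r_pos j) (S.r_le_one j)
  by_cases hx : nd x < r j
  · refine (jn_mul_le hs hK (contDiff_const.sub hE.contDiff) ((hap.sg_contDiff _).inv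
      fun y => (hap.sg_pos (S.N_pos j) y).ne')).trans ?_
    refine (mul_le_mul (hχ.jn_one_sub_Efn_le (S.r_pos j) (S.r_le_one j) hs hK (hCK j le_rfl) n x)
      (jn_sg_inv_le S hχ hs hK hc hc0 n (fun i hi => hCK i hi.le) hx)
      (jn_nonneg hK) (by positivity)).trans_eq ?_
    rw [show (7 / 8 : ℝ) = 7 / 4 * 2⁻¹ by norm_num, mul_pow, inv_pow]
    ring
  · have : stepF ω (seqA ω χ r N j) (Efn χ r j) (N j) =ᶠ[nhds x] fun _ => 0 := by
      filter_upwards [eventually_lt_nd (x := x) (ρ := 7 / 8 * r j)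
        (by linarith [S.r_pos j])] with y hy
      exact S.stepF_eq_zero hχ hy.le
    rw [jn_congr this, jn_const, abs_zero]
    positivity

theorem jn_stepF_mul_le {j : ℕ} (n : ℕ) (hCK : ∀ i ≤ j, C / r i ≤ K) (x : ℝ) :
    jn s K n x (fun z => stepF ω (seqA ω χ r N j) (Efn χ r j) (N j) z * (Efn χ r j z)⁻¹ *
      (pr ω (seqA ω χ r N j) (N j) z)⁻¹ ^ 2) ≤ 512 * (7 / 8) ^ (2 ^ j) := by
  have hap := S.seqA_posPer hχ j
  have hE : PosPer (Efn χ r j) := hχ.Efn_posPer (S.r_pos j) (S.r_le_one j)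
  have hF := stepF_contDiff (ω := ω) hap hE hχ.Efn_le_one (S.N_pos j)
  have hEi : Smooth fun y => (Efn χ r j y)⁻¹ := hE.contDiff.inv fun y => (hE.pos y).ne'
  have hi : Smooth fun y => (pr ω (seqA ω χ r N j) (N j) y)⁻¹ :=
    (hap.pr _).contDiff.inv fun y => ((hap.pr _).pos y).ne'
  by_cases hx : nd x < r j
  · have h1 : jn s K n x (fun y => (pr ω (seqA ω χ r N j) (N j) y)⁻¹) ≤
        (1 / 64) ^ N j * (2 ^ N j * 2 ^ N j) := by
      refine (prodBound_N S hχ hs hK (fun i hi => hCK i hi.le) hx).1.trans ?_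
      gcongr
      refine (S.prod_wt_le hc hc0 j _ x).trans ?_
      gcongr
      exact four_pow_le_two_pow (S.N_ge j)
    have h2 : jn s K n x (fun y => (Efn χ r j y)⁻¹) ≤ 2 ^ N j :=
      (hχ.jn_Efn_inv_le (S.r_pos j) (S.r_le_one j) hs hK (hCK j le_rfl) n x).trans
        (four_pow_le_two_pow (S.N_ge j))
    have h3 := jn_stepF_le S hχ hs hK hc hc0 n hCK x
    calc _ ≤ _ := jn_mul_le hs hK (hF.mul hEi) (hi.pow 2)
      _ ≤ (512 * (7 / 8) ^ (2 ^ j) * 2 ^ N j) * ((1 / 64) ^ N j * (2 ^ N j * 2 ^ N j)) ^ 2 := by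
        refine mul_le_mul ((jn_mul_le hs hK hF hEi).trans (mul_le_mul h3 h2 (jn_nonneg hK)
          (by positivity))) ((jn_pow_le hs hK hi 2).trans (pow_le_pow_left₀ (jn_nonneg hK) h1 2))
          (jn_nonneg hK) (by positivity)
      _ = 512 * (7 / 8) ^ (2 ^ j) * (2 * ((1 / 64) * (2 * 2)) ^ 2) ^ N j := by
        simp only [mul_pow, ← pow_mul]
        ring
      _ ≤ _ := mul_le_of_le_one_right (by positivity) (pow_le_one₀ (by norm_num) (by norm_num))
  · have : (fun z => stepF ω (seqA ω χ r N j) (Efn χ r j) (N j) z * (Efn χ r j z)⁻¹ *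
      (pr ω (seqA ω χ r N j) (N j) z)⁻¹ ^ 2) =ᶠ[nhds x] fun _ => 0 := by
      filter_upwards [eventually_lt_nd (x := x) (ρ := 7 / 8 * r j)
        (by linarith [S.r_pos j])] with y hy
      rw [S.stepF_eq_zero hχ hy.le, zero_mul, zero_mul]
    rw [jn_congr this, jn_const, abs_zero]
    positivity

omit hs hK hc hc0 in
theorem pot_seqA_succ (j : ℕ) (y : ℝ) :
    pot ω (seqA ω χ r N (j + 1)) y = pot ω (seqA ω χ r N j) y -
      stepF ω (seqA ω χ r N j) (Efn χ r j) (N j) (y + ω) +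
      stepF ω (seqA ω χ r N j) (Efn χ r j) (N j) (y - (N j - 1 : ℝ) * ω) *
        (Efn χ r j (y - (N j - 1 : ℝ) * ω))⁻¹ *
        (pr ω (seqA ω χ r N j) (N j) (y - (N j - 1 : ℝ) * ω))⁻¹ ^ 2 := by
  refine pot_stepA (S.seqA_posPer hχ j) (hχ.Efn_posPer (S.r_pos j) (S.r_le_one j)) hχ.Efn_le_one
    (S.N_pos j) fun k hk l hl hkl hne => ?_
  have hr := S.r_pos j
  have hlt : nd (y + ω - k * ω) < r j := by
    by_contra h
    exact hne (S.stepF_eq_zero hχ (by linarith))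
  exact S.stepF_eq_zero hχ (by linarith [S.nd_sub_ge hk hl hkl hlt])

theorem jn_pot_sub_le {j : ℕ} (n : ℕ) (hCK : ∀ i ≤ j, C / r i ≤ K) (x : ℝ) :
    jn s K n x (fun y => pot ω (seqA ω χ r N (j + 1)) y - pot ω (seqA ω χ r N j) y) ≤
      1024 * (7 / 8) ^ (2 ^ j) := by
  have hap := S.seqA_posPer hχ j
  have hE : PosPer (Efn χ r j) := hχ.Efn_posPer (S.r_pos j) (S.r_le_one j)
  have hF := stepF_contDiff (ω := ω) hap hE hχ.Efn_le_one (S.N_pos j)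
  have hG : Smooth fun z => stepF ω (seqA ω χ r N j) (Efn χ r j) (N j) z * (Efn χ r j z)⁻¹ *
      (pr ω (seqA ω χ r N j) (N j) z)⁻¹ ^ 2 :=
    (hF.mul (hE.contDiff.inv fun y => (hE.pos y).ne')).mul
      (((hap.pr _).contDiff.inv fun y => ((hap.pr _).pos y).ne').pow 2)
  set F := stepF ω (seqA ω χ r N j) (Efn χ r j) (N j) with hFd
  set G := fun z => F z * (Efn χ r j z)⁻¹ * (pr ω (seqA ω χ r N j) (N j) z)⁻¹ ^ 2 with hGd
  have e : (fun y => pot ω (seqA ω χ r N (j + 1)) y - pot ω (seqA ω χ r N j) y) =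
      fun y => G (y + -((N j - 1 : ℝ) * ω)) - F (y + ω) := by
    funext y
    rw [pot_seqA_succ S hχ, ← sub_eq_add_neg]
    simp only [hGd, hFd]
    ring
  rw [e]
  refine (jn_sub_le hK (contDiff_shift hG _) (contDiff_shift hF _)).trans ?_
  rw [jn_comp_add, jn_comp_add]
  have h1 := jn_stepF_le S hχ hs hK hc hc0 n hCK (x + ω)
  have h2 := jn_stepF_mul_le S hχ hs hK hc hc0 n hCK (x + -((N j - 1 : ℝ) * ω))
  linarith

omit hK in
theorem gevreyBound_pot_sub (hC : 0 < C) (j : ℕ) :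
    GevreyBound s (1024 * (7 / 8) ^ (2 ^ j)) (C / r j)
      (fun y => pot ω (seqA ω χ r N (j + 1)) y - pot ω (seqA ω χ r N j) y) :=
  GevreyBound.of_jn_le (div_pos hC (S.r_pos j)) fun n x =>
    jn_pot_sub_le S hχ hs (div_pos hC (S.r_pos j)) hc hc0 n
      (fun _ hi => div_le_div_of_nonneg_left hC.le (S.r_pos j) (S.r_anti hi)) x

omit hs hK hc hc0 in
theorem integral_log_seqA_succ (j : ℕ) :
    ∫ x in (0 : ℝ)..(2 * π), log (seqA ω χ r N (j + 1) x) =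
      (∫ x in (0 : ℝ)..(2 * π), log (seqA ω χ r N j x)) +
        2 ^ j * ∫ x in (0 : ℝ)..(2 * π), log (1 - χ (r j) x / 2) := by
  rw [seqA, integral_log_stepA (S.seqA_posPer hχ j) (hχ.Efn_posPer (S.r_pos j) (S.r_le_one j))
    hχ.Efn_le_one (S.N_pos j), ← intervalIntegral.integral_const_mul]
  simp only [Efn, log_pow]
  push_cast
  rfl

end Increment

/-! ### The Gevrey norm at scale one -/

/-- The weight of the `k`-th derivative in the Gevrey norm of index `s` and scale one. -/
def gw (s : ℝ) (k : ℕ) : ℝ := 4 * π ^ 2 / 3 * ((1 + (k : ℝ)) ^ 2 / (k.factorial : ℝ) ^ s)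

/-- The Gevrey norm of index `s` and scale one of `f` is at most `u`. -/
def GevreyLe (s : ℝ) (f : ℝ → ℝ) (u : ℝ) : Prop := ∀ k x, gw s k * |iteratedDeriv k f x| ≤ u

section GevreyLe

variable {s u u' : ℝ} {f g : ℝ → ℝ}

theorem gw_pos (s : ℝ) (k : ℕ) : 0 < gw s k := by
  have := pi_pos
  unfold gw; positivity

theorem GevreyLe.mono (h : GevreyLe s f u) (hu : u ≤ u') : GevreyLe s f u' :=
  fun k x => (h k x).trans hu

theorem GevreyLe.gevreyNorm_le (h : GevreyLe s f u) : gevreyNorm s 1 f ≤ ENNReal.ofReal u := by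
  refine iSup_le fun k => ?_
  rw [ENNReal.mul_iSup]
  refine iSup_le fun x => ?_
  rw [ENNReal.mul_iSup]
  refine iSup_le fun _ => ?_
  rw [one_pow, one_mul]
  change ENNReal.ofReal (gw s k) * _ ≤ _
  rw [← ENNReal.ofReal_mul (gw_pos s k).le]
  exact ENNReal.ofReal_le_ofReal (h k x)

theorem GevreyLe.abs_le (h : GevreyLe s f u) (x : ℝ) : |f x| ≤ u := by
  refine le_trans ?_ (h 0 x)
  have : (1 : ℝ) ≤ gw s 0 := by
    have := pi_gt_three
    simp only [gw, Nat.factorial_zero, Nat.cast_one, one_rpow, Nat.cast_zero]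
    nlinarith
  rw [iteratedDeriv_zero]
  exact le_mul_of_one_le_left (abs_nonneg _) this

theorem GevreyLe.add (hf : Smooth f) (hg : Smooth g) (h : GevreyLe s f u) (h' : GevreyLe s g u') :
    GevreyLe s (fun x => f x + g x) (u + u') := fun k x => by
  rw [iteratedDeriv_fun_add (contDiffAt_nat hf k x) (contDiffAt_nat hg k x)]
  calc _ ≤ gw s k * (|iteratedDeriv k f x| + |iteratedDeriv k g x|) :=
        mul_le_mul_of_nonneg_left (abs_add_le _ _) (gw_pos s k).le
    _ ≤ _ := by rw [mul_add]; exact add_le_add (h k x) (h' k x)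

theorem GevreyLe.neg (h : GevreyLe s f u) : GevreyLe s (fun x => -f x) u := fun k x => by
  have : (fun x => -f x) = fun x => (-1) * f x := by funext x; ring
  rw [this, iteratedDeriv_const_mul_field, abs_mul, abs_neg, abs_one, one_mul]
  exact h k x

theorem GevreyLe.sub (hf : Smooth f) (hg : Smooth g) (h : GevreyLe s f u) (h' : GevreyLe s g u') :
    GevreyLe s (fun x => f x - g x) (u + u') := by
  simp only [sub_eq_add_neg]
  exact h.add hf hg.neg h'.neg

theorem GevreyLe.const (s c : ℝ) : GevreyLe s (fun _ => c) (gw s 0 * |c|) := fun k x => by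
  rw [iteratedDeriv_const]
  split_ifs with hk
  · rw [hk]
  · rw [abs_zero, mul_zero]
    exact mul_nonneg (gw_pos s 0).le (abs_nonneg c)

theorem GevreyLe.norm_iteratedFDeriv_le (h : GevreyLe s f u) (k : ℕ) (x : ℝ) :
    ‖iteratedFDeriv ℝ k f x‖ ≤ u / gw s k := by
  rw [norm_iteratedFDeriv_eq_norm_iteratedDeriv, le_div_iff₀' (gw_pos s k)]
  exact h k x

theorem contDiff_tsum_of_gevreyLe {F : ℕ → ℝ → ℝ} {U : ℕ → ℝ} (hF : ∀ i, Smooth (F i))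
    (h : ∀ i, GevreyLe s (F i) (U i)) (hU : Summable U) : Smooth fun x => ∑' i, F i x :=
  contDiff_tsum (v := fun k i => U i / gw s k) hF (fun _ _ => hU.div_const _)
    fun k i x _ => (h i).norm_iteratedFDeriv_le k x

theorem GevreyLe.tsum {F : ℕ → ℝ → ℝ} {U : ℕ → ℝ} (hF : ∀ i, Smooth (F i))
    (h : ∀ i, GevreyLe s (F i) (U i)) (hU : Summable U) :
    GevreyLe s (fun x => ∑' i, F i x) (∑' i, U i) := fun k x => by
  rw [← le_div_iff₀' (gw_pos s k), ← Real.norm_eq_abs, ← norm_iteratedFDeriv_eq_norm_iteratedDeriv,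
    iteratedFDeriv_tsum_apply (v := fun k i => U i / gw s k) (N := ⊤) hF
      (fun k _ => hU.div_const _) (fun k i x _ => (h i).norm_iteratedFDeriv_le k x) le_top,
    ← tsum_div_const]
  exact tsum_of_norm_bounded (hU.div_const _).hasSum fun i => (h i).norm_iteratedFDeriv_le k x

theorem GevreyBound.gevreyLe {s' d A D : ℝ} (hd : 0 < d) (hA : 0 ≤ A) (hD : 0 ≤ D)
    (h : GevreyBound s' A D f) :
    GevreyLe (s' + d) f (4 * π ^ 2 / 3 * A * exp (d * (4 * D) ^ (1 / d))) := fun k x => by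
  have hk0 : (0 : ℝ) < k.factorial := by positivity
  have h2 : (1 + (k : ℝ)) ^ 2 ≤ 4 ^ k := by
    have : (1 + (k : ℝ)) ≤ 2 ^ k := by
      have := one_add_mul_le_pow (a := (1 : ℝ)) (by norm_num) k
      norm_num at this; linarith
    calc _ ≤ ((2 : ℝ) ^ k) ^ 2 := by gcongr
      _ = _ := by rw [← pow_mul, mul_comm, pow_mul]; norm_num
  have h3 : (4 * D) ^ k / (k.factorial : ℝ) ^ d ≤ exp (d * (4 * D) ^ (1 / d)) := by
    have := pow_div_factorial_le_exp (x := (4 * D) ^ (1 / d)) (by positivity) k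
    have := rpow_le_rpow (by positivity) this hd.le
    rw [div_rpow (by positivity) hk0.le, ← rpow_natCast, ← rpow_mul (by positivity),
      ← rpow_mul (by positivity), ← exp_mul] at this
    rw [← rpow_natCast, mul_comm d]
    convert this using 3
    field_simp
  rw [gw]
  have hp : (0 : ℝ) ≤ 4 * π ^ 2 / 3 := by positivity
  calc _ ≤ 4 * π ^ 2 / 3 * ((1 + (k : ℝ)) ^ 2 / (k.factorial : ℝ) ^ (s' + d)) *
        (A * D ^ k * (k.factorial : ℝ) ^ s') := by gcongr; exact h k x
    _ = 4 * π ^ 2 / 3 * A * ((1 + (k : ℝ)) ^ 2 * D ^ k / (k.factorial : ℝ) ^ d) := by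
        rw [rpow_add hk0]; field_simp
    _ ≤ 4 * π ^ 2 / 3 * A * ((4 * D) ^ k / (k.factorial : ℝ) ^ d) := by
        rw [mul_pow]; gcongr
    _ ≤ _ := by gcongr

end GevreyLe

/-- A bound on the size of the `j`-th perturbation. -/
def stepSize (d e ρ C : ℝ) (j : ℕ) : ℝ :=
  4 * π ^ 2 / 3 * (1024 * (7 / 8) ^ (2 ^ j)) *
    exp (d * (4 * (C / (ρ * 2 ^ (-e * j)))) ^ (1 / d))

theorem summable_stepSize {d e ρ C : ℝ} (hd : 0 < d) (hed : e < d) (hρ : 0 < ρ) (hC : 0 < C) :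
    Summable (stepSize d e ρ C) := by
  have hC2 : ∃ B : ℝ, ∀ j : ℕ, d * (4 * (C / (ρ * 2 ^ (-e * (j : ℝ))))) ^ (1 / d) =
      B * (2 : ℝ) ^ (e / d * (j : ℝ)) := by
    refine ⟨d * (4 * (C / ρ)) ^ (1 / d), fun j => ?_⟩
    rw [neg_mul, rpow_neg (by norm_num), show 4 * (C / (ρ * (2 ^ (e * (j : ℝ)))⁻¹)) =
      4 * (C / ρ) * (2 : ℝ) ^ (e * (j : ℝ)) by field_simp, mul_rpow (by positivity) (by positivity),
      ← rpow_mul (by norm_num), show e * (j : ℝ) * (1 / d) = e / d * j by ring, ← mul_assoc]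
  obtain ⟨B, hB⟩ := hC2
  set L : ℝ := -log (7 / 8) with hL
  have hL0 : 0 < L := by rw [hL, neg_pos]; exact log_neg (by norm_num) (by norm_num)
  have e78 : ∀ j : ℕ, (7 / 8 : ℝ) ^ (2 ^ j) = exp (-(L * (2 : ℝ) ^ (j : ℝ))) := fun j => by
    rw [hL, neg_mul, neg_neg, exp_mul, exp_log (by norm_num)]
    norm_cast
  have hsz : ∀ j, stepSize d e ρ C j = 4 * π ^ 2 / 3 * 1024 *
      exp (-(L * (2 : ℝ) ^ (j : ℝ)) + B * (2 : ℝ) ^ (e / d * (j : ℝ))) := fun j => by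
    rw [stepSize, hB, exp_add, e78]; ring
  have hlim : Tendsto (fun j : ℕ => (2 : ℝ) ^ ((e / d - 1) * (j : ℝ))) atTop (nhds 0) := by
    have h0 : e / d - 1 < 0 := by rw [sub_neg, div_lt_one hd]; exact hed
    have : ∀ j : ℕ, (2 : ℝ) ^ ((e / d - 1) * (j : ℝ)) = ((2 : ℝ) ^ (e / d - 1)) ^ j := fun j => by
      rw [rpow_mul (by norm_num), rpow_natCast]
    simp only [this]
    exact tendsto_pow_atTop_nhds_zero_of_lt_one (by positivity)
      (rpow_lt_one_of_one_lt_of_neg (by norm_num) h0)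
  have hev : ∀ᶠ j : ℕ in atTop, B * (2 : ℝ) ^ ((e / d - 1) * (j : ℝ)) < L / 2 := by
    have := hlim.const_mul B
    rw [mul_zero] at this
    exact this.eventually_lt_const (by positivity)
  have hg : Summable fun j : ℕ => 4 * π ^ 2 / 3 * 1024 * exp (-(L / 2)) ^ j := by
    refine Summable.mul_left _ (summable_geometric_of_lt_one (exp_pos _).le ?_)
    rw [exp_lt_one_iff]; linarith
  refine Summable.of_norm_bounded_eventually_nat hg ?_
  filter_upwards [hev] with j hj
  rw [hsz, Real.norm_of_nonneg (by positivity), ← exp_nat_mul]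
  gcongr
  have h1 : (2 : ℝ) ^ (e / d * (j : ℝ)) =
      (2 : ℝ) ^ ((e / d - 1) * (j : ℝ)) * (2 : ℝ) ^ (j : ℝ) := by
    rw [← rpow_add (by norm_num)]; congr 1; ring
  have h2 : (j : ℝ) ≤ (2 : ℝ) ^ (j : ℝ) := by
    rw [rpow_natCast]; exact_mod_cast (Nat.lt_two_pow_self).le
  have h3 : (0 : ℝ) < (2 : ℝ) ^ (j : ℝ) := by positivity
  rw [h1]
  nlinarith

theorem stepSize_nonneg (d e ρ C : ℝ) (j : ℕ) : 0 ≤ stepSize d e ρ C j := by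
  unfold stepSize; positivity

theorem gevreyLe_pot_sub {s d e ρ C ω c : ℝ} {χ : ℝ → ℝ → ℝ} {r : ℕ → ℝ} {N : ℕ → ℕ}
    (S : Sched ω c r N) (hχ : IsBumpFamily s C χ) (hs : 1 ≤ s)
    (hc : ∀ k : ℕ, 1 ≤ k → c / k ≤ nd (k * ω)) (hc0 : 0 < c) (hd : 0 < d) (hρ : 0 < ρ)
    (hC : 0 < C) (hr : ∀ j : ℕ, ρ * (2 : ℝ) ^ (-e * (j : ℝ)) ≤ r j) (j : ℕ) :
    GevreyLe (s + d) (fun y => pot ω (seqA ω χ r N (j + 1)) y - pot ω (seqA ω χ r N j) y)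
      (stepSize d e ρ C j) := by
  have hr0 := S.r_pos j
  refine ((gevreyBound_pot_sub S hχ hs hc hc0 hC j).gevreyLe hd (by positivity)
    (by positivity)).mono ?_
  unfold stepSize
  gcongr
  exact hr j

/-! ### Uniform convergence of Birkhoff averages for irrational rotations -/

theorem fourier_rotation_ne_one {α : ℝ} (hα : Irrational α) {k : ℤ} (hk : k ≠ 0) :
    fourier k ((2 * π * α : ℝ) : AddCircle (2 * π)) ≠ 1 := by
  have : Fact (0 < 2 * π) := ⟨two_pi_pos⟩
  intro h
  rw [fourier_apply, Circle.coe_eq_one, ← AddCircle.toCircle_zero] at h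
  have h0 := AddCircle.injective_toCircle two_pi_pos.ne' h
  rw [← AddCircle.coe_zsmul, AddCircle.coe_eq_zero_iff] at h0
  obtain ⟨n, hn⟩ := h0
  have hk' : (k : ℝ) ≠ 0 := by exact_mod_cast hk
  have e : α = ((n / k : ℚ) : ℝ) := by
    push_cast
    rw [eq_div_iff hk']
    rw [zsmul_eq_mul, zsmul_eq_mul] at hn
    have := two_pi_pos.ne'
    apply mul_left_cancel₀ this
    linear_combination -hn
  exact hα ⟨_, e.symm⟩

theorem exists_birkhoff_sum_bound {α : ℝ} (hα : Irrational α)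
    {p : C(AddCircle (2 * π), ℂ)} (hp : p ∈ Submodule.span ℂ (Set.range (@fourier (2 * π)))) :
    ∃ (m : ℂ) (D : ℝ), ∀ (n : ℕ) (x : AddCircle (2 * π)),
      ‖∑ t ∈ Finset.range n, p (x + (t • (2 * π * α : ℝ) : AddCircle (2 * π))) - n * m‖ ≤ D := by
  induction hp using Submodule.span_induction with
  | mem p hp =>
    obtain ⟨k, rfl⟩ := hp
    by_cases hk : k = 0
    · exact ⟨1, 0, fun n x => by simp [hk]⟩
    · have hne := fourier_rotation_ne_one hα hk
      set z := fourier k ((2 * π * α : ℝ) : AddCircle (2 * π)) with hz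
      have hz1 : ‖z‖ = 1 := by rw [hz, fourier_apply]; exact Circle.norm_coe _
      refine ⟨0, 2 / ‖z - 1‖, fun n x => ?_⟩
      have e : ∀ t : ℕ, fourier k (x + (t • (2 * π * α : ℝ) : AddCircle (2 * π))) =
          fourier k x * z ^ t := fun t => by
        rw [hz, fourier_apply, fourier_apply, fourier_apply, smul_add, AddCircle.toCircle_add,
          Circle.coe_mul, ← Circle.coe_pow, ← AddCircle.toCircle_nsmul]
        congr 3
        exact smul_comm _ _ _
      simp only [e]
      rw [← Finset.mul_sum, geom_sum_eq hne, mul_zero, sub_zero, norm_mul, norm_div, fourier_apply,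
        Circle.norm_coe, one_mul]
      gcongr
      calc ‖z ^ n - 1‖ ≤ ‖z ^ n‖ + ‖(1 : ℂ)‖ := norm_sub_le _ _
        _ = 2 := by rw [norm_pow, hz1, one_pow, norm_one]; norm_num
  | zero => exact ⟨0, 0, fun n x => by simp⟩
  | add p q _ _ hp hq =>
    obtain ⟨m, D, h⟩ := hp
    obtain ⟨m', D', h'⟩ := hq
    refine ⟨m + m', D + D', fun n x => (le_of_eq ?_).trans
      ((norm_add_le _ _).trans (add_le_add (h n x) (h' n x)))⟩
    simp only [ContinuousMap.add_apply, Finset.sum_add_distrib]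
    congr 1; ring
  | smul c p _ hp =>
    obtain ⟨m, D, h⟩ := hp
    refine ⟨c * m, ‖c‖ * D, fun n x => (le_of_eq ?_).trans
      (mul_le_mul_of_nonneg_left (h n x) (norm_nonneg c))⟩
    rw [← norm_mul, mul_sub, Finset.mul_sum]
    simp only [ContinuousMap.smul_apply, smul_eq_mul]
    congr 1; ring

theorem exists_birkhoff_sum_le {α : ℝ} (hα : Irrational α) {g : ℝ → ℝ} (hg : Continuous g)
    (hp : Function.Periodic g (2 * π)) {ε : ℝ} (hε : 0 < ε) :
    ∃ D : ℝ, ∀ (n : ℕ) (x : ℝ),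
      |∑ t ∈ Finset.range n, g (x + t * (2 * π * α)) -
        n * ((2 * π)⁻¹ * ∫ y in (0 : ℝ)..(2 * π), g y)| ≤ ε * n + D := by
  have : Fact (0 < 2 * π) := ⟨two_pi_pos⟩
  have hpi := two_pi_pos
  let G : C(AddCircle (2 * π), ℂ) :=
    ⟨fun y => (hp.lift y : ℂ), Complex.continuous_ofReal.comp (hg.quotient_lift _)⟩
  have hG : ∀ x : ℝ, G (x : AddCircle (2 * π)) = (g x : ℂ) := fun x => rfl
  have hmem : G ∈ (Submodule.span ℂ (Set.range (@fourier (2 * π)))).topologicalClosure := by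
    rw [span_fourier_closure_eq_top]; trivial
  obtain ⟨p, hps, hpG⟩ := Metric.mem_closure_iff.1 hmem (ε / 2) (half_pos hε)
  obtain ⟨m, D, h⟩ := exists_birkhoff_sum_bound hα hps
  have h1 : ∀ (n : ℕ) (x : ℝ),
      |∑ t ∈ Finset.range n, g (x + t * (2 * π * α)) - n * m.re| ≤ ε / 2 * n + D := by
    intro n x
    have e : ∑ t ∈ Finset.range n, g (x + t * (2 * π * α)) - n * m.re =
        (∑ t ∈ Finset.range n, G ((x : AddCircle (2 * π)) +
          (t • (2 * π * α : ℝ) : AddCircle (2 * π))) - n * m).re := by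
      simp only [Complex.sub_re, Complex.re_sum, Complex.mul_re, Complex.natCast_re,
        Complex.natCast_im, zero_mul, sub_zero]
      congr 1
      refine Finset.sum_congr rfl fun t _ => ?_
      rw [← AddCircle.coe_nsmul, ← AddCircle.coe_add, hG, Complex.ofReal_re, nsmul_eq_mul]
    rw [e]
    refine (Complex.abs_re_le_norm _).trans ?_
    set y : ℕ → AddCircle (2 * π) := fun t =>
      (x : AddCircle (2 * π)) + (t • (2 * π * α : ℝ) : AddCircle (2 * π))
    calc _ = ‖∑ t ∈ Finset.range n, (G (y t) - p (y t)) +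
            (∑ t ∈ Finset.range n, p (y t) - n * m)‖ := by
          rw [Finset.sum_sub_distrib]; congr 1; ring
      _ ≤ ∑ t ∈ Finset.range n, ‖G (y t) - p (y t)‖ + D :=
          (norm_add_le _ _).trans (add_le_add (norm_sum_le _ _) (h n _))
      _ ≤ ∑ t ∈ Finset.range n, ε / 2 + D := by
          gcongr with t _
          exact ((G - p).norm_coe_le_norm (y t)).trans (by rw [← dist_eq_norm]; exact hpG.le)
      _ = _ := by rw [Finset.sum_const, Finset.card_range, nsmul_eq_mul]; ring
  set I := (2 * π)⁻¹ * ∫ y in (0 : ℝ)..(2 * π), g y with hI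
  have hInt : ∀ n : ℕ, |(n : ℝ) * I - n * m.re| ≤ ε / 2 * n + D := by
    intro n
    have hc : ∀ t : ℕ, Continuous fun x => g (x + t * (2 * π * α)) := fun t =>
      hg.comp (continuous_id.add continuous_const)
    have hcs : Continuous fun x => ∑ t ∈ Finset.range n, g (x + t * (2 * π * α)) :=
      continuous_finsetSum _ fun t _ => hc t
    have hsum : ∫ x in (0 : ℝ)..(2 * π), (∑ t ∈ Finset.range n, g (x + t * (2 * π * α)) -
        n * m.re) = 2 * π * (n * I - n * m.re) := by
      rw [intervalIntegral.integral_sub (hcs.intervalIntegrable _ _) (by simp),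
        intervalIntegral.integral_finsetSum fun t _ => (hc t).intervalIntegrable _ _]
      have : ∀ t ∈ Finset.range n, ∫ x in (0 : ℝ)..(2 * π), g (x + t * (2 * π * α)) =
          2 * π * I := fun t _ => by
        rw [intervalIntegral.integral_comp_add_right g, zero_add, add_comm,
          hp.intervalIntegral_add_eq _ 0, zero_add, hI]
        field_simp
      rw [Finset.sum_congr rfl this, Finset.sum_const, Finset.card_range, nsmul_eq_mul,
        intervalIntegral.integral_const, smul_eq_mul]
      ring
    have := intervalIntegral.norm_integral_le_of_norm_le_const (a := 0) (b := 2 * π)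
      (f := fun x => ∑ t ∈ Finset.range n, g (x + t * (2 * π * α)) - n * m.re)
      (C := ε / 2 * n + D) fun x _ => h1 n x
    rw [hsum, Real.norm_eq_abs, abs_mul, abs_of_pos hpi, sub_zero, abs_of_pos hpi, mul_comm] at this
    exact le_of_mul_le_mul_right this hpi
  refine ⟨2 * D, fun n x => ?_⟩
  have e1 := abs_le.1 (h1 n x)
  have e2 := abs_le.1 (hInt n)
  exact abs_le.2 ⟨by linarith, by linarith⟩

/-! ### The operator norm of a two by two matrix -/

section MNorm

variable (A B : Matrix (Fin 2) (Fin 2) ℝ)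

theorem mnorm_mul_le : mnorm (A * B) ≤ mnorm A * mnorm B := by
  rw [mnorm, map_mul]
  exact norm_mul_le _ _

theorem norm_mulVec_le (u : Fin 2 → ℝ) :
    ‖WithLp.toLp 2 (A.mulVec u)‖ ≤ mnorm A * ‖WithLp.toLp 2 u‖ := by
  have := (Matrix.toEuclideanCLM (𝕜 := ℝ) A).le_opNorm (WithLp.toLp 2 u)
  rwa [Matrix.toEuclideanCLM_toLp] at this

theorem norm_toLp_sq (u : Fin 2 → ℝ) : ‖WithLp.toLp 2 u‖ ^ 2 = u 0 ^ 2 + u 1 ^ 2 := by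
  rw [EuclideanSpace.norm_sq_eq]; simp

theorem mnorm_nonneg : 0 ≤ mnorm A := norm_nonneg _

theorem mnorm_le_sum : mnorm A ≤ |A 0 0| + |A 0 1| + |A 1 0| + |A 1 1| := by
  refine ContinuousLinearMap.opNorm_le_bound _ (by positivity) fun u => ?_
  have hu : ‖u‖ ^ 2 = u 0 ^ 2 + u 1 ^ 2 := by rw [EuclideanSpace.norm_sq_eq]; simp
  have h0 : |u 0| ≤ ‖u‖ := abs_le_of_sq_le_sq (by nlinarith [sq_nonneg (u 1)]) (norm_nonneg u)
  have h1 : |u 1| ≤ ‖u‖ := abs_le_of_sq_le_sq (by nlinarith [sq_nonneg (u 0)]) (norm_nonneg u)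
  have e : Matrix.toEuclideanCLM (𝕜 := ℝ) A u = WithLp.toLp 2 (A.mulVec u) := rfl
  have hb : ∀ i, |A.mulVec u i| ≤ (|A i 0| + |A i 1|) * ‖u‖ := fun i => by
    simp only [Matrix.mulVec, dotProduct, Fin.sum_univ_two]
    calc _ ≤ |A i 0 * u 0| + |A i 1 * u 1| := abs_add_le _ _
      _ ≤ |A i 0| * ‖u‖ + |A i 1| * ‖u‖ := by rw [abs_mul, abs_mul]; gcongr
      _ = _ := by ring
  have hs : ‖WithLp.toLp 2 (A.mulVec u)‖ ≤ |A.mulVec u 0| + |A.mulVec u 1| := by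
    refine le_of_sq_le_sq ?_ (by positivity)
    rw [norm_toLp_sq, ← sq_abs, ← sq_abs (A.mulVec u 1)]
    nlinarith [abs_nonneg (A.mulVec u 0), abs_nonneg (A.mulVec u 1)]
  rw [e]
  linarith [hb 0, hb 1]

variable {A} in
theorem one_le_mnorm (hA : A.det = 1) : 1 ≤ mnorm A := by
  have h : ∀ u : Fin 2 → ℝ, u 0 ^ 2 + u 1 ^ 2 = 1 →
      (A.mulVec u 0) ^ 2 + (A.mulVec u 1) ^ 2 ≤ mnorm A ^ 2 := fun u hu => by
    have h1 := norm_mulVec_le A u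
    have h2 := norm_toLp_sq u
    rw [hu, pow_eq_one_iff_of_nonneg (norm_nonneg _) two_ne_zero] at h2
    rw [h2, mul_one] at h1
    rw [← norm_toLp_sq]
    gcongr
  have h0 := h ![1, 0] (by simp)
  have h1 := h ![0, 1] (by simp)
  simp [Matrix.mulVec, dotProduct, Fin.sum_univ_two] at h0 h1
  rw [Matrix.det_fin_two] at hA
  have : (1 : ℝ) ^ 2 ≤ mnorm A ^ 2 := by
    nlinarith [sq_nonneg (A 0 0 - A 1 1), sq_nonneg (A 0 1 + A 1 0)]
  exact le_of_sq_le_sq this (mnorm_nonneg A)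

theorem continuous_mnorm : Continuous mnorm :=
  continuous_norm.comp (LinearMap.continuous_of_finiteDimensional
    (Matrix.toEuclideanCLM (𝕜 := ℝ) (n := Fin 2)).toAlgEquiv.toLinearMap)

end MNorm

/-! ### Lyapunov exponents of Schrödinger cocycles -/

section Lyapunov

variable {α : ℝ} {w : ℝ → ℝ}

theorem schrodingerMap_neg (w : ℝ → ℝ) (x : ℝ) :
    schrodingerMap 0 (fun y => -w y) x = !![w x, -1; 1, 0] := by
  simp [schrodingerMap]

theorem det_cocycleIter (w : ℝ → ℝ) (n : ℕ) (x : ℝ) :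
    (cocycleIter α (schrodingerMap 0 fun y => -w y) n x).det = 1 := by
  induction n with
  | zero => simp [cocycleIter]
  | succ n ih => rw [cocycleIter, Matrix.det_mul, ih, schrodingerMap_neg]; simp

theorem continuous_cocycleIter (hw : Continuous w) (n : ℕ) :
    Continuous (cocycleIter α (schrodingerMap 0 fun y => -w y) n) := by
  induction n with
  | zero => exact continuous_const
  | succ n ih =>
    simp only [cocycleIter, schrodingerMap_neg]
    refine Continuous.matrix_mul ?_ ih
    refine continuous_matrix fun i j => ?_
    fin_cases i <;> fin_cases j <;> simp <;> fun_prop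

theorem tendsto_cocycleIter {W : ℕ → ℝ → ℝ}
    (h : ∀ x, Tendsto (fun j => W j x) atTop (nhds (w x))) (n : ℕ) (x : ℝ) :
    Tendsto (fun j => cocycleIter α (schrodingerMap 0 fun y => -W j y) n x) atTop
      (nhds (cocycleIter α (schrodingerMap 0 fun y => -w y) n x)) := by
  induction n with
  | zero => exact tendsto_const_nhds
  | succ n ih =>
    simp only [cocycleIter, schrodingerMap_neg]
    refine ((continuous_fst.matrix_mul continuous_snd).tendsto (_, _)).comp
      (Tendsto.prodMk_nhds ?_ ih)
    refine tendsto_pi_nhds.2 fun i => tendsto_pi_nhds.2 fun j => ?_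
    fin_cases i <;> fin_cases j <;> simp [h]

theorem mnorm_cocycleIter_le {B : ℝ} (hB : ∀ x, |w x| ≤ B) (n : ℕ) (x : ℝ) :
    mnorm (cocycleIter α (schrodingerMap 0 fun y => -w y) n x) ≤ 4 * (B + 2) ^ n := by
  have hB0 : 0 ≤ B := (abs_nonneg _).trans (hB 0)
  induction n with
  | zero => 
    refine (mnorm_le_sum _).trans ?_
    simp [cocycleIter]; norm_num
  | succ n ih =>
    rw [cocycleIter, schrodingerMap_neg]
    refine (mnorm_mul_le _ _).trans ?_
    rw [pow_succ, ← mul_assoc, mul_comm]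
    refine mul_le_mul ih ?_ (mnorm_nonneg _) (by positivity)
    refine (mnorm_le_sum _).trans ?_
    simp
    linarith [hB (x + 2 * π * n * α)]

theorem continuous_log_mnorm_cocycleIter (hw : Continuous w) (n : ℕ) :
    Continuous fun x => log (mnorm (cocycleIter α (schrodingerMap 0 fun y => -w y) n x)) :=
  (continuous_mnorm.comp (continuous_cocycleIter hw n)).log fun x =>
    (zero_lt_one.trans_le (one_le_mnorm (det_cocycleIter w n x))).ne'

theorem tendsto_integral_log_mnorm {W : ℕ → ℝ → ℝ} (hW : ∀ j, Continuous (W j)) {B : ℝ}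
    (hB : ∀ j x, |W j x| ≤ B) (h : ∀ x, Tendsto (fun j => W j x) atTop (nhds (w x))) (n : ℕ) :
    Tendsto (fun j => ∫ x in (0 : ℝ)..(2 * π),
        log (mnorm (cocycleIter α (schrodingerMap 0 fun y => -W j y) n x))) atTop
      (nhds (∫ x in (0 : ℝ)..(2 * π),
        log (mnorm (cocycleIter α (schrodingerMap 0 fun y => -w y) n x)))) := by
  refine intervalIntegral.tendsto_integral_filter_of_dominated_convergence
    (fun _ => log (4 * (B + 2) ^ n)) ?_ ?_ (by simp) ?_
  · exact Eventually.of_forall fun j =>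
      (continuous_log_mnorm_cocycleIter (hW j) n).aestronglyMeasurable
  · refine Eventually.of_forall fun j => Eventually.of_forall fun x _ => ?_
    have h1 := one_le_mnorm (det_cocycleIter (α := α) (W j) n x)
    rw [Real.norm_of_nonneg (log_nonneg h1)]
    exact log_le_log (by linarith) (mnorm_cocycleIter_le (hB j) n x)
  · refine Eventually.of_forall fun x _ => ?_
    refine Tendsto.log ?_ (zero_lt_one.trans_le (one_le_mnorm (det_cocycleIter w n x))).ne'
    exact (continuous_mnorm.tendsto _).comp (tendsto_cocycleIter h n x)

variable {a : ℝ → ℝ}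

theorem cocycleIter_mulVec (ha : PosPer a) (n : ℕ) (x : ℝ) :
    (cocycleIter α (schrodingerMap 0 fun y => -pot (2 * π * α) a y) n x).mulVec ![a x, 1] =
      pr (2 * π * α) a n x • ![a (x + n * (2 * π * α)), 1] := by
  induction n with
  | zero => simp [cocycleIter, pr_zero]
  | succ n ih =>
    have e : pot (2 * π * α) a (x + n * (2 * π * α)) =
        a (x + ((n + 1 : ℕ) : ℝ) * (2 * π * α)) + (a (x + n * (2 * π * α)))⁻¹ := by
      rw [pot]; congr 2; push_cast; ring
    have h := (ha.pos (x + n * (2 * π * α))).ne'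
    rw [cocycleIter, ← Matrix.mulVec_mulVec, ih, pr_succ, schrodingerMap_neg,
      show x + 2 * π * n * α = x + n * (2 * π * α) by ring, e]
    generalize a (x + ((n + 1 : ℕ) : ℝ) * (2 * π * α)) = u
    generalize a (x + n * (2 * π * α)) = v at h ⊢
    funext i
    fin_cases i
    · simp [Matrix.mulVec, dotProduct, Fin.sum_univ_two]
      field_simp
      ring
    · simp [Matrix.mulVec, dotProduct, Fin.sum_univ_two]

theorem cocycleIter_mulVec_one_zero (ha : PosPer a) (n : ℕ) (x : ℝ) :
    (cocycleIter α (schrodingerMap 0 fun y => -pot (2 * π * α) a y) n x).mulVec ![1, 0] =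
      (pr (2 * π * α) a n x * sg (2 * π * α) a n x) • ![a (x + n * (2 * π * α)), 1] +
        (pr (2 * π * α) a n x)⁻¹ • ![1, 0] := by
  induction n with
  | zero => simp [cocycleIter, pr_zero, sg_zero]
  | succ n ih =>
    have e : pot (2 * π * α) a (x + n * (2 * π * α)) =
        a (x + ((n + 1 : ℕ) : ℝ) * (2 * π * α)) + (a (x + n * (2 * π * α)))⁻¹ := by
      rw [pot]; congr 2; push_cast; ring
    have h := (ha.pos (x + n * (2 * π * α))).ne'
    have hp := ((ha.pr (ω := 2 * π * α) n).pos x).ne'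
    rw [cocycleIter, ← Matrix.mulVec_mulVec, ih, sg_succ, pr_succ, schrodingerMap_neg,
      show x + 2 * π * n * α = x + n * (2 * π * α) by ring, e]
    generalize a (x + ((n + 1 : ℕ) : ℝ) * (2 * π * α)) = u
    generalize a (x + n * (2 * π * α)) = v at h ⊢
    generalize pr (2 * π * α) a n x = p at hp ⊢
    funext i
    fin_cases i
    · simp [Matrix.mulVec, dotProduct, Fin.sum_univ_two]
      field_simp
      ring
    · simp [Matrix.mulVec, dotProduct, Fin.sum_univ_two]
      field_simp

end Lyapunov

section LyapunovPosPer

variable {α : ℝ} {a : ℝ → ℝ}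

/-- The mean of the logarithm of `a` over the circle. -/
def meanLog (a : ℝ → ℝ) : ℝ := (2 * π)⁻¹ * ∫ x in (0 : ℝ)..(2 * π), log (a x)

theorem PosPer.continuous_log (ha : PosPer a) : Continuous fun x => log (a x) :=
  ha.contDiff.continuous.log fun x => (ha.pos x).ne'

theorem log_pr (ha : PosPer a) (ω : ℝ) (n : ℕ) (x : ℝ) :
    log (pr ω a n x) = ∑ t ∈ Finset.range n, log (a (x + t * ω)) :=
  log_prod fun _ _ => (ha.pos _).ne'

theorem intervalIntegral_shift {f : ℝ → ℝ} (hf : Function.Periodic f (2 * π)) (c : ℝ) :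
    ∫ x in (0 : ℝ)..(2 * π), f (x + c) = ∫ x in (0 : ℝ)..(2 * π), f x := by
  rw [intervalIntegral.integral_comp_add_right f, zero_add, add_comm,
    hf.intervalIntegral_add_eq _ 0, zero_add]

theorem mul_meanLog_le (ha : PosPer a) (n : ℕ) :
    n * meanLog a ≤ (2 * π)⁻¹ * ∫ x in (0 : ℝ)..(2 * π),
      log (mnorm (cocycleIter α (schrodingerMap 0 fun y => -pot (2 * π * α) a y) n x)) := by
  have hpi := two_pi_pos
  set h : ℝ → ℝ := fun x => log (a x ^ 2 + 1) / 2 with hh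
  have hhc : Continuous h :=
    (((ha.contDiff.continuous.pow 2).add continuous_const).log fun x =>
      (show (0 : ℝ) < a x ^ 2 + 1 by positivity).ne').div_const 2
  have hhp : Function.Periodic h (2 * π) := fun x => by simp only [hh, ha.periodic x]
  have hlp : Function.Periodic (fun x => log (a x)) (2 * π) := fun x => by
    simp only [ha.periodic x]
  have hpt : ∀ x, ∑ t ∈ Finset.range n, log (a (x + t * (2 * π * α))) +
      (h (x + n * (2 * π * α)) - h x) ≤
      log (mnorm (cocycleIter α (schrodingerMap 0 fun y => -pot (2 * π * α) a y) n x)) := by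
    intro x
    have h1 := norm_mulVec_le
      (cocycleIter α (schrodingerMap 0 fun y => -pot (2 * π * α) a y) n x) ![a x, 1]
    rw [cocycleIter_mulVec ha] at h1
    have h2 := pow_le_pow_left₀ (norm_nonneg _) h1 2
    have hm := zero_lt_one.trans_le
      (one_le_mnorm (det_cocycleIter (α := α) (pot (2 * π * α) a) n x))
    have hp := (ha.pr (ω := 2 * π * α) n).pos x
    rw [mul_pow, norm_toLp_sq, norm_toLp_sq] at h2
    simp only [Pi.smul_apply, Matrix.cons_val_zero, Matrix.cons_val_one, smul_eq_mul, mul_one,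
      one_pow] at h2
    rw [show ∀ p u : ℝ, (p * u) ^ 2 + p ^ 2 = p ^ 2 * (u ^ 2 + 1) from fun p u => by ring] at h2
    have h3 := log_le_log (by positivity) h2
    rw [log_mul (by positivity) (by positivity), log_mul (by positivity) (by positivity), log_pow,
      log_pow, log_pr ha] at h3
    push_cast at h3
    simp only [hh]
    linarith
  have hc : ∀ t : ℕ, Continuous fun x => log (a (x + t * (2 * π * α))) := fun t =>
    ha.continuous_log.comp (continuous_id.add continuous_const)
  have hcs : Continuous fun x => ∑ t ∈ Finset.range n, log (a (x + t * (2 * π * α))) :=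
    continuous_finsetSum _ fun t _ => hc t
  have hhs : Continuous fun x => h (x + n * (2 * π * α)) :=
    hhc.comp (continuous_id.add continuous_const)
  have hhd : Continuous fun x => h (x + n * (2 * π * α)) - h x := hhs.sub hhc
  have hs : ∀ t : ℕ, ∫ x in (0 : ℝ)..(2 * π), log (a (x + t * (2 * π * α))) =
      ∫ x in (0 : ℝ)..(2 * π), log (a x) := fun t => intervalIntegral_shift hlp _
  have hInt : ∫ x in (0 : ℝ)..(2 * π), (∑ t ∈ Finset.range n, log (a (x + t * (2 * π * α))) +
      (h (x + n * (2 * π * α)) - h x)) = n * ∫ x in (0 : ℝ)..(2 * π), log (a x) := by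
    rw [intervalIntegral.integral_add (hcs.intervalIntegrable _ _)
      (hhd.intervalIntegrable _ _), intervalIntegral.integral_sub
      (hhs.intervalIntegrable _ _) (hhc.intervalIntegrable _ _), intervalIntegral_shift hhp,
      sub_self, add_zero, intervalIntegral.integral_finsetSum fun t _ =>
      (hc t).intervalIntegrable _ _, Finset.sum_congr rfl fun t _ =>
      hs t, Finset.sum_const, Finset.card_range, nsmul_eq_mul]
  have := intervalIntegral.integral_mono (μ := volume) hpi.le ((hcs.add hhd).intervalIntegrable 0 _)
    ((continuous_log_mnorm_cocycleIter ha.pot_contDiff.continuous n).intervalIntegrable _ _) hpt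
  simp only [Pi.add_apply] at this
  rw [hInt] at this
  rw [meanLog, mul_left_comm]
  gcongr

theorem exists_mnorm_cocycleIter_le (hα : Irrational α) (ha : PosPer a) (hl : 0 ≤ meanLog a)
    {ε : ℝ} (hε : 0 < ε) : ∃ D : ℝ, 0 < D ∧ ∀ (n : ℕ) (x : ℝ),
      mnorm (cocycleIter α (schrodingerMap 0 fun y => -pot (2 * π * α) a y) n x) ≤
        D * (n + 1) * exp ((meanLog a + 3 * ε) * n) := by
  have hlp : Function.Periodic (fun x => log (a x)) (2 * π) := fun x => by
    simp only [ha.periodic x]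
  obtain ⟨D, hD⟩ := exists_birkhoff_sum_le hα ha.continuous_log hlp hε
  obtain ⟨B, hB⟩ : ∃ B : ℝ, ∀ x, a x ≤ B := by
    obtain ⟨B, hB⟩ := (isCompact_Icc (a := (0 : ℝ)) (b := 2 * π)).bddAbove_image
      ha.contDiff.continuous.continuousOn
    refine ⟨B, fun x => ?_⟩
    obtain ⟨y, hy, hxy⟩ := ha.periodic.exists_mem_Ico₀ two_pi_pos x
    rw [hxy]
    exact hB ⟨y, ⟨hy.1, hy.2.le⟩, rfl⟩
  have hB0 : 0 < B := (ha.pos 0).trans_le (hB 0)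
  have hD0 : 0 ≤ D := by simpa using (abs_nonneg _).trans (hD 0 0)
  set l := meanLog a with hldef
  have hu : ∀ n x, pr (2 * π * α) a n x ≤ exp (l * n + ε * n + D) := fun n x => by
    rw [← log_le_iff_le_exp ((ha.pr n).pos x), log_pr ha]
    have := (abs_le.1 (hD n x)).2
    rw [← meanLog, ← hldef] at this
    linarith
  have hi : ∀ n x, (pr (2 * π * α) a n x)⁻¹ ≤ exp (ε * n + D) := fun n x => by
    rw [← log_le_iff_le_exp (inv_pos.2 ((ha.pr n).pos x)), log_inv, log_pr ha]
    have := (abs_le.1 (hD n x)).1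
    rw [← meanLog, ← hldef] at this
    have : 0 ≤ n * l := by positivity
    linarith
  have hs : ∀ n x, pr (2 * π * α) a n x * sg (2 * π * α) a n x ≤
      n * exp ((l + 3 * ε) * n + 3 * D) := fun n x => by
    rw [sg, Finset.mul_sum]
    calc _ ≤ ∑ i ∈ Finset.range n, exp ((l + 3 * ε) * n + 3 * D) := by
          refine Finset.sum_le_sum fun i hin => ?_
          have hin := Finset.mem_range.1 hin
          have hin1 : (i : ℝ) ≤ n := by exact_mod_cast hin.le
          have hin2 : ((i + 1 : ℕ) : ℝ) ≤ n := by exact_mod_cast hin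
          rw [mul_inv]
          calc _ ≤ exp (l * n + ε * n + D) * (exp (ε * i + D) * exp (ε * (i + 1 : ℕ) + D)) := by
                have := ((ha.pr (ω := 2 * π * α) i).pos x).le
                have := ((ha.pr (ω := 2 * π * α) (i + 1)).pos x).le
                gcongr
                exacts [hu n x, hi i x, hi (i + 1) x]
            _ = exp (l * n + ε * n + D + (ε * i + D + (ε * (i + 1 : ℕ) + D))) := by
                rw [exp_add (l * n + ε * n + D), exp_add (ε * i + D)]
            _ ≤ _ := by
                refine exp_le_exp.2 ?_
                nlinarith [mul_le_mul_of_nonneg_left hin1 hε.le,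
                  mul_le_mul_of_nonneg_left hin2 hε.le]
      _ = _ := by rw [Finset.sum_const, Finset.card_range, nsmul_eq_mul]
  refine ⟨4 * (B + 1) ^ 2 * exp (3 * D), by positivity, fun n x => ?_⟩
  set A := cocycleIter α (schrodingerMap 0 fun y => -pot (2 * π * α) a y) n x with hA
  have h1 := cocycleIter_mulVec (α := α) ha n x
  have h2 := cocycleIter_mulVec_one_zero (α := α) ha n x
  rw [← hA] at h1 h2
  have e00 := congrFun h2 0
  have e10 := congrFun h2 1
  have e01 := congrFun h1 0
  have e11 := congrFun h1 1
  simp [Matrix.mulVec, dotProduct, Fin.sum_univ_two] at e00 e10 e01 e11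
  have hp := (ha.pr (ω := 2 * π * α) n).pos x
  have hsg := mul_nonneg hp.le (ha.sg_nonneg (ω := 2 * π * α) n x)
  have hpu := hu n x
  have hpi := hi n x
  have hps := hs n x
  set P := pr (2 * π * α) a n x
  set Q := P * sg (2 * π * α) a n x
  set b := a (x + n * (2 * π * α))
  have hb : 0 < b := ha.pos _
  have hbB : b ≤ B := hB _
  have hx := ha.pos x
  have hxB := hB x
  have hPi : 0 < P⁻¹ := inv_pos.2 hp
  set X := exp ((l + 3 * ε) * n + 3 * D) with hX
  have hX0 : 0 < X := exp_pos _
  have hPX : P ≤ X := hpu.trans (exp_le_exp.2 (by nlinarith [mul_nonneg hε.le n.cast_nonneg]))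
  have hPX' : P⁻¹ ≤ X := hpi.trans (exp_le_exp.2
    (by nlinarith [mul_nonneg hε.le n.cast_nonneg, mul_nonneg hl n.cast_nonneg]))
  have hn0 : (0 : ℝ) ≤ n := n.cast_nonneg
  have f00 : |A 0 0| ≤ (n + 1) * (B + 1) * X := by
    rw [e00, abs_of_nonneg (by positivity)]
    calc Q * b + P⁻¹ ≤ n * X * B + X := by gcongr
      _ ≤ (n + 1) * (B + 1) * X := by nlinarith [mul_pos hB0 hX0, mul_nonneg hn0 hX0.le]
  have f10 : |A 1 0| ≤ (n + 1) * (B + 1) * X := by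
    rw [e10, abs_of_nonneg hsg]
    refine hps.trans ?_
    nlinarith [mul_pos hB0 hX0, mul_nonneg hn0 hX0.le, mul_nonneg hn0 (mul_pos hB0 hX0).le]
  have f01 : |A 0 1| ≤ (n + 1) * (B + 1) ^ 2 * X := by
    have : A 0 1 = P * b - A 0 0 * a x := by linear_combination e01
    rw [this]
    calc |P * b - A 0 0 * a x| ≤ |P * b| + |A 0 0 * a x| := abs_sub _ _
      _ ≤ X * B + (n + 1) * (B + 1) * X * B := by
          rw [abs_mul, abs_mul, abs_of_pos hp, abs_of_pos hb, abs_of_pos hx]; gcongr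
      _ ≤ (n + 1) * (B + 1) ^ 2 * X := by
          nlinarith [mul_pos hB0 hX0, mul_nonneg hn0 hX0.le, mul_nonneg hn0 (mul_pos hB0 hX0).le]
  have f11 : |A 1 1| ≤ (n + 1) * (B + 1) ^ 2 * X := by
    have : A 1 1 = P - A 1 0 * a x := by linear_combination e11
    rw [this]
    calc |P - A 1 0 * a x| ≤ |P| + |A 1 0 * a x| := abs_sub _ _
      _ ≤ X + (n + 1) * (B + 1) * X * B := by
          rw [abs_mul, abs_of_pos hp, abs_of_pos hx]; gcongr
      _ ≤ (n + 1) * (B + 1) ^ 2 * X := by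
          nlinarith [mul_pos hB0 hX0, mul_nonneg hn0 hX0.le, mul_nonneg hn0 (mul_pos hB0 hX0).le]
  have hBB : (n + 1) * (B + 1) * X ≤ (n + 1) * (B + 1) ^ 2 * X := by
    gcongr
    nlinarith
  calc mnorm A ≤ _ := mnorm_le_sum A
    _ ≤ 4 * ((n + 1) * (B + 1) ^ 2 * X) := by linarith
    _ = _ := by rw [hX, exp_add]; ring

theorem lyapunovExp_le_meanLog (hα : Irrational α) (ha : PosPer a) (hl : 0 ≤ meanLog a) :
    lyapunovExp α (schrodingerMap 0 fun y => -pot (2 * π * α) a y) ≤ meanLog a := by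
  have hpi := two_pi_pos
  have hbdd : BddBelow (Set.range fun n : ℕ => (1 / ((n : ℝ) + 1)) *
      ((2 * π)⁻¹ * ∫ x in (0 : ℝ)..(2 * π),
        log (mnorm (cocycleIter α
          (schrodingerMap 0 fun y => -pot (2 * π * α) a y) (n + 1) x)))) := by
    refine ⟨meanLog a, ?_⟩
    rintro _ ⟨n, rfl⟩
    have := mul_meanLog_le (α := α) ha (n + 1)
    push_cast at this
    dsimp only
    rw [one_div, le_inv_mul_iff₀ (by positivity)]
    exact this
  refine le_of_forall_pos_le_add fun δ hδ => ?_
  obtain ⟨D, hD0, hD⟩ := exists_mnorm_cocycleIter_le hα ha hl (ε := δ / 3) (by positivity)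
  rw [mul_div_cancel₀ _ (three_ne_zero' ℝ)] at hD
  have hlim : Tendsto (fun n : ℕ => (log D + log ((n : ℝ) + 2)) / ((n : ℝ) + 1) + (meanLog a + δ))
      atTop (nhds (0 + (meanLog a + δ))) := by
    refine Tendsto.add_const _ ?_
    have t0 : Tendsto (fun n : ℕ => (n : ℝ) + 2) atTop atTop :=
      tendsto_atTop_add_const_right _ _ tendsto_natCast_atTop_atTop
    have t1 := ((tendsto_pow_log_div_mul_add_atTop 1 (-1) 0 one_ne_zero).const_mul (log D)).comp t0
    have t2 := (tendsto_pow_log_div_mul_add_atTop 1 (-1) 1 one_ne_zero).comp t0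
    have t3 := t1.add t2
    rw [mul_zero, add_zero] at t3
    refine t3.congr fun n => ?_
    simp only [Function.comp, pow_zero, pow_one]
    rw [show 1 * ((n : ℝ) + 2) + -1 = n + 1 by ring]
    ring
  rw [zero_add] at hlim
  refine ge_of_tendsto' hlim fun n => (ciInf_le hbdd n).trans ?_
  have hn : (0 : ℝ) < (n : ℝ) + 1 := by positivity
  rw [one_div, inv_mul_le_iff₀ hn, inv_mul_le_iff₀ hpi]
  have := intervalIntegral.integral_mono (μ := volume) hpi.le
    ((continuous_log_mnorm_cocycleIter (α := α) (ha.pot_contDiff (ω := 2 * π * α)).continuous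
      (n + 1)).intervalIntegrable 0 (2 * π)) (intervalIntegrable_const
      (c := log D + log ((n : ℝ) + 2) + (meanLog a + δ) * ((n : ℝ) + 1))) fun x => by
    have h1 := log_le_log (zero_lt_one.trans_le
      (one_le_mnorm (det_cocycleIter (α := α) (pot (2 * π * α) a) (n + 1) x))) (hD (n + 1) x)
    rw [log_mul (by positivity) (by positivity), log_exp, log_mul (by positivity) (by positivity)]
      at h1
    push_cast at h1
    rwa [show (n : ℝ) + 1 + 1 = n + 2 by ring] at h1
  refine this.trans (le_of_eq ?_)
  rw [intervalIntegral.integral_const, smul_eq_mul, sub_zero]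
  field_simp

theorem le_lyapunovExp {w : ℝ → ℝ} {W : ℕ → ℝ → ℝ} {b : ℕ → ℝ → ℝ} (hb : ∀ j, PosPer (b j))
    (hW : ∀ j x, W j x = pot (2 * π * α) (b j) x) {B l : ℝ} (hB : ∀ j x, |W j x| ≤ B)
    (h : ∀ x, Tendsto (fun j => W j x) atTop (nhds (w x))) (hl : ∀ j, l ≤ meanLog (b j)) :
    l ≤ lyapunovExp α (schrodingerMap 0 fun y => -w y) := by
  have hWe : ∀ j, W j = pot (2 * π * α) (b j) := fun j => funext (hW j)
  refine le_ciInf fun n => ?_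
  have hlim := (tendsto_integral_log_mnorm (α := α)
    (fun j => by rw [hWe]; exact (hb j).pot_contDiff.continuous) hB h (n + 1)).const_mul (2 * π)⁻¹
  have hn : (0 : ℝ) < (n : ℝ) + 1 := by positivity
  rw [one_div, le_inv_mul_iff₀ hn]
  refine ge_of_tendsto' hlim fun j => ?_
  have := mul_meanLog_le (α := α) (hb j) (n + 1)
  push_cast at this
  simp only [hWe]
  exact (mul_le_mul_of_nonneg_left (hl j) hn.le).trans this

end LyapunovPosPer

/-! ### Choice of the return times -/

/-- Admissibility of `m` as the `j`-th return time, given the previous ones. -/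
def IsReturnTime (ω : ℝ) (r : ℕ → ℝ) (N : ℕ → ℕ) (j m : ℕ) : Prop :=
  2 ^ (j + 1) ≤ m ∧ m ≤ 2 ^ (j + 2) ∧
    ∀ i < j, ∀ k : ℕ, 1 ≤ k → k < N i → 2 * r i ≤ nd ((m - k : ℝ) * ω)

/-- The sequence whose first `j` terms are the first `j` return times. -/
def returnTimesUpTo (ω : ℝ) (r : ℕ → ℝ) : ℕ → ℕ → ℕ
  | 0 => fun _ => 0
  | j + 1 => Function.update (returnTimesUpTo ω r j) j
      (sInf {m | IsReturnTime ω r (returnTimesUpTo ω r j) j m})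

/-- The return times associated with the radii `r`. -/
def returnTime (ω : ℝ) (r : ℕ → ℝ) (j : ℕ) : ℕ := returnTimesUpTo ω r (j + 1) j

section ReturnTime

variable {ω c : ℝ} {r r' : ℕ → ℝ} {N N' : ℕ → ℕ} {j : ℕ}

theorem IsReturnTime.congr (hr : ∀ i < j, r i = r' i) (hN : ∀ i < j, N i = N' i) (m : ℕ) :
    IsReturnTime ω r N j m ↔ IsReturnTime ω r' N' j m := by
  unfold IsReturnTime
  refine and_congr_right fun _ => and_congr_right fun _ => forall₂_congr fun i hi => ?_
  rw [hr i hi, hN i hi]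

theorem returnTimesUpTo_congr (hr : ∀ i < j, r i = r' i) :
    returnTimesUpTo ω r j = returnTimesUpTo ω r' j := by
  induction j with
  | zero => rfl
  | succ j ih =>
    have h := fun i (hi : i < j) => hr i (hi.trans j.lt_succ_self)
    rw [returnTimesUpTo, returnTimesUpTo, ih h]
    simp only [IsReturnTime.congr h fun _ _ => rfl]

theorem returnTimesUpTo_eq {i : ℕ} (h : i < j) : returnTimesUpTo ω r j i = returnTime ω r i := by
  induction j with
  | zero => omega
  | succ j ih =>
    rcases Nat.lt_succ_iff_lt_or_eq.1 h with h | rfl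
    · rw [returnTimesUpTo, Function.update_of_ne h.ne, ih h]
    · rfl

theorem returnTime_congr (hr : ∀ i < j, r i = r' i) {i : ℕ} (hi : i < j) :
    returnTime ω r i = returnTime ω r' i := by
  rw [← returnTimesUpTo_eq hi, ← returnTimesUpTo_eq hi, returnTimesUpTo_congr hr]

theorem card_return_le (hc : ∀ k : ℕ, 1 ≤ k → c / k ≤ nd (k * ω)) (hc0 : 0 < c) {ρ : ℝ}
    (hρ : 0 < ρ) (m : ℕ) (hm : 1 ≤ m) :
    (((Finset.range m).filter fun t : ℕ => 1 ≤ t ∧ nd (t * ω) < ρ).card : ℝ) ≤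
      m * (2 * ρ / c) := by
  have h := card_visits_le hc hc0 hρ 0 m
  simp only [zero_add] at h
  have h0 : (0 : ℕ) ∈ (Finset.range m).filter fun t : ℕ => nd (t * ω) < ρ := by
    simp only [Finset.mem_filter, Finset.mem_range, Nat.cast_zero, zero_mul]
    exact ⟨by omega, by simpa [nd] using hρ⟩
  have e : ((Finset.range m).filter fun t : ℕ => 1 ≤ t ∧ nd (t * ω) < ρ) =
      ((Finset.range m).filter fun t : ℕ => nd (t * ω) < ρ).erase 0 := by
    ext t
    simp only [Finset.mem_filter, Finset.mem_erase, Nat.one_le_iff_ne_zero]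
    tauto
  rw [e, Finset.card_erase_of_mem h0, Nat.cast_sub (Finset.card_pos.2 ⟨0, h0⟩)]
  push_cast
  linarith

theorem exists_isReturnTime (hc : ∀ k : ℕ, 1 ≤ k → c / k ≤ nd (k * ω)) (hc0 : 0 < c)
    (hr : ∀ i, 0 < r i) (hs : ∑ i ∈ Finset.range j, 2 ^ (i + 1) * r i ≤ c / 32)
    (hN : ∀ i < j, N i ≤ 2 ^ (i + 2)) : ∃ m, IsReturnTime ω r N j m := by
  by_contra! hno
  set V : ℕ → Finset ℕ := fun i =>
    (Finset.range (2 ^ (j + 2))).filter fun t : ℕ => 1 ≤ t ∧ nd (t * ω) < 2 * r i with hV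
  have hsub : Finset.Ico (2 ^ (j + 1)) (2 ^ (j + 2)) ⊆
      (Finset.range j).biUnion fun i => (Finset.range (N i)).biUnion fun k =>
        (V i).image fun t => t + k := by
    intro m hm
    rw [Finset.mem_Ico] at hm
    have := hno m
    simp only [IsReturnTime, not_and, not_forall, not_le] at this
    obtain ⟨i, hi, k, hk1, hk, hlt⟩ := this hm.1 hm.2.le
    have hkm : k < m := by
      calc k < 2 ^ (i + 2) := hk.trans_le (hN i hi)
        _ ≤ 2 ^ (j + 1) := Nat.pow_le_pow_right (by norm_num) (by omega)
        _ ≤ m := hm.1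
    simp only [Finset.mem_biUnion, Finset.mem_range, Finset.mem_image, hV, Finset.mem_filter]
    refine ⟨i, hi, k, hk, m - k, ⟨by omega, by omega, ?_⟩, by omega⟩
    rwa [Nat.cast_sub hkm.le]
  have hVc : ∀ i, ((V i).card : ℝ) ≤ 2 ^ (j + 2) * (4 * r i / c) := fun i => by
    have := card_return_le hc hc0 (ρ := 2 * r i) (by linarith [hr i]) (2 ^ (j + 2))
      Nat.one_le_two_pow
    push_cast at this
    rwa [show 2 * (2 * r i) / c = 4 * r i / c by ring] at this
  have h1 : (2 : ℝ) ^ (j + 1) ≤ ∑ i ∈ Finset.range j, (N i : ℝ) * (V i).card := by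
    have h := (Finset.card_le_card hsub).trans (Finset.card_biUnion_le.trans
      (Finset.sum_le_sum fun i _ => Finset.card_biUnion_le.trans
        (Finset.sum_le_sum fun k _ => Finset.card_image_le)))
    rw [Nat.card_Ico, show 2 ^ (j + 2) - 2 ^ (j + 1) = 2 ^ (j + 1) by
      rw [pow_succ 2 (j + 1)]; omega] at h
    simp only [Finset.sum_const, Finset.card_range, smul_eq_mul] at h
    exact_mod_cast h
  have h2 : ∑ i ∈ Finset.range j, (N i : ℝ) * (V i).card ≤
      2 ^ (j + 1) * (16 / c) * ∑ i ∈ Finset.range j, 2 ^ (i + 1) * r i := by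
    rw [Finset.mul_sum]
    refine Finset.sum_le_sum fun i hi => ?_
    have hNi : (N i : ℝ) ≤ 2 ^ (i + 2) := by exact_mod_cast hN i (Finset.mem_range.1 hi)
    calc _ ≤ (2 : ℝ) ^ (i + 2) * (2 ^ (j + 2) * (4 * r i / c)) := by gcongr; exact hVc i
      _ = _ := by rw [pow_succ _ (i + 1), pow_succ _ (j + 1)]; ring
  have h3 : (2 : ℝ) ^ (j + 1) * (16 / c) * ∑ i ∈ Finset.range j, 2 ^ (i + 1) * r i ≤
      2 ^ (j + 1) * (16 / c) * (c / 32) := by gcongr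
  have h4 : (2 : ℝ) ^ (j + 1) * (16 / c) * (c / 32) = 2 ^ (j + 1) / 2 := by field_simp; norm_num
  have : (0 : ℝ) < 2 ^ (j + 1) := by positivity
  linarith

theorem isReturnTime_returnTime (hc : ∀ k : ℕ, 1 ≤ k → c / k ≤ nd (k * ω)) (hc0 : 0 < c)
    (hr : ∀ i, 0 < r i) (hs : ∀ j, ∑ i ∈ Finset.range j, 2 ^ (i + 1) * r i ≤ c / 32) (j : ℕ) :
    IsReturnTime ω r (returnTime ω r) j (returnTime ω r j) := by
  induction j using Nat.strong_induction_on with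
  | _ j ih =>
    have hN : ∀ i < j, returnTimesUpTo ω r j i = returnTime ω r i := fun i hi =>
      returnTimesUpTo_eq hi
    rw [← IsReturnTime.congr (fun _ _ => rfl) hN]
    have e : returnTime ω r j = sInf {m | IsReturnTime ω r (returnTimesUpTo ω r j) j m} := by
      rw [returnTime, returnTimesUpTo, Function.update_self]
    rw [e]
    exact Nat.sInf_mem (exists_isReturnTime hc hc0 hr (hs j) fun i hi => by
      rw [hN i hi]; exact (ih i hi).2.1)

theorem sched_returnTime (hc : ∀ k : ℕ, 1 ≤ k → c / k ≤ nd (k * ω)) (hc0 : 0 < c)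
    (hr : ∀ i, 0 < r i) (hr1 : r 0 ≤ 1) (hrs : ∀ j, r (j + 1) ≤ 3 / 4 * r j)
    (hs : ∀ j, ∑ i ∈ Finset.range j, 2 ^ (i + 1) * r i ≤ c / 32) :
    Sched ω c r (returnTime ω r) := by
  have hR := isReturnTime_returnTime hc hc0 hr hs
  refine ⟨hr, fun j => ?_, hrs, fun j => (hs j).trans (by linarith), fun j => (hR j).1,
    fun j => (hR j).2.1, fun i k hk1 hk => ?_, fun i j hij => (hR j).2.2 i hij⟩
  · exact (antitone_nat_of_succ_le (fun j => (hrs j).trans (by linarith [hr j]))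
      (Nat.zero_le j)).trans hr1
  · have hk2 : (k : ℝ) ≤ 2 ^ (i + 2) := by exact_mod_cast hk.trans (hR i).2.1
    have hk0 : (0 : ℝ) < k := by exact_mod_cast hk1
    have h1 : 2 ^ (i + 1) * r i ≤ c / 32 := (Finset.single_le_sum
      (f := fun i => 2 ^ (i + 1) * r i) (fun i _ => by have := hr i; positivity)
      (Finset.self_mem_range_succ i)).trans (hs (i + 1))
    refine le_trans ?_ (hc k hk1)
    rw [le_div_iff₀ hk0]
    calc 2 * r i * k ≤ 2 * r i * 2 ^ (i + 2) := by have := hr i; gcongr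
      _ = 4 * (2 ^ (i + 1) * r i) := by rw [pow_succ _ (i + 1)]; ring
      _ ≤ c := by linarith

theorem seqA_congr {χ : ℝ → ℝ → ℝ} (hr : ∀ i < j, r i = r' i) (hN : ∀ i < j, N i = N' i) :
    seqA ω χ r N j = seqA ω χ r' N' j := by
  induction j with
  | zero => rfl
  | succ j ih =>
    have h : Efn χ r j = Efn χ r' j := by
      funext x; rw [Efn, Efn, hr j j.lt_succ_self]
    rw [seqA, seqA, ih (fun i hi => hr i (hi.trans j.lt_succ_self))
      (fun i hi => hN i (hi.trans j.lt_succ_self)), h, hN j j.lt_succ_self]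

end ReturnTime

/-! ### The mean logarithm lost in one step -/

/-- The mean of `-log (1 - χ ρ / 2)` over the circle. -/
def meanDrop (χ : ℝ → ℝ → ℝ) (ρ : ℝ) : ℝ :=
  -((2 * π)⁻¹ * ∫ x in (0 : ℝ)..(2 * π), log (1 - χ ρ x / 2))

theorem meanDrop_eq (χ : ℝ → ℝ → ℝ) (ρ : ℝ) :
    meanDrop χ ρ = (2 * π)⁻¹ * ∫ x in (0 : ℝ)..(2 * π), -log (1 - χ ρ x / 2) := by
  rw [meanDrop, intervalIntegral.integral_neg, mul_neg]

namespace IsBumpFamily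

variable {s C ρ : ℝ} {χ : ℝ → ℝ → ℝ} (hχ : IsBumpFamily s C χ)
include hχ

theorem neg_log_mem_Icc (x : ℝ) : -log (1 - χ ρ x / 2) ∈ Set.Icc 0 (log 2) := by
  have h0 := hχ.nonneg ρ x
  have h1 := hχ.le_one ρ x
  have hp : 0 < 1 - χ ρ x / 2 := by linarith
  constructor
  · linarith [log_nonpos hp.le (by linarith : 1 - χ ρ x / 2 ≤ 1)]
  · rw [← log_inv]
    refine log_le_log (inv_pos.2 hp) ?_
    rw [inv_le_comm₀ hp (by norm_num)]
    linarith

theorem continuous_neg_log (h0 : 0 < ρ) (h1 : ρ ≤ 1) :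
    Continuous fun x => -log (1 - χ ρ x / 2) := by
  have hc : Continuous (χ ρ) := (hχ.contDiff h0 h1).continuous
  refine (Continuous.log (by fun_prop) fun x => ?_).neg
  have := hχ.le_one ρ x
  linarith

theorem le_meanDrop (h0 : 0 < ρ) (h1 : ρ ≤ 1) : 3 * log 2 / (8 * π) * ρ ≤ meanDrop χ ρ := by
  have hc := hχ.continuous_neg_log h0 h1
  have hpi := pi_gt_three
  rw [meanDrop_eq, ← intervalIntegral.integral_add_adjacent_intervals
    (hc.intervalIntegrable 0 (3 / 4 * ρ)) (hc.intervalIntegrable _ _)]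
  have hA : ∫ x in (0 : ℝ)..(3 / 4 * ρ), -log (1 - χ ρ x / 2) = 3 / 4 * ρ * log 2 := by
    rw [intervalIntegral.integral_congr (g := fun _ => log 2), intervalIntegral.integral_const]
    · simp
    · intro x hx
      rw [Set.uIcc_of_le (by positivity)] at hx
      have : χ ρ x = 1 := hχ.eq_one h0
        ((nd_le_abs x).trans (by rw [abs_of_nonneg hx.1]; exact hx.2))
      simp only [this]
      rw [← log_inv]
      norm_num
  have hB : 0 ≤ ∫ x in (3 / 4 * ρ)..(2 * π), -log (1 - χ ρ x / 2) :=
    intervalIntegral.integral_nonneg (by linarith) fun x _ => (hχ.neg_log_mem_Icc x).1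
  rw [hA]
  calc 3 * log 2 / (8 * π) * ρ = (2 * π)⁻¹ * (3 / 4 * ρ * log 2) := by field_simp; norm_num
    _ ≤ _ := by gcongr; linarith

theorem meanDrop_nonneg (ρ : ℝ) : 0 ≤ meanDrop χ ρ := by
  have := pi_pos
  rw [meanDrop_eq]
  exact mul_nonneg (by positivity) (intervalIntegral.integral_nonneg (by positivity)
    fun x _ => (hχ.neg_log_mem_Icc x).1)

theorem meanDrop_le (h0 : 0 < ρ) (h1 : ρ ≤ 1) : meanDrop χ ρ ≤ ρ := by
  have hc := hχ.continuous_neg_log h0 h1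
  have hpi := pi_gt_three
  have hI := fun a b : ℝ => hc.intervalIntegrable (μ := volume) a b
  have hbd : ∀ a b : ℝ, a ≤ b →
      ∫ x in a..b, -log (1 - χ ρ x / 2) ≤ (b - a) * log 2 := fun a b hab => by
    have := intervalIntegral.integral_mono_on (μ := volume) hab (hI a b)
      (intervalIntegrable_const (c := log 2)) fun x _ => (hχ.neg_log_mem_Icc x).2
    simpa using this
  have hmid : ∫ x in ρ..(2 * π - ρ), -log (1 - χ ρ x / 2) = 0 := by
    rw [intervalIntegral.integral_congr (g := fun _ => 0), intervalIntegral.integral_zero]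
    intro x hx
    rw [Set.uIcc_of_le (by linarith)] at hx
    have : χ ρ x = 0 := by
      refine hχ.eq_zero h0 ?_
      rw [nd_eq]
      set m : ℤ := round (x / (2 * π))
      have h2 : 0 ≤ ρ := h0.le
      rcases le_or_gt m 0 with hm | hm
      · have : (m : ℝ) ≤ 0 := by exact_mod_cast hm
        refine le_trans ?_ (le_abs_self _)
        nlinarith [hx.1]
      · have : (1 : ℝ) ≤ m := by exact_mod_cast hm
        refine le_trans ?_ (neg_le_abs _)
        nlinarith [hx.2]
    simp [this]
  rw [meanDrop_eq, ← intervalIntegral.integral_add_adjacent_intervals (hI 0 ρ) (hI ρ _),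
    ← intervalIntegral.integral_add_adjacent_intervals (hI ρ (2 * π - ρ)) (hI _ _), hmid]
  have h1 := hbd 0 ρ h0.le
  have h2 := hbd (2 * π - ρ) (2 * π) (by linarith)
  rw [inv_mul_le_iff₀ (by positivity)]
  have : log 2 ≤ 1 := by linarith [log_two_lt_d9]
  nlinarith

end IsBumpFamily

theorem meanLog_seqA {s C ω c : ℝ} {χ : ℝ → ℝ → ℝ} {r : ℕ → ℝ} {N : ℕ → ℕ} (S : Sched ω c r N)
    (hχ : IsBumpFamily s C χ) (j : ℕ) :
    meanLog (seqA ω χ r N j) = log 64 - ∑ i ∈ Finset.range j, 2 ^ i * meanDrop χ (r i) := by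
  have := pi_pos
  induction j with
  | zero =>
    simp only [meanLog, seqA, intervalIntegral.integral_const, Finset.range_zero, Finset.sum_empty,
      smul_eq_mul]
    field_simp
    ring
  | succ j ih =>
    rw [Finset.sum_range_succ, ← sub_sub, ← ih, meanLog, meanLog,
      integral_log_seqA_succ S hχ, meanDrop]
    ring

/-! ### Choice of the radii -/

/-- Radii decreasing geometrically with ratio `β`, except for the indices in `[n, J)`, where the
ratio is `3 / 4`. -/
def radii (β r₀ : ℝ) (n J : ℕ) : ℕ → ℝ
  | 0 => r₀
  | j + 1 => radii β r₀ n J j * if n ≤ j ∧ j < J then 3 / 4 else β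

section Radii

variable {β r₀ : ℝ} {n J j : ℕ}

theorem radii_of_le (h : j ≤ n) : radii β r₀ n J j = r₀ * β ^ j := by
  induction j with
  | zero => simp [radii]
  | succ j ih =>
    rw [radii, ih (by omega), if_neg (by omega), pow_succ, mul_assoc]

theorem radii_add (m : ℕ) : radii β r₀ n (n + m) (n + m) = r₀ * β ^ n * (3 / 4) ^ m := by
  have h : ∀ k ≤ m, radii β r₀ n (n + m) (n + k) = r₀ * β ^ n * (3 / 4) ^ k := fun k hk => by
    induction k with
    | zero => simp [radii_of_le]
    | succ k ih =>
      rw [← add_assoc, radii, ih (by omega), if_pos (by omega), pow_succ, mul_assoc]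
  exact h m le_rfl

theorem exists_radii_mem_Icc (hβ : 0 < β) (hβ2 : β < 1 / 2) (h0 : 0 < r₀) (n : ℕ) :
    ∃ J, n ≤ J ∧ 2 ^ J * radii β r₀ n J J ∈ Set.Icc r₀ (3 / 2 * r₀) := by
  have ht : 0 < (2 * β) ^ n := by positivity
  obtain ⟨m, h1, h2⟩ := exists_nat_pow_near (x := ((2 * β) ^ n)⁻¹) (y := (3 / 2 : ℝ))
    ((one_le_inv₀ ht).2 (pow_le_one₀ (by positivity) (by linarith))) (by norm_num)
  refine ⟨n + (m + 1), by omega, ?_⟩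
  have e : 2 ^ (n + (m + 1)) * radii β r₀ n (n + (m + 1)) (n + (m + 1)) =
      r₀ * ((2 * β) ^ n * (3 / 2) ^ (m + 1)) := by
    rw [radii_add, pow_add, mul_pow, show (3 / 2 : ℝ) = 2 * (3 / 4) by norm_num, mul_pow]
    ring
  rw [e]
  rw [inv_lt_iff_one_lt_mul₀' ht] at h2
  rw [le_inv_comm₀ (by positivity) ht, ← one_div, le_div_iff₀ (by positivity)] at h1
  constructor
  · exact le_mul_of_one_le_right h0.le h2.le
  · rw [mul_comm]
    refine mul_le_mul_of_nonneg_right ?_ h0.le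
    rw [pow_succ]
    linarith

theorem radii_pos (hβ : 0 < β) (h0 : 0 < r₀) (n J j : ℕ) : 0 < radii β r₀ n J j := by
  induction j with
  | zero => exact h0
  | succ j ih => rw [radii]; split_ifs <;> positivity

theorem radii_succ_le (hβ : 0 < β) (hβ2 : β < 1 / 2) (h0 : 0 < r₀) (n J j : ℕ) :
    radii β r₀ n J (j + 1) ≤ 3 / 4 * radii β r₀ n J j := by
  have := radii_pos hβ h0 n J j
  rw [radii, mul_comm]
  gcongr
  split_ifs <;> linarith

theorem le_radii (hβ : 0 < β) (hβ2 : β < 1 / 2) (h0 : 0 < r₀) (n J j : ℕ) :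
    r₀ * β ^ j ≤ radii β r₀ n J j := by
  induction j with
  | zero => simp [radii]
  | succ j ih =>
    have := radii_pos hβ h0 n J j
    rw [radii, pow_succ, ← mul_assoc]
    gcongr
    split_ifs <;> linarith

theorem sum_radii_le (hβ : 0 < β) (hβ2 : β < 1 / 2) (h0 : 0 < r₀) (hnJ : n ≤ J)
    (hJ : 2 ^ J * radii β r₀ n J J ≤ 3 / 2 * r₀) (j : ℕ) :
    ∑ i ∈ Finset.range j, 2 ^ i * radii β r₀ n J i ≤ (3 + 5 / 2 * (1 - 2 * β)⁻¹) * r₀ := by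
  set D := (1 - 2 * β)⁻¹ with hD
  have hD0 : 0 < D := inv_pos.2 (by linarith)
  have hD1 : D * (1 - 2 * β) = 1 := inv_mul_cancel₀ (by linarith)
  set g : ℕ → ℝ := fun i => 2 ^ i * radii β r₀ n J i with hg
  have hg0 : ∀ i, 0 < g i := fun i => mul_pos (by positivity) (radii_pos hβ h0 n J i)
  have hgs : ∀ i, ¬(n ≤ i ∧ i < J) → D * g (i + 1) = D * g i - g i := fun i hi => by
    simp only [hg, radii, if_neg hi, pow_succ]
    linear_combination -(2 ^ i * radii β r₀ n J i) * hD1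
  have hgt : ∀ i, n ≤ i ∧ i < J → g (i + 1) = 3 / 2 * g i := fun i hi => by
    simp only [hg, radii, if_pos hi, pow_succ]
    ring
  have h1 : ∀ j, j ≤ n → ∑ i ∈ Finset.range j, g i ≤ D * r₀ - D * g j := by
    intro j hj
    induction j with
    | zero => simp [hg, radii]
    | succ j ih =>
      rw [Finset.sum_range_succ, hgs j (by omega)]
      linarith [ih (by omega)]
  have h2 : ∀ j, n ≤ j → j ≤ J → ∑ i ∈ Finset.range j, g i ≤ D * r₀ + 2 * g j := by
    intro j hnj
    induction j, hnj using Nat.le_induction with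
    | base => intro _; nlinarith [h1 n le_rfl, hg0 n]
    | succ j hj ih =>
      intro hjJ
      rw [Finset.sum_range_succ, hgt j ⟨hj, by omega⟩]
      linarith [ih (by omega)]
  have h3 : ∀ j, J ≤ j → ∑ i ∈ Finset.range j, g i ≤
      D * r₀ + 3 * r₀ + D * (3 / 2 * r₀) - D * g j := by
    intro j hj
    induction j, hj using Nat.le_induction with
    | base => nlinarith [h2 J hnJ le_rfl, hJ, hg0 J]
    | succ j hj ih =>
      rw [Finset.sum_range_succ, hgs j (by omega)]
      linarith
  refine (Finset.sum_le_sum_of_subset_of_nonneg (Finset.range_mono (le_max_left j J))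
    fun i _ _ => (hg0 i).le).trans ((h3 (max j J) (le_max_right _ _)).trans ?_)
  have := mul_pos hD0 (hg0 (max j J))
  linarith

end Radii

/-! ### The limit potential -/

/-- The bounds on the radii `r` under which the construction converges, with total weight `T`. -/
structure GoodRadii (e ρ T : ℝ) (r : ℕ → ℝ) : Prop where
  pos : ∀ j, 0 < r j
  zero_le_one : r 0 ≤ 1
  succ_le : ∀ j, r (j + 1) ≤ 3 / 4 * r j
  sum_le : ∀ j, ∑ i ∈ Finset.range j, 2 ^ i * r i ≤ T
  ge : ∀ j : ℕ, ρ * (2 : ℝ) ^ (-e * (j : ℝ)) ≤ r j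

/-- The successive potentials, with opposite sign. -/
def seqPot (ω : ℝ) (χ : ℝ → ℝ → ℝ) (r : ℕ → ℝ) (j : ℕ) : ℝ → ℝ :=
  pot ω (seqA ω χ r (returnTime ω r) j)

/-- The pointwise limit of the successive potentials, with opposite sign. -/
def limPot (ω : ℝ) (χ : ℝ → ℝ → ℝ) (r : ℕ → ℝ) (x : ℝ) : ℝ :=
  seqPot ω χ r 0 x + ∑' j, (seqPot ω χ r (j + 1) x - seqPot ω χ r j x)

theorem seqPot_congr {ω : ℝ} {χ : ℝ → ℝ → ℝ} {r r' : ℕ → ℝ} {j : ℕ} (h : ∀ i < j, r i = r' i) :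
    seqPot ω χ r j = seqPot ω χ r' j := by
  rw [seqPot, seqPot, seqA_congr h fun i hi => returnTime_congr h hi]

theorem gevreyLe_seqPot_zero (ω : ℝ) (χ : ℝ → ℝ → ℝ) (r : ℕ → ℝ) (s : ℝ) :
    GevreyLe s (seqPot ω χ r 0) (gw s 0 * |64 + 64⁻¹|) :=
  GevreyLe.const s (64 + 64⁻¹)

theorem GevreyLe.sub_of_forall {s : ℝ} {W : ℕ → ℝ → ℝ} {U : ℕ → ℝ} (hW : ∀ j, Smooth (W j))
    (h : ∀ j, GevreyLe s (fun x => W (j + 1) x - W j x) (U j)) (i m : ℕ) :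
    GevreyLe s (fun x => W (i + m) x - W i x) (∑ k ∈ Finset.range m, U (k + i)) := by
  induction m with
  | zero => simpa using GevreyLe.const s 0
  | succ m ih =>
    rw [Finset.sum_range_succ]
    have := ih.add ((hW _).sub (hW _)) ((hW _).sub (hW _)) (h (i + m))
    rw [add_comm m i]
    convert this using 2
    rw [← add_assoc]
    ring

theorem sched_of_goodRadii {ω c e ρ T : ℝ} {r : ℕ → ℝ}
    (hc : ∀ k : ℕ, 1 ≤ k → c / k ≤ nd (k * ω)) (hc0 : 0 < c) (hr : GoodRadii e ρ T r)
    (hT : T ≤ c / 64) : Sched ω c r (returnTime ω r) :=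
  sched_returnTime hc hc0 hr.pos hr.zero_le_one hr.succ_le fun j => by
    have := hr.sum_le j
    simp only [pow_succ _ _, mul_right_comm _ (2 : ℝ) _, ← Finset.sum_mul]
    linarith

section LimPot

variable {s d e ρ T C ω c : ℝ} {χ : ℝ → ℝ → ℝ} {r r' : ℕ → ℝ}
  (hc : ∀ k : ℕ, 1 ≤ k → c / k ≤ nd (k * ω)) (hc0 : 0 < c) (hr : GoodRadii e ρ T r)
  (hT : T ≤ c / 64) (hχ : IsBumpFamily s C χ)

include hc hc0 hr hT hχ

theorem seqPot_contDiff (j : ℕ) : Smooth (seqPot ω χ r j) :=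
  ((sched_of_goodRadii hc hc0 hr hT).seqA_posPer hχ j).pot_contDiff

theorem seqPot_periodic (j : ℕ) : Function.Periodic (seqPot ω χ r j) (2 * π) :=
  ((sched_of_goodRadii hc hc0 hr hT).seqA_posPer hχ j).pot_periodic

theorem limPot_periodic : Function.Periodic (limPot ω χ r) (2 * π) := fun x => by
  simp only [limPot, (seqPot_periodic hc hc0 hr hT hχ _) x]

variable (hs : 1 ≤ s) (hd : 0 < d) (hed : e < d) (hρ : 0 < ρ) (hC : 0 < C)

include hs hd hρ hC

theorem gevreyLe_seqPot_sub (j : ℕ) :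
    GevreyLe (s + d) (fun x => seqPot ω χ r (j + 1) x - seqPot ω χ r j x) (stepSize d e ρ C j) :=
  gevreyLe_pot_sub (sched_of_goodRadii hc hc0 hr hT) hχ hs hc hc0 hd hρ hC hr.ge j

theorem gevreyLe_seqPot_add_sub (i m : ℕ) :
    GevreyLe (s + d) (fun x => seqPot ω χ r (i + m) x - seqPot ω χ r i x)
      (∑ k ∈ Finset.range m, stepSize d e ρ C (k + i)) :=
  GevreyLe.sub_of_forall (seqPot_contDiff hc hc0 hr hT hχ)
    (gevreyLe_seqPot_sub hc hc0 hr hT hχ hs hd hρ hC) i m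

include hed

theorem summable_seqPot_sub (x : ℝ) :
    Summable fun j => seqPot ω χ r (j + 1) x - seqPot ω χ r j x :=
  .of_norm_bounded (summable_stepSize hd hed hρ hC) fun j =>
    (gevreyLe_seqPot_sub hc hc0 hr hT hχ hs hd hρ hC j).abs_le x

theorem tendsto_seqPot (x : ℝ) :
    Tendsto (fun j => seqPot ω χ r j x) atTop (nhds (limPot ω χ r x)) := by
  have := ((summable_seqPot_sub hc hc0 hr hT hχ hs hd hed hρ hC x).hasSum.tendsto_sum_nat).const_add
    (seqPot ω χ r 0 x)
  refine this.congr fun j => ?_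
  rw [Finset.sum_range_sub (fun j => seqPot ω χ r j x)]
  ring

theorem limPot_eq (i : ℕ) : limPot ω χ r = fun x => seqPot ω χ r i x +
    ∑' j, (seqPot ω χ r (j + i + 1) x - seqPot ω χ r (j + i) x) := by
  funext x
  rw [limPot, ← (summable_seqPot_sub hc hc0 hr hT hχ hs hd hed hρ hC x).sum_add_tsum_nat_add i,
    Finset.sum_range_sub (fun j => seqPot ω χ r j x)]
  ring

theorem limPot_contDiff : Smooth (limPot ω χ r) := by
  have hW := seqPot_contDiff hc hc0 hr hT hχ
  exact (hW 0).add (contDiff_tsum_of_gevreyLe (fun j => (hW (j + 1)).sub (hW j))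
    (gevreyLe_seqPot_sub hc hc0 hr hT hχ hs hd hρ hC) (summable_stepSize hd hed hρ hC))

theorem gevreyLe_limPot_sub (i : ℕ) :
    GevreyLe (s + d) (fun x => limPot ω χ r x - seqPot ω χ r i x)
      (∑' k, stepSize d e ρ C (k + i)) := by
  have hW := seqPot_contDiff hc hc0 hr hT hχ
  have := GevreyLe.tsum (fun j => (hW (j + i + 1)).sub (hW (j + i)))
    (fun j => gevreyLe_seqPot_sub hc hc0 hr hT hχ hs hd hρ hC (j + i))
    ((summable_nat_add_iff i).2 (summable_stepSize hd hed hρ hC))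
  convert this using 2
  rw [limPot_eq hc hc0 hr hT hχ hs hd hed hρ hC i]
  ring

theorem exists_gevreyLe_seqPot : ∃ u, ∀ j, GevreyLe (s + d) (seqPot ω χ r j) u := by
  have hW := seqPot_contDiff hc hc0 hr hT hχ
  have hu := gevreyLe_seqPot_zero ω χ r (s + d)
  refine ⟨gw (s + d) 0 * |64 + 64⁻¹| + ∑' k, stepSize d e ρ C k, fun j => ?_⟩
  have h := hu.add (hW 0) ((hW _).sub (hW 0))
    (gevreyLe_seqPot_add_sub hc hc0 hr hT hχ hs hd hρ hC 0 j)
  simp only [zero_add, add_zero, add_sub_cancel] at h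
  exact h.mono (by
    gcongr
    exact (summable_stepSize hd hed hρ hC).sum_le_tsum _ fun k _ => stepSize_nonneg _ _ _ _ k)

theorem exists_gevreyLe_limPot : ∃ u, GevreyLe (s + d) (limPot ω χ r) u := by
  have hW := seqPot_contDiff hc hc0 hr hT hχ
  have hu := gevreyLe_seqPot_zero ω χ r (s + d)
  have h := hu.add (hW 0) ((limPot_contDiff hc hc0 hr hT hχ hs hd hed hρ hC).sub (hW 0))
    (gevreyLe_limPot_sub hc hc0 hr hT hχ hs hd hed hρ hC 0)
  simp only [add_sub_cancel] at h
  exact ⟨_, h⟩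

theorem gevreyLe_seqPot_sub_limPot (hr' : GoodRadii e ρ T r') {i : ℕ} (h : ∀ k < i, r' k = r k)
    {j : ℕ} (hij : i ≤ j) :
    GevreyLe (s + d) (fun x => seqPot ω χ r' j x - limPot ω χ r x)
      (2 * ∑' k, stepSize d e ρ C (k + i)) := by
  have hW := seqPot_contDiff hc hc0 hr hT hχ
  have hW' := seqPot_contDiff hc hc0 hr' hT hχ
  have hL := limPot_contDiff hc hc0 hr hT hχ hs hd hed hρ hC
  obtain ⟨m, rfl⟩ := Nat.exists_eq_add_of_le hij
  have := GevreyLe.sub ((hW' (i + m)).sub (hW' i)) (hL.sub (hW i))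
    (gevreyLe_seqPot_add_sub hc hc0 hr' hT hχ hs hd hρ hC i m)
    (gevreyLe_limPot_sub hc hc0 hr hT hχ hs hd hed hρ hC i)
  simp only [seqPot_congr (ω := ω) (χ := χ) h, sub_sub_sub_cancel_right] at this
  refine this.mono ?_
  rw [two_mul]
  gcongr
  exact ((summable_nat_add_iff i).2 (summable_stepSize hd hed hρ hC)).sum_le_tsum _
    fun k _ => stepSize_nonneg _ _ _ _ _

end LimPot

/-! ### Discontinuity -/

theorem GoodRadii.le_one {e ρ T : ℝ} {r : ℕ → ℝ} (hr : GoodRadii e ρ T r) (j : ℕ) : r j ≤ 1 :=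
  (antitone_nat_of_succ_le (fun j => (hr.succ_le j).trans (by linarith [hr.pos j]))
    (Nat.zero_le j)).trans hr.zero_le_one

section Drop

variable {s e ρ T C : ℝ} {χ : ℝ → ℝ → ℝ} {r : ℕ → ℝ}
  (hr : GoodRadii e ρ T r) (hχ : IsBumpFamily s C χ)
include hr hχ

theorem sum_meanDrop_le (j : ℕ) : ∑ i ∈ Finset.range j, 2 ^ i * meanDrop χ (r i) ≤ T :=
  (Finset.sum_le_sum fun i _ => mul_le_mul_of_nonneg_left
    (hχ.meanDrop_le (hr.pos i) (hr.le_one i)) (by positivity)).trans (hr.sum_le j)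

theorem summable_meanDrop : Summable fun i => 2 ^ i * meanDrop χ (r i) :=
  summable_of_sum_range_le (fun i => mul_nonneg (by positivity) (hχ.meanDrop_nonneg _))
    (sum_meanDrop_le hr hχ)

end Drop

theorem goodRadii_radii {e β r₀ T : ℝ} (hβ : β = 2 ^ (-e)) (hβ2 : β < 1 / 2) (h0 : 0 < r₀)
    (h1 : r₀ ≤ 1) (hT : (3 + 5 / 2 * (1 - 2 * β)⁻¹) * r₀ ≤ T) {n J : ℕ} (hnJ : n ≤ J)
    (hJ : 2 ^ J * radii β r₀ n J J ≤ 3 / 2 * r₀) : GoodRadii e r₀ T (radii β r₀ n J) := by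
  have hβ0 : 0 < β := by rw [hβ]; positivity
  refine ⟨radii_pos hβ0 h0 n J, h1, radii_succ_le hβ0 hβ2 h0 n J,
    fun j => (sum_radii_le hβ0 hβ2 h0 hnJ hJ j).trans hT, fun j => ?_⟩
  rw [rpow_mul (by norm_num), rpow_natCast, ← hβ]
  exact le_radii hβ0 hβ2 h0 n J j

/-- **Discontinuity of the Lyapunov exponent in `G^s`, `s > 2`** (Theorem 1.1, part (2)).
If `α` is irrational of bounded type and `s > 2`, then there are `v₀ ∈ G^s(𝕊¹)`, an energy
`E`, a constant `K > 0` and `v_n ∈ G^{s,K}(𝕊¹)` with `|v_n − v₀|_{s,K} → 0`, for which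
`L(S_{E,v_n})` does not converge to `L(S_{E,v₀})`. -/
theorem lyapunov_discontinuous_gevrey_gt_two
    (α M : ℝ) (hα : Irrational α) (hM : 0 < M) (hbdd : BoundedType α M)
    (s : ℝ) (hs : 2 < s) :
    ∃ (v₀ : ℝ → ℝ) (E K : ℝ) (vseq : ℕ → ℝ → ℝ),
      GevreyCircle s v₀ ∧ 0 < K ∧
      (∀ n, ContDiff ℝ (⊤ : ℕ∞) (vseq n) ∧ Function.Periodic (vseq n) (2 * π) ∧
        gevreyNorm s K (vseq n) < ⊤) ∧
      Tendsto (fun n => gevreyNorm s K (fun x => vseq n x - v₀ x)) atTop (nhds 0) ∧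
      ¬ Tendsto (fun n => lyapunovExp α (schrodingerMap E (vseq n))) atTop
          (nhds (lyapunovExp α (schrodingerMap E v₀))) := by
  obtain ⟨c, hc0, hc⟩ := exists_nd_lower_bound hα hM hbdd
  obtain ⟨d, rfl⟩ : ∃ d, s = d + d := ⟨s / 2, by ring⟩
  have hd1 : 1 < d := by linarith
  have hd : 0 < d := by linarith
  obtain ⟨C, χ, hC, hχ⟩ := exists_isBumpFamily hd1
  obtain ⟨e, he1, hed⟩ := exists_between hd1
  set ω := 2 * π * α
  obtain ⟨β, hβ⟩ : ∃ β : ℝ, β = 2 ^ (-e) := ⟨_, rfl⟩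
  have hβ0 : 0 < β := by rw [hβ]; positivity
  have hβ2 : β < 1 / 2 := by
    rw [hβ, one_div, ← rpow_neg_one]
    exact rpow_lt_rpow_of_exponent_lt (by norm_num) (by linarith)
  have hD : 0 < 3 + 5 / 2 * (1 - 2 * β)⁻¹ := by
    have := inv_pos.2 (by linarith : 0 < 1 - 2 * β)
    positivity
  have hlog : 0 < log 64 := log_pos (by norm_num)
  obtain ⟨T, hT0, hTc, hTl⟩ : ∃ T, 0 < T ∧ T ≤ c / 64 ∧ T ≤ log 64 :=
    ⟨min (c / 64) (log 64), by positivity, min_le_left _ _, min_le_right _ _⟩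
  obtain ⟨ρ, hρ, hρ1, hρT⟩ :
      ∃ ρ, 0 < ρ ∧ ρ ≤ 1 ∧ (3 + 5 / 2 * (1 - 2 * β)⁻¹) * ρ ≤ T :=
    ⟨min 1 (T / (3 + 5 / 2 * (1 - 2 * β)⁻¹)), by positivity, min_le_left _ _,
      (le_div_iff₀' hD).1 (min_le_right _ _)⟩
  choose J hnJ hJ using fun n => exists_radii_mem_Icc hβ0 hβ2 hρ n
  set r := radii β ρ 0 0 with hrdef
  set R := fun n => radii β ρ n (J n)
  have hr : GoodRadii e ρ T r :=
    goodRadii_radii hβ hβ2 hρ hρ1 hρT le_rfl (by simp only [radii]; linarith)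
  have hR : ∀ n, GoodRadii e ρ T (R n) := fun n =>
    goodRadii_radii hβ hβ2 hρ hρ1 hρT (hnJ n) (hJ n).2
  have hagree : ∀ n, ∀ k < n + 1, R n k = r k := fun n k hk => by
    refine (radii_of_le (Nat.lt_succ_iff.1 hk)).trans ?_
    clear hk
    induction k with
    | zero => simp [hrdef, radii]
    | succ k ih =>
      rw [hrdef, radii, ← hrdef, ← ih, if_neg (by omega), pow_succ, mul_assoc]
  have hl := limPot_contDiff hc hc0 hr hTc hχ hd1.le hd hed hρ hC
  have hlper := limPot_periodic hc hc0 hr hTc hχ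
  obtain ⟨u, hu⟩ := exists_gevreyLe_limPot hc hc0 hr hTc hχ hd1.le hd hed hρ hC
  have hneg : ∀ {f : ℝ → ℝ}, Function.Periodic f (2 * π) →
      Function.Periodic (fun x => -f x) (2 * π) := fun hf x => by simp only [hf x]
  refine ⟨fun x => -limPot ω χ r x, 0, 1, fun n x => -seqPot ω χ (R n) (J n + 1) x,
    ⟨hl.neg, hneg hlper, 1, one_pos, hu.neg.gevreyNorm_le.trans_lt ENNReal.ofReal_lt_top⟩, one_pos,
    fun n => ⟨(seqPot_contDiff hc hc0 (hR n) hTc hχ _).neg,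
      hneg (seqPot_periodic hc hc0 (hR n) hTc hχ _), ?_⟩, ?_, fun hlim => ?_⟩
  · obtain ⟨u', hu'⟩ := exists_gevreyLe_seqPot hc hc0 (hR n) hTc hχ hd1.le hd hed hρ hC
    exact (hu' _).neg.gevreyNorm_le.trans_lt ENNReal.ofReal_lt_top
  · have h0 : Tendsto (fun n => ENNReal.ofReal (2 * ∑' k, stepSize d e ρ C (k + (n + 1)))) atTop
        (nhds 0) := by
      have := ((tendsto_sum_nat_add (stepSize d e ρ C)).comp (tendsto_add_atTop_nat 1)).const_mul 2
      rw [mul_zero] at this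
      simpa using ENNReal.tendsto_ofReal this
    refine tendsto_of_tendsto_of_tendsto_of_le_of_le tendsto_const_nhds h0 (fun _ => zero_le)
      fun n => ?_
    simpa only [neg_sub, neg_sub_neg] using
      (gevreyLe_seqPot_sub_limPot hc hc0 hr hTc hχ hd1.le hd hed hρ hC (hR n) (hagree n)
        (Nat.succ_le_succ (hnJ n))).neg.gevreyNorm_le
  · have hS := summable_meanDrop hr hχ
    have hpi := pi_pos
    have hl2 := log_pos one_lt_two
    obtain ⟨B, hB⟩ := exists_gevreyLe_seqPot hc hc0 hr hTc hχ hd1.le hd hed hρ hC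
    have hlow : log 64 - ∑' i, 2 ^ i * meanDrop χ (r i) ≤
        lyapunovExp α (schrodingerMap 0 fun x => -limPot ω χ r x) := by
      have S := sched_of_goodRadii hc hc0 hr hTc
      refine le_lyapunovExp (S.seqA_posPer hχ) (fun j x => rfl) (fun j x => (hB j).abs_le x)
        (tendsto_seqPot hc hc0 hr hTc hχ hd1.le hd hed hρ hC) fun j => ?_
      rw [meanLog_seqA S hχ]
      gcongr
      exact hS.sum_le_tsum _ fun i _ => mul_nonneg (by positivity) (hχ.meanDrop_nonneg _)
    have hup : ∀ n, lyapunovExp α (schrodingerMap 0 fun x => -seqPot ω χ (R n) (J n + 1) x) ≤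
        log 64 - ∑ i ∈ Finset.range n, 2 ^ i * meanDrop χ (r i) - 3 * log 2 / (8 * π) * ρ :=
      fun n => by
        have S := sched_of_goodRadii hc hc0 (hR n) hTc
        have hm := meanLog_seqA S hχ (J n + 1)
        refine (lyapunovExp_le_meanLog hα (S.seqA_posPer hχ (J n + 1)) ?_).trans ?_
        · rw [hm]
          linarith [sum_meanDrop_le (hR n) hχ (J n + 1)]
        · rw [hm, Finset.sum_range_succ]
          have h1 : ∑ i ∈ Finset.range n, 2 ^ i * meanDrop χ (r i) ≤
              ∑ i ∈ Finset.range (J n), 2 ^ i * meanDrop χ (R n i) := by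
            rw [Finset.sum_congr rfl fun i hi => by
              rw [← hagree n i ((Finset.mem_range.1 hi).trans n.lt_succ_self)]]
            exact Finset.sum_le_sum_of_subset_of_nonneg (Finset.range_mono (hnJ n)) fun i _ _ =>
              mul_nonneg (by positivity) (hχ.meanDrop_nonneg _)
          have h2 : 3 * log 2 / (8 * π) * ρ ≤ 2 ^ J n * meanDrop χ (R n (J n)) := by
            calc _ ≤ 3 * log 2 / (8 * π) * (2 ^ J n * R n (J n)) := by
                  gcongr
                  exact (hJ n).1
              _ = 2 ^ J n * (3 * log 2 / (8 * π) * R n (J n)) := by ring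
              _ ≤ _ := by
                  gcongr
                  exact hχ.le_meanDrop ((hR n).pos _) ((hR n).le_one _)
          linarith
    have := le_of_tendsto_of_tendsto' hlim
      ((hS.hasSum.tendsto_sum_nat.const_sub (log 64)).sub_const _) hup
    have : 0 < 3 * log 2 / (8 * π) * ρ := by positivity
    linarith

end
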